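/- arXiv:1308.3143 — 3 statements merged into one kernel-verified Lean document; each statement's English description precedes it below -/
import Mathlib

section
/- Suppose E = ⋃_{i=1}^m (g_i E/n + b_i) ∈ Λ is the self-similar set generated by the similitudes S_i(x) = g_i(x)/n + b_i (g_i ∈ 𝔾, b_i ∈ Γ, i = 1,…,m), and suppose E is totally disconnected and has no complete overlaps. Then E is bilipschitz equivalent to the symbolic space Σ_m^{1/n}. -/
open scoped Classical

/-- The symbolic space metric on `ℕ → Fin m`: `d(x,y) = r ^ (min {k | x k ≠ y k})`
for `x ≠ y`, and `d(x,x) = 0`. -/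
noncomputable def symbDist (r : ℝ) {m : ℕ} (x y : ℕ → Fin m) : ℝ :=
  if x = y then 0 else r ^ sInf {k : ℕ | x k ≠ y k}

/-- `K` (a subset of a metric space) is bilipschitz equivalent to the symbolic
space `Σ_m^r`. -/
def BilipWithSymb {X : Type*} [MetricSpace X] (K : Set X) (m : ℕ) (r : ℝ) : Prop :=
  ∃ f : K → (ℕ → Fin m), Function.Bijective f ∧ ∃ C : ℝ, 1 ≤ C ∧ ∀ x y : K,
    C⁻¹ * dist x y ≤ symbDist r (f x) (f y) ∧ symbDist r (f x) (f y) ≤ C * dist x y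

/-- `K ⊆ X` and `K' ⊆ X'` are bilipschitz equivalent (as metric spaces with the
induced metrics). -/
def BilipEquivSets {X Y : Type*} [MetricSpace X] [MetricSpace Y]
    (K : Set X) (K' : Set Y) : Prop :=
  ∃ f : K → K', Function.Bijective f ∧ ∃ C : ℝ, 1 ≤ C ∧ ∀ x y : K,
    C⁻¹ * dist x y ≤ dist (f x) (f y) ∧ dist (f x) (f y) ≤ C * dist x y

/-- Dust-like graph-directed sets with ratio `r` on a directed graph with `p`
vertices, where `a i j` is the number of edges from `i` to `j`:
nonempty compact sets `K i` with `K i = ⋃_j ⋃_{e : Fin (a i j)} S i j e '' (K j)`,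
the union being pairwise disjoint, each `S i j e` a similitude of ratio `r`. -/
structure GraphDirected (X : Type*) [MetricSpace X] (p : ℕ) (r : ℝ) where
  a : Fin p → Fin p → ℕ
  S : ∀ i j : Fin p, Fin (a i j) → X → X
  sim : ∀ i j e x y, dist (S i j e x) (S i j e y) = r * dist x y
  K : Fin p → Set X
  nonempty : ∀ i, (K i).Nonempty
  compact : ∀ i, IsCompact (K i)
  union : ∀ i, K i = ⋃ j, ⋃ e, S i j e '' K j
  disj : ∀ i : Fin p, ∀ j j' : Fin p, ∀ e : Fin (a i j), ∀ e' : Fin (a i j'),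
    (⟨j, e⟩ : Σ j, Fin (a i j)) ≠ ⟨j', e'⟩ →
    Disjoint (S i j e '' K j) (S i j' e' '' K j')

/-- The family has integer characteristic `m`: there is a positive vector `v`
with `A v = m v`, `A` being the adjacency matrix. -/
def GraphDirected.HasCharacteristic {X : Type*} [MetricSpace X] {p : ℕ} {r : ℝ}
    (G : GraphDirected X p r) (m : ℕ) : Prop :=
  ∃ v : Fin p → ℝ, (∀ i, 0 < v i) ∧ ∀ i, ∑ j, (G.a i j : ℝ) * v j = (m : ℝ) * v i

/-- `K` belongs to the class `𝔄_m^r`: `K = K_1` for some dust-like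
graph-directed sets `{K_1, …, K_p}` with ratio `r` and integer characteristic `m`. -/
def MemGDClass {X : Type*} [MetricSpace X] (K : Set X) (r : ℝ) (m : ℕ) : Prop :=
  ∃ (p : ℕ) (hp : 0 < p) (G : GraphDirected X p r),
    G.HasCharacteristic m ∧ K = G.K ⟨0, hp⟩

/-- Composition `S_{i₁} ∘ ⋯ ∘ S_{i_t}` of the maps of an IFS along a word. -/
def wordMap {X : Type*} {m : ℕ} (S : Fin m → X → X) : List (Fin m) → X → X
  | [] => id
  | i :: w => S i ∘ wordMap S w

/-- The IFS `S` has complete overlaps: there are two distinct (nonempty) words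
`i₁⋯i_t` and `j₁⋯j_{t'}` with `S_{i₁} ∘ ⋯ ∘ S_{i_t} = S_{j₁} ∘ ⋯ ∘ S_{j_{t'}}`. -/
def HasCompleteOverlaps {X : Type*} {m : ℕ} (S : Fin m → X → X) : Prop :=
  ∃ w w' : List (Fin m), w ≠ [] ∧ w' ≠ [] ∧ w ≠ w' ∧ wordMap S w = wordMap S w'

/-! ### Part 1 : approximate bilipschitz relations -/
def ARel {α β : Type*} [MetricSpace α] [MetricSpace β] (C ε : ℝ) (U : Set α) (V : Set β) : Prop :=
  ∃ R : α → β → Prop, (∀ x ∈ U, ∃ y ∈ V, R x y) ∧ (∀ y ∈ V, ∃ x ∈ U, R x y) ∧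
    ∀ x ∈ U, ∀ x' ∈ U, ∀ y ∈ V, ∀ y' ∈ V, R x y → R x' y' →
      dist x x' ≤ C * dist y y' + ε ∧ dist y y' ≤ C * dist x x' + ε

theorem ARel.symm {α β : Type*} [MetricSpace α] [MetricSpace β] {C ε : ℝ} {U : Set α} {V : Set β}
    (h : ARel C ε U V) : ARel C ε V U := by
  obtain ⟨R, h1, h2, h3⟩ := h
  exact ⟨fun y x => R x y, h2, h1, fun y hy y' hy' x hx x' hx' a b =>
    (h3 x hx x' hx' y hy y' hy' a b).symm⟩

theorem ARel.trans {α β γ : Type*} [MetricSpace α] [MetricSpace β] [MetricSpace γ]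
    {C C' : ℝ} (hC : 0 ≤ C) (hC' : 0 ≤ C') {U : Set α} {V : Set β} {W : Set γ}
    (h : ARel C 0 U V) (h' : ARel C' 0 V W) : ARel (C * C') 0 U W := by
  obtain ⟨R, h1, h2, h3⟩ := h
  obtain ⟨R', h1', h2', h3'⟩ := h'
  refine ⟨fun x z => ∃ y ∈ V, R x y ∧ R' y z, ?_, ?_, ?_⟩
  · intro x hx
    obtain ⟨y, hy, hxy⟩ := h1 x hx
    obtain ⟨z, hz, hyz⟩ := h1' y hy
    exact ⟨z, hz, y, hy, hxy, hyz⟩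
  · intro z hz
    obtain ⟨y, hy, hyz⟩ := h2' z hz
    obtain ⟨x, hx, hxy⟩ := h2 y hy
    exact ⟨x, hx, y, hy, hxy, hyz⟩
  · rintro x hx x' hx' z hz z' hz' ⟨y, hy, a, b⟩ ⟨y', hy', a', b'⟩
    obtain ⟨e1, e2⟩ := h3 x hx x' hx' y hy y' hy' a a'
    obtain ⟨f1, f2⟩ := h3' y hy y' hy' z hz z' hz' b b'
    have g1 := mul_le_mul_of_nonneg_left f1 hC
    have g2 := mul_le_mul_of_nonneg_left e2 hC'
    constructor <;> nlinarith

theorem ARel.mono {α β : Type*} [MetricSpace α] [MetricSpace β] {C C' ε : ℝ} (hC : C ≤ C')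
    {U : Set α} {V : Set β} (h : ARel C ε U V) : ARel C' ε U V := by
  obtain ⟨R, h1, h2, h3⟩ := h
  refine ⟨R, h1, h2, fun x hx x' hx' y hy y' hy' a b => ?_⟩
  obtain ⟨e1, e2⟩ := h3 x hx x' hx' y hy y' hy' a b
  have := mul_le_mul_of_nonneg_right hC (dist_nonneg (x := x) (y := x'))
  have := mul_le_mul_of_nonneg_right hC (dist_nonneg (x := y) (y := y'))
  constructor <;> linarith

theorem ARel.mono_eps {α β : Type*} [MetricSpace α] [MetricSpace β] {C ε ε' : ℝ} (hC : ε ≤ ε')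
    {U : Set α} {V : Set β} (h : ARel C ε U V) : ARel C ε' U V := by
  obtain ⟨R, h1, h2, h3⟩ := h
  refine ⟨R, h1, h2, fun x hx x' hx' y hy y' hy' a b => ?_⟩
  obtain ⟨e1, e2⟩ := h3 x hx x' hx' y hy y' hy' a b
  constructor <;> linarith

open Filter Topology in
theorem ARel.limit {α β : Type*} [MetricSpace α] [MetricSpace β] {C : ℝ}
    {U : Set α} {V : Set β} (hU : IsCompact U) (hV : IsCompact V) {e : ℕ → ℝ}
    (he : Tendsto e atTop (𝓝 0))
    (h : ∀ N : ℕ, ARel C (e N) U V) : ARel C 0 U V := by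
  choose R h1 h2 h3 using h
  let F : Ultrafilter ℕ := Ultrafilter.of atTop
  have hF : (F : Filter ℕ) ≤ atTop := Ultrafilter.of_le atTop
  have key : ∀ {γ : Type _} [MetricSpace γ] {W : Set γ}, IsCompact W → ∀ s : ℕ → γ, (∀ N, s N ∈ W) →
      ∃ z ∈ W, Tendsto s F (𝓝 z) := by
    intro γ _ W hW s hs
    obtain ⟨z, hz, hz'⟩ := hW.ultrafilter_le_nhds (F.map s) (by
      simp only [Filter.le_principal_iff]
      exact Filter.mem_map.2 (Filter.univ_mem' hs))
    exact ⟨z, hz, hz'⟩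
  have key' : ∀ s : ℕ → β, (∀ N, s N ∈ V) → ∃ z ∈ V, Tendsto s F (𝓝 z) := by
    intro s hs
    obtain ⟨z, hz, hz'⟩ := hV.ultrafilter_le_nhds (F.map s) (by
      simp only [Filter.le_principal_iff]
      exact Filter.mem_map.2 (Filter.univ_mem' hs))
    exact ⟨z, hz, hz'⟩
  refine ⟨fun x y => ∃ (s : ℕ → α) (t : ℕ → β), (∀ N, s N ∈ U) ∧ (∀ N, t N ∈ V) ∧
    (∀ N, R N (s N) (t N)) ∧ Tendsto s F (𝓝 x) ∧ Tendsto t F (𝓝 y), ?_, ?_, ?_⟩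
  · intro x hx
    choose t ht ht' using fun N => h1 N x hx
    obtain ⟨y, hy, hy'⟩ := key' t ht
    exact ⟨y, hy, fun _ => x, t, fun _ => hx, ht, ht', tendsto_const_nhds, hy'⟩
  · intro y hy
    choose s hs hs' using fun N => h2 N y hy
    obtain ⟨x, hx, hx'⟩ := key hU s hs
    exact ⟨x, hx, s, fun _ => y, hs, fun _ => hy, hs', hx', tendsto_const_nhds⟩
  · rintro x hx x' hx' y hy y' hy' ⟨s, t, hs, ht, hst, sx, ty⟩ ⟨s', t', hs', ht', hst', sx', ty'⟩
    have e0 : Tendsto e F (𝓝 0) := he.mono_left hF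
    have d1 := sx.dist sx'
    have d2 := ty.dist ty'
    constructor
    · exact le_of_tendsto_of_tendsto' d1 ((d2.const_mul C).add e0)
        (fun N => (h3 N _ (hs N) _ (hs' N) _ (ht N) _ (ht' N) (hst N) (hst' N)).1)
    · exact le_of_tendsto_of_tendsto' d2 ((d1.const_mul C).add e0)
        (fun N => (h3 N _ (hs N) _ (hs' N) _ (ht N) _ (ht' N) (hst N) (hst' N)).2)

/-- gluing -/
theorem ARel.glue {α β : Type*} [MetricSpace α] [MetricSpace β] {C ε D c : ℝ} (hc : 0 < c)
    (hε : 0 ≤ ε) (hC : D / c ≤ C)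
    {ι : Type*} (U : ι → Set α) (V : ι → Set β)
    (hU : ∀ x ∈ ⋃ i, U i, ∀ x' ∈ ⋃ i, U i, dist x x' ≤ D)
    (hV : ∀ x ∈ ⋃ i, V i, ∀ x' ∈ ⋃ i, V i, dist x x' ≤ D)
    (sU : ∀ i j, i ≠ j → ∀ x ∈ U i, ∀ x' ∈ U j, c ≤ dist x x')
    (sV : ∀ i j, i ≠ j → ∀ x ∈ V i, ∀ x' ∈ V j, c ≤ dist x x')
    (h : ∀ i, ARel C ε (U i) (V i)) : ARel C ε (⋃ i, U i) (⋃ i, V i) := by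
  choose R h1 h2 h3 using h
  refine ⟨fun x y => ∃ i, x ∈ U i ∧ y ∈ V i ∧ R i x y, ?_, ?_, ?_⟩
  · intro x hx
    obtain ⟨i, hi⟩ := Set.mem_iUnion.1 hx
    obtain ⟨y, hy, hxy⟩ := h1 i x hi
    exact ⟨y, Set.mem_iUnion.2 ⟨i, hy⟩, i, hi, hy, hxy⟩
  · intro y hy
    obtain ⟨i, hi⟩ := Set.mem_iUnion.1 hy
    obtain ⟨x, hx, hxy⟩ := h2 i y hi
    exact ⟨x, Set.mem_iUnion.2 ⟨i, hx⟩, i, hx, hi, hxy⟩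
  · rintro x hx x' hx' y hy y' hy' ⟨i, a1, a2, a3⟩ ⟨j, b1, b2, b3⟩
    by_cases hij : i = j
    · subst hij
      exact h3 i x a1 x' b1 y a2 y' b2 a3 b3
    · have q1 := sU i j hij x a1 x' b1
      have q2 := sV i j hij y a2 y' b2
      have q3 := hU x hx x' hx'
      have q4 := hV y hy y' hy'
      have hD : D ≤ C * c := by rwa [div_le_iff₀ hc] at hC
      have hC0 : 0 ≤ C := by
        by_contra hneg
        push Not at hneg
        nlinarith
      have := mul_le_mul_of_nonneg_left q1 hC0
      have := mul_le_mul_of_nonneg_left q2 hC0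
      constructor <;> linarith

/-- the bisimulation lemma -/
theorem bisim {α β : Type*} [MetricSpace α] [MetricSpace β] {r D c C₀ : ℝ}
    (hr : 0 < r) (hr1 : r < 1) (hc : 0 < c) (hD : 0 ≤ D)
    (P : ℕ → Set α → Set β → Prop)
    (hne : ∀ k U V, P k U V → U.Nonempty ∧ V.Nonempty ∧ IsCompact U ∧ IsCompact V)
    (hdU : ∀ k U V, P k U V → ∀ x ∈ U, ∀ x' ∈ U, dist x x' ≤ D * r ^ k)
    (hdV : ∀ k U V, P k U V → ∀ x ∈ V, ∀ x' ∈ V, dist x x' ≤ D * r ^ k)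
    (step : ∀ k U V, P k U V → ∃ (ι : Type) (U' : ι → Set α) (V' : ι → Set β),
      U = ⋃ i, U' i ∧ V = ⋃ i, V' i ∧
      (∀ i j, i ≠ j → ∀ x ∈ U' i, ∀ x' ∈ U' j, c * r ^ k ≤ dist x x') ∧
      (∀ i j, i ≠ j → ∀ x ∈ V' i, ∀ x' ∈ V' j, c * r ^ k ≤ dist x x') ∧
      ∀ i, (∃ k' > k, P k' (U' i) (V' i)) ∨ ARel C₀ 0 (U' i) (V' i)) :
    ∃ C, 0 < C ∧ ∀ k U V, P k U V → ARel C 0 U V := by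
  refine ⟨max 1 (max C₀ (D / c)), by positivity, ?_⟩
  set C := max 1 (max C₀ (D / c)) with hCdef
  have hC1 : 1 ≤ C := le_max_left _ _
  have hC2 : C₀ ≤ C := (le_max_left _ _).trans (le_max_right _ _)
  have hC3 : D / c ≤ C := (le_max_right _ _).trans (le_max_right _ _)
  have main : ∀ N j k U V, N ≤ k + j → P k U V → ARel C (D * r ^ N) U V := by
    intro N j
    induction j with
    | zero =>
      intro k U V hk hP
      obtain ⟨⟨x0, hx0⟩, ⟨y0, hy0⟩, -, -⟩ := hne k U V hP
      have hpow : D * r ^ k ≤ D * r ^ N :=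
        mul_le_mul_of_nonneg_left (pow_le_pow_of_le_one hr.le hr1.le (by omega)) hD
      refine ⟨fun _ _ => True, fun x _ => ⟨y0, hy0, trivial⟩, fun y _ => ⟨x0, hx0, trivial⟩, ?_⟩
      intro x hx x' hx' y hy y' hy' _ _
      have a1 := hdU k U V hP x hx x' hx'
      have a2 := hdV k U V hP y hy y' hy'
      have b1 : 0 ≤ C * dist x x' := by positivity
      have b2 : 0 ≤ C * dist y y' := by positivity
      constructor <;> linarith
    | succ j ih =>
      intro k U V hk hP
      obtain ⟨ι, U', V', rfl, rfl, sU, sV, hi⟩ := step k U V hP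
      have hrk : 0 < r ^ k := by positivity
      refine ARel.glue (c := c * r ^ k) (D := D * r ^ k) (by positivity) (by positivity) ?_ U' V'
        (hdU _ _ _ hP) (hdV _ _ _ hP) sU sV ?_
      · rwa [mul_div_mul_right _ _ hrk.ne']
      · intro i
        rcases hi i with ⟨k', hk', hP'⟩ | h
        · exact ih k' _ _ (by omega) hP'
        · exact (h.mono hC2).mono_eps (by positivity)
  intro k U V hP
  obtain ⟨-, -, cU, cV⟩ := hne k U V hP
  refine ARel.limit cU cV (e := fun N => D * r ^ N) ?_ (fun N => main N N k U V (by omega) hP)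
  simpa using (tendsto_pow_atTop_nhds_zero_of_lt_one hr.le hr1).const_mul D

/-! ### Part 2 : words and the symbolic space -/
def Sy (m : ℕ) (r : ℝ) : Type := ℕ → Fin m

def pre {m : ℕ} (L : ℕ) (x : ℕ → Fin m) : List (Fin m) := (List.range L).map x

theorem pre_length {m : ℕ} (L : ℕ) (x : ℕ → Fin m) : (pre L x).length = L := by simp [pre]

theorem pre_take {m : ℕ} {k L : ℕ} (h : k ≤ L) (x : ℕ → Fin m) : (pre L x).take k = pre k x := by
  simp [pre, ← List.map_take, List.take_range, h]

theorem pre_eq_iff {m : ℕ} {L : ℕ} {x y : ℕ → Fin m} :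
    pre L x = pre L y ↔ ∀ i < L, x i = y i := by
  simp [pre]

theorem symbDist_le_iff {m : ℕ} {r : ℝ} (hr : 0 < r) (hr1 : r < 1) {x y : ℕ → Fin m} {L : ℕ} :
    symbDist r x y ≤ r ^ L ↔ pre L x = pre L y := by
  rw [pre_eq_iff]
  unfold symbDist
  split_ifs with h
  · subst h
    simp [hr.le]
  · have hne : {k : ℕ | x k ≠ y k}.Nonempty := by
      by_contra hc
      rw [Set.not_nonempty_iff_eq_empty] at hc
      apply h
      funext k
      by_contra hk
      have : k ∈ {k : ℕ | x k ≠ y k} := hk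
      rw [hc] at this
      exact this
    rw [pow_le_pow_iff_right_of_lt_one₀ hr hr1]
    constructor
    · intro h1 i hi
      by_contra hk
      have := Nat.sInf_le (s := {k : ℕ | x k ≠ y k}) hk
      omega
    · intro h1
      by_contra hlt
      push Not at hlt
      exact Nat.sInf_mem hne (h1 _ hlt)

theorem symbDist_eq_pow {m : ℕ} {r : ℝ} {x y : ℕ → Fin m} (h : x ≠ y) :
    ∃ L, symbDist r x y = r ^ L := ⟨_, by unfold symbDist; rw [if_neg h]⟩

theorem symbDist_comm {m : ℕ} {r : ℝ} (x y : ℕ → Fin m) : symbDist r x y = symbDist r y x := by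
  unfold symbDist
  simp only [eq_comm (a := x) (b := y), ne_comm]

theorem symbDist_nonneg {m : ℕ} {r : ℝ} (hr : 0 < r) (x y : ℕ → Fin m) : 0 ≤ symbDist r x y := by
  unfold symbDist
  split_ifs <;> positivity

theorem symbDist_ultra {m : ℕ} {r : ℝ} (hr : 0 < r) (hr1 : r < 1) (x y z : ℕ → Fin m) :
    symbDist r x z ≤ max (symbDist r x y) (symbDist r y z) := by
  by_cases h1 : x = y
  · subst h1; exact le_max_right _ _
  by_cases h2 : y = z
  · subst h2; exact le_max_left _ _
  obtain ⟨L1, e1⟩ := symbDist_eq_pow (r := r) h1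
  obtain ⟨L2, e2⟩ := symbDist_eq_pow (r := r) h2
  have a1 := pre_eq_iff.1 ((symbDist_le_iff hr hr1).1 e1.le)
  have a2 := pre_eq_iff.1 ((symbDist_le_iff hr hr1).1 e2.le)
  have : symbDist r x z ≤ r ^ (min L1 L2) := by
    rw [symbDist_le_iff hr hr1, pre_eq_iff]
    intro i hi
    rw [a1 i (by omega), a2 i (by omega)]
  rw [e1, e2]
  rcases le_total L1 L2 with h | h
  · rw [min_eq_left h] at this; exact this.trans (le_max_left _ _)
  · rw [min_eq_right h] at this; exact this.trans (le_max_right _ _)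

noncomputable instance instMetricSy (m : ℕ) (r : ℝ) [h : Fact (0 < r ∧ r < 1)] :
    MetricSpace (Sy m r) where
  dist x y := symbDist r x y
  dist_self x := if_pos rfl
  dist_comm x y := symbDist_comm _ _
  dist_triangle x y z := by
    have h1 := symbDist_ultra h.1.1 h.1.2 x y z
    have h2 := symbDist_nonneg h.1.1 x y
    have h3 := symbDist_nonneg h.1.1 y z
    exact h1.trans (max_le (by linarith) (by linarith))
  eq_of_dist_eq_zero := by
    intro x y hxy
    by_contra hne
    obtain ⟨L, e⟩ := symbDist_eq_pow (r := r) hne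
    have hr : 0 < r ^ L := pow_pos h.1.1 L
    have : symbDist r x y = 0 := hxy
    linarith

theorem sy_dist_le_iff {m : ℕ} {r : ℝ} [h : Fact (0 < r ∧ r < 1)] {x y : Sy m r} {L : ℕ} :
    dist x y ≤ r ^ L ↔ pre L x = pre L y := symbDist_le_iff h.1.1 h.1.2

instance instCompactSy (m : ℕ) (r : ℝ) [h : Fact (0 < r ∧ r < 1)] : CompactSpace (Sy m r) := by
  let f : (ℕ → Fin m) → Sy m r := fun x => x
  have hf : Continuous f := by
    rw [Metric.continuous_iff']
    intro a ε hε
    obtain ⟨L, hL⟩ := exists_pow_lt_of_lt_one hε h.1.2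
    have : ∀ i ∈ Finset.range L, ∀ᶠ x : ℕ → Fin m in nhds a, x i = a i := by
      intro i _
      have := (continuous_apply (A := fun _ : ℕ => Fin m) i).continuousAt (x := a)
      exact this.eventually (by simp : ∀ᶠ y in nhds (a i), y = a i)
    have := (Filter.eventually_all_finset (Finset.range L)).2 this
    filter_upwards [this] with x hx
    refine lt_of_le_of_lt (sy_dist_le_iff.2 ?_) hL
    exact pre_eq_iff.2 (fun i hi => hx i (Finset.mem_range.2 hi))
  have hs : Function.Surjective f := fun x => ⟨x, rfl⟩
  exact hs.compactSpace hf

/-- words of length `k` -/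
def Wd (m k : ℕ) : Finset (List (Fin m)) :=
  (Finset.univ : Finset (List.Vector (Fin m) k)).map ⟨List.Vector.toList, Subtype.val_injective⟩

theorem mem_Wd {m k : ℕ} {w : List (Fin m)} : w ∈ Wd m k ↔ w.length = k := by
  simp only [Wd, Finset.mem_map, Finset.mem_univ, true_and, Function.Embedding.coeFn_mk]
  constructor
  · rintro ⟨a, rfl⟩; exact a.2
  · intro h; exact ⟨⟨w, h⟩, rfl⟩

theorem card_Wd (m k : ℕ) : (Wd m k).card = m ^ k := by
  simp [Wd, card_vector]

/-- all extensions by `c` letters -/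
def wext {m : ℕ} (A : Finset (List (Fin m))) (c : ℕ) : Finset (List (Fin m)) :=
  Finset.image₂ (fun a u => a ++ u) A (Wd m c)

theorem mem_wext {m : ℕ} {A : Finset (List (Fin m))} {c k : ℕ} (hA : ∀ a ∈ A, a.length = k)
    {y : List (Fin m)} : y ∈ wext A c ↔ y.length = k + c ∧ y.take k ∈ A := by
  simp only [wext, Finset.mem_image₂, mem_Wd]
  constructor
  · rintro ⟨a, ha, u, hu, rfl⟩
    have := hA a ha
    subst this
    simp [hu, ha]
  · rintro ⟨h1, h2⟩
    exact ⟨_, h2, y.drop k, by simp [h1], List.take_append_drop k y⟩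

theorem card_wext {m : ℕ} {A : Finset (List (Fin m))} {c k : ℕ} (hA : ∀ a ∈ A, a.length = k) :
    (wext A c).card = A.card * m ^ c := by
  rw [wext, Finset.card_image₂_iff.2, card_Wd]
  rintro ⟨a, u⟩ h ⟨a', u'⟩ h' e
  simp only [Set.mem_prod, Finset.mem_coe] at h h'
  have := List.append_inj e ((hA _ h.1).trans (hA _ h'.1).symm)
  exact Prod.ext this.1 this.2

def VA {m : ℕ} (r : ℝ) (A : Finset (List (Fin m))) (L : ℕ) : Set (Sy m r) := {x | pre L x ∈ A}

theorem VA_wext {m : ℕ} {r : ℝ} {A : Finset (List (Fin m))} {L : ℕ} (c : ℕ)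
    (hA : ∀ a ∈ A, a.length = L) : VA r (wext A c) (L + c) = VA r A L := by
  ext x
  show pre (L + c) x ∈ wext A c ↔ pre L x ∈ A
  have e1 : (pre (L + c) x).take L = pre L x := pre_take (by omega) _
  have e2 : (pre (L + c) x).length = L + c := pre_length _ _
  rw [mem_wext hA, e1]
  exact ⟨fun h => h.2, fun h => ⟨e2, h⟩⟩

theorem VA_compact {m : ℕ} {r : ℝ} [h : Fact (0 < r ∧ r < 1)] (A : Finset (List (Fin m))) (L : ℕ) :
    IsCompact (VA r A L) := by
  apply IsClosed.isCompact
  rw [← isOpen_compl_iff, Metric.isOpen_iff]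
  intro x hx
  refine ⟨r ^ L, pow_pos h.1.1 L, ?_⟩
  intro y hy hyA
  apply hx
  have := sy_dist_le_iff.1 (le_of_lt (Metric.mem_ball.1 hy))
  have e : pre L x ∈ A := by rw [← this]; exact hyA
  exact e

theorem VA_nonempty {m : ℕ} {r : ℝ} (hm : 0 < m) {A : Finset (List (Fin m))} {L : ℕ}
    (hA : ∀ a ∈ A, a.length = L) (hne : A.Nonempty) : (VA r A L).Nonempty := by
  obtain ⟨a, ha⟩ := hne
  refine ⟨fun i => a.getD i ⟨0, hm⟩, ?_⟩
  have : pre L (fun i => a.getD i ⟨0, hm⟩) = a := by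
    apply List.ext_getElem
    · simp [pre, hA a ha]
    · intro i h1 h2
      simp [pre, h2]
  show pre L _ ∈ A
  rw [this]; exact ha

theorem VA_diam {m : ℕ} {r : ℝ} [h : Fact (0 < r ∧ r < 1)] {A : Finset (List (Fin m))} {L p : ℕ}
    (ht : ∀ a ∈ A, ∀ a' ∈ A, a.take (L - p) = a'.take (L - p)) {x y : Sy m r}
    (hx : x ∈ VA r A L) (hy : y ∈ VA r A L) : dist x y ≤ (r ^ p)⁻¹ * r ^ L := by
  have h0 := h.1.1
  have h1 : (pre L x).take (L - p) = (pre L y).take (L - p) := ht _ hx _ hy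
  have e1 : (pre L x).take (L - p) = pre (L - p) x := pre_take (by omega) _
  have e2 : (pre L y).take (L - p) = pre (L - p) y := pre_take (by omega) _
  rw [e1, e2] at h1
  refine (sy_dist_le_iff.2 h1).trans ?_
  rw [le_inv_mul_iff₀ (pow_pos h0 _), ← pow_add]
  exact pow_le_pow_of_le_one h0.le h.1.2.le (by omega)

theorem VA_sep {m : ℕ} {r : ℝ} [h : Fact (0 < r ∧ r < 1)] {A B : Finset (List (Fin m))} {L : ℕ}
    (hAB : Disjoint A B) {x y : Sy m r}
    (hx : x ∈ VA r A L) (hy : y ∈ VA r B L) : r ^ L ≤ dist x y := by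
  by_contra hlt
  push Not at hlt
  have := sy_dist_le_iff.1 hlt.le
  have e : pre L x ∈ B := by rw [this]; exact hy
  exact Finset.disjoint_left.1 hAB hx e

theorem VA_fib {m : ℕ} {r : ℝ} {A : Finset (List (Fin m))} {L : ℕ} {ι : Type*}
    (f : List (Fin m) → ι) : VA r A L = ⋃ i, VA r (A.filter (fun a => f a = i)) L := by
  ext x
  simp [VA]

/-! ### Part 3 : many cylinders against one -/
theorem many_one {m : ℕ} (hm : 2 ≤ m) {r : ℝ} [h : Fact (0 < r ∧ r < 1)] (p : ℕ) (hp : 0 < p) :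
    ∃ C, 0 < C ∧ ∀ (L : ℕ) (A : Finset (List (Fin m))) (e : List (Fin m)),
      (∀ a ∈ A, a.length = L) → A.Nonempty →
      (∀ a ∈ A, ∀ a' ∈ A, a.take (L - p) = a'.take (L - p)) → e.length = L →
      ARel C 0 (VA r A L) (VA r {e} L) := by
  have h0 := h.1.1
  have hrp : 0 < r ^ p := pow_pos h0 p
  obtain ⟨C, hC, H⟩ := bisim (α := Sy m r) (β := Sy m r) (r := r) (D := (r ^ p)⁻¹) (c := r ^ p)
    (C₀ := 1) h0 h.1.2 hrp (by positivity)
    (fun L U V => ∃ (A : Finset (List (Fin m))) (e : List (Fin m)),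
      (∀ a ∈ A, a.length = L) ∧ A.Nonempty ∧
      (∀ a ∈ A, ∀ a' ∈ A, a.take (L - p) = a'.take (L - p)) ∧ e.length = L ∧
      U = VA r A L ∧ V = VA r {e} L)
    (by
      rintro k U V ⟨A, e, hA, hne, ht, he, rfl, rfl⟩
      exact ⟨VA_nonempty (by omega) hA hne, VA_nonempty (by omega) (by simpa using he) (by simp),
        VA_compact _ _, VA_compact _ _⟩)
    (by
      rintro k U V ⟨A, e, hA, hne, ht, he, rfl, rfl⟩ x hx y hy
      exact VA_diam ht hx hy)
    (by
      rintro k U V ⟨A, e, hA, hne, ht, he, rfl, rfl⟩ x hx y hy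
      exact VA_diam (by simp) hx hy)
    (by
      rintro k U V ⟨A, e, hA, hne, ht, he, rfl, rfl⟩
      -- `A` has at most `m ^ p` elements
      have hcard : A.card ≤ (Wd m p).card := by
        apply Finset.card_le_card_of_injOn (fun a => a.drop (k - p) ++
          List.replicate (p - (k - (k - p))) ⟨0, by omega⟩)
        · intro a ha
          have := hA a ha
          rw [Finset.mem_coe, mem_Wd]
          simp [this]
          omega
        · intro a ha a' ha' haa
          have e1 := (List.append_inj haa (by simp [hA a ha, hA a' ha'])).1
          rw [← List.take_append_drop (k - p) a, ← List.take_append_drop (k - p) a', e1,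
            ht a ha a' ha']
      haveI : Nonempty A := hne.to_subtype
      obtain ⟨s⟩ : Nonempty (A ↪ Wd m p) := by
        rw [Function.Embedding.nonempty_iff_card_le]
        simpa using hcard
      let f : Wd m p → A := Function.invFun s
      have hfs : ∀ a, f (s a) = a := Function.leftInverse_invFun s.injective
      -- the assignment
      let τ : List (Fin m) → List (Fin m) := fun y =>
        if hy : y.drop k ∈ Wd m p ∧ y.take k ∈ A then
          (if (f ⟨_, hy.1⟩ : List (Fin m)) = y.take k then y.drop k else s ⟨_, hy.2⟩) else []
      have hτ : ∀ (a : A) (u : Wd m p), τ (a.1 ++ u.1) = if f u = a then u.1 else s a := by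
        intro a u
        have hl := hA a.1 a.2
        have e1 : (a.1 ++ u.1).drop k = u.1 := by rw [← hl]; simp
        have e2 : (a.1 ++ u.1).take k = a.1 := by rw [← hl]; simp
        have hy : (a.1 ++ u.1).drop k ∈ Wd m p ∧ (a.1 ++ u.1).take k ∈ A := by
          rw [e1, e2]; exact ⟨u.2, a.2⟩
        simp only [τ]
        rw [dif_pos hy]
        simp only [e1, e2, Subtype.coe_eta, Subtype.ext_iff]
      have hτf : ∀ (a : A) (u v : Wd m p), τ (a.1 ++ u.1) = v → a = f v := by
        intro a u v hv
        rw [hτ] at hv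
        split_ifs at hv with hh
        · rw [← hh, Subtype.ext hv]
        · rw [← Subtype.ext hv, hfs]
      have hel : ∀ a ∈ ({e} : Finset (List (Fin m))), a.length = k := by simpa using he
      have hdec : ∀ y ∈ wext A p, ∃ (a : A) (u : Wd m p), y = a.1 ++ u.1 := by
        intro y hy
        rw [mem_wext hA] at hy
        exact ⟨⟨_, hy.2⟩, ⟨y.drop k, mem_Wd.2 (by simp [hy.1])⟩, (List.take_append_drop k y).symm⟩
      refine ⟨Wd m p, fun v => VA r ((wext A p).filter (fun y => τ y = v.1)) (k + p),
        fun v => VA r {e ++ v.1} (k + p), ?_, ?_, ?_, ?_, ?_⟩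
      · rw [← VA_wext p hA]
        ext x
        simp only [VA, Set.mem_ofPred_eq, Finset.mem_filter, Set.mem_iUnion]
        constructor
        · intro hx
          obtain ⟨a, u, hau⟩ := hdec _ hx
          refine ⟨⟨τ (a.1 ++ u.1), ?_⟩, hx, by rw [hau]⟩
          rw [hτ]
          split_ifs
          · exact u.2
          · exact (s a).2
        · rintro ⟨v, hx, -⟩; exact hx
      · rw [← VA_wext p hel]
        ext x
        simp only [VA, Set.mem_ofPred_eq, Finset.mem_singleton, Set.mem_iUnion, wext,
          Finset.mem_image₂, exists_eq_left]
        constructor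
        · rintro ⟨u, hu, hx⟩; exact ⟨⟨u, hu⟩, hx.symm⟩
        · rintro ⟨u, hx⟩; exact ⟨u.1, u.2, hx.symm⟩
      · intro i j hij x hx y hy
        rw [mul_comm, ← pow_add]
        refine VA_sep ?_ hx hy
        rw [Finset.disjoint_left]
        intro y h1 h2
        simp only [Finset.mem_filter] at h1 h2
        exact hij (Subtype.ext (h1.2.symm.trans h2.2))
      · intro i j hij x hx y hy
        rw [mul_comm, ← pow_add]
        refine VA_sep ?_ hx hy
        simp only [Finset.disjoint_singleton, ne_eq, List.append_cancel_left_eq]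
        exact fun hh => hij (Subtype.ext hh)
      · intro v
        left
        refine ⟨k + p, by omega, _, _, ?_, ?_, ?_, ?_, rfl, rfl⟩
        · intro y hy
          simp only [Finset.mem_filter, mem_wext hA] at hy
          exact hy.1.1
        · refine ⟨(f v).1 ++ v.1, ?_⟩
          simp only [Finset.mem_filter]
          refine ⟨Finset.mem_image₂_of_mem (f v).2 v.2, ?_⟩
          rw [hτ, if_pos rfl]
        · have : ∀ y ∈ (wext A p).filter (fun y => τ y = v.1), y.take (k + p - p) = (f v).1 := by
            intro y hy
            simp only [Finset.mem_filter] at hy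
            obtain ⟨a, u, rfl⟩ := hdec y hy.1
            rw [← hτf a u v hy.2, Nat.add_sub_cancel, ← hA a.1 a.2]
            simp
          intro y hy y' hy'
          rw [this y hy, this y' hy']
        · simp [he, mem_Wd.1 v.2])
  exact ⟨C, hC, fun L A e h1 h2 h3 h4 => H L _ _ ⟨A, e, h1, h2, h3, h4, rfl, rfl⟩⟩

/-! ### Part 4 : clusters -/
def Adj {m : ℕ} {α : Type*} (P : List (Fin m) → Set α) (u v : List (Fin m)) : Prop :=
  u.length = v.length ∧ (P u ∩ P v).Nonempty

def Conn {m : ℕ} {α : Type*} (P : List (Fin m) → Set α) : List (Fin m) → List (Fin m) → Prop :=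
  Relation.ReflTransGen (Adj P)

noncomputable def cl {m : ℕ} {α : Type*} (P : List (Fin m) → Set α) (w : List (Fin m)) :
    Finset (List (Fin m)) := (Wd m w.length).filter (Conn P w)

def US {m : ℕ} {α : Type*} (P : List (Fin m) → Set α) (W : Finset (List (Fin m))) : Set α :=
  ⋃ w ∈ W, P w

structure Sys {m : ℕ} {α : Type*} [MetricSpace α] (P : List (Fin m) → Set α) (r : ℝ) (N : ℕ)
    (K0 a0 : ℝ) : Prop where
  ne : ∀ w, (P w).Nonempty
  cpt : ∀ w, IsCompact (P w)
  split : ∀ w c, P w = ⋃ u ∈ Wd m c, P (w ++ u)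
  refl : ∀ w u v, (P (w ++ u) ∩ P (w ++ v)).Nonempty ↔ (P u ∩ P v).Nonempty
  card : ∀ w, (cl P w).card ≤ N
  diam : ∀ w, ∀ u ∈ cl P w, ∀ v ∈ cl P w, ∀ x ∈ P u, ∀ y ∈ P v, dist x y ≤ K0 * r ^ w.length
  sep : ∀ u v, u.length = v.length → ¬ (P u ∩ P v).Nonempty → ∀ x ∈ P u, ∀ y ∈ P v,
    a0 * r ^ u.length ≤ dist x y

theorem Conn.length {m : ℕ} {α : Type*} {P : List (Fin m) → Set α} {u v : List (Fin m)}
    (h : Conn P u v) : u.length = v.length := by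
  induction h with
  | refl => rfl
  | tail _ h ih => exact ih.trans h.1

theorem Adj.symm {m : ℕ} {α : Type*} {P : List (Fin m) → Set α} {u v : List (Fin m)}
    (h : Adj P u v) : Adj P v u := ⟨h.1.symm, by rw [Set.inter_comm]; exact h.2⟩

theorem Conn.symm {m : ℕ} {α : Type*} {P : List (Fin m) → Set α} {u v : List (Fin m)}
    (h : Conn P u v) : Conn P v u := by
  induction h with
  | refl => exact Relation.ReflTransGen.refl
  | tail _ h ih => exact Relation.ReflTransGen.head h.symm ih

theorem Conn.trans {m : ℕ} {α : Type*} {P : List (Fin m) → Set α} {u v w : List (Fin m)}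
    (h : Conn P u v) (h' : Conn P v w) : Conn P u w := Relation.ReflTransGen.trans h h'

theorem Conn.rfl' {m : ℕ} {α : Type*} {P : List (Fin m) → Set α} {u : List (Fin m)} : Conn P u u :=
  Relation.ReflTransGen.refl

theorem mem_cl {m : ℕ} {α : Type*} {P : List (Fin m) → Set α} {u v : List (Fin m)} :
    v ∈ cl P u ↔ Conn P u v := by
  simp only [cl, Finset.mem_filter, mem_Wd]
  exact ⟨fun h => h.2, fun h => ⟨h.length.symm, h⟩⟩

theorem self_mem_cl {m : ℕ} {α : Type*} {P : List (Fin m) → Set α} {u : List (Fin m)} :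
    u ∈ cl P u := mem_cl.2 Conn.rfl'

theorem cl_length {m : ℕ} {α : Type*} {P : List (Fin m) → Set α} {u : List (Fin m)} :
    ∀ v ∈ cl P u, v.length = u.length := fun _ hv => (mem_cl.1 hv).length.symm

theorem cl_eq {m : ℕ} {α : Type*} {P : List (Fin m) → Set α} {u v : List (Fin m)}
    (h : Conn P u v) : cl P u = cl P v := by
  ext w
  rw [mem_cl, mem_cl]
  exact ⟨fun h' => h.symm.trans h', fun h' => h.trans h'⟩

theorem cl_disj {m : ℕ} {α : Type*} {P : List (Fin m) → Set α} {u v : List (Fin m)}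
    (h : cl P u ≠ cl P v) : Disjoint (cl P u) (cl P v) := by
  rw [Finset.disjoint_left]
  intro w h1 h2
  rw [mem_cl] at h1 h2
  exact h (cl_eq (h1.trans h2.symm))

section
variable {m : ℕ} {α : Type*} [MetricSpace α] {P : List (Fin m) → Set α} {r : ℝ} {N : ℕ}
    {K0 a0 : ℝ} (H : Sys P r N K0 a0)

theorem Sys.sub (H : Sys P r N K0 a0) (w u : List (Fin m)) : P (w ++ u) ⊆ P w := by
  rw [H.split w u.length]
  exact Set.subset_biUnion_of_mem (u := fun u => P (w ++ u)) (mem_Wd.2 rfl)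

theorem Sys.sub_take (H : Sys P r N K0 a0) (w : List (Fin m)) (k : ℕ) : P w ⊆ P (w.take k) := by
  have := H.sub (w.take k) (w.drop k)
  rwa [List.take_append_drop] at this

theorem Sys.conn_take (H : Sys P r N K0 a0) {u v : List (Fin m)} (h : Conn P u v) (k : ℕ) :
    Conn P (u.take k) (v.take k) := by
  induction h with
  | refl => exact Conn.rfl'
  | tail _ h ih =>
    refine Relation.ReflTransGen.tail ih ⟨by simp [h.1], ?_⟩
    exact h.2.mono (Set.inter_subset_inter (H.sub_take _ _) (H.sub_take _ _))

theorem Sys.conn_app (H : Sys P r N K0 a0) {u v : List (Fin m)} (h : Conn P u v)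
    (w : List (Fin m)) : Conn P (w ++ u) (w ++ v) := by
  induction h with
  | refl => exact Conn.rfl'
  | tail _ h ih =>
    exact Relation.ReflTransGen.tail ih ⟨by simp [h.1], (H.refl _ _ _).2 h.2⟩

theorem US_ne (H : Sys P r N K0 a0) (w : List (Fin m)) : (US P (cl P w)).Nonempty := by
  obtain ⟨x, hx⟩ := H.ne w
  exact ⟨x, Set.mem_biUnion self_mem_cl hx⟩

theorem US_cpt (H : Sys P r N K0 a0) (w : List (Fin m)) : IsCompact (US P (cl P w)) :=
  (cl P w).isCompact_biUnion fun u _ => H.cpt u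

theorem US_diam (H : Sys P r N K0 a0) (w : List (Fin m)) : ∀ x ∈ US P (cl P w),
    ∀ y ∈ US P (cl P w), dist x y ≤ K0 * r ^ w.length := by
  intro x hx y hy
  simp only [US, Set.mem_iUnion, exists_prop] at hx hy
  obtain ⟨u, hu, hx⟩ := hx
  obtain ⟨v, hv, hy⟩ := hy
  exact H.diam w u hu v hv x hx y hy

theorem US_sep (H : Sys P r N K0 a0) {u v : List (Fin m)} (hl : u.length = v.length)
    (h : cl P u ≠ cl P v) : ∀ x ∈ US P (cl P u), ∀ y ∈ US P (cl P v),
    a0 * r ^ u.length ≤ dist x y := by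
  intro x hx y hy
  simp only [US, Set.mem_iUnion, exists_prop] at hx hy
  obtain ⟨u', hu, hx⟩ := hx
  obtain ⟨v', hv, hy⟩ := hy
  rw [mem_cl] at hu hv
  have hl' : u'.length = v'.length := by rw [← hu.length, ← hv.length, hl]
  rw [hu.length]
  refine H.sep u' v' hl' ?_ x hx y hy
  intro hne
  exact h (cl_eq ((hu.tail ⟨hl', hne⟩).trans hv.symm))

theorem US_split (H : Sys P r N K0 a0) (W : Finset (List (Fin m))) (c : ℕ) :
    US P W = US P (wext W c) := by
  ext x
  simp only [US, Set.mem_iUnion, exists_prop]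
  constructor
  · rintro ⟨w, hw, hx⟩
    rw [H.split w c] at hx
    simp only [Set.mem_iUnion, exists_prop] at hx
    obtain ⟨u, hu, hx⟩ := hx
    exact ⟨w ++ u, Finset.mem_image₂_of_mem hw hu, hx⟩
  · rintro ⟨y, hy, hx⟩
    simp only [wext, Finset.mem_image₂] at hy
    obtain ⟨a, ha, u, hu, rfl⟩ := hy
    exact ⟨a, ha, H.sub _ _ hx⟩

/-- child clusters -/
noncomputable def chil (P : List (Fin m) → Set α) (W : Finset (List (Fin m))) (c : ℕ) :
    Finset (Finset (List (Fin m))) := (wext W c).image (cl P)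

theorem mem_wext_cl {w y : List (Fin m)} {c : ℕ} : y ∈ wext (cl P w) c ↔
    y.length = w.length + c ∧ Conn P w (y.take w.length) := by
  rw [mem_wext cl_length, mem_cl]

theorem mem_chil {w : List (Fin m)} {c : ℕ} {W : Finset (List (Fin m))} : W ∈ chil P (cl P w) c ↔
    ∃ y, y.length = w.length + c ∧ Conn P w (y.take w.length) ∧ W = cl P y := by
  simp only [chil, Finset.mem_image, mem_wext_cl]
  constructor
  · rintro ⟨y, ⟨h1, h2⟩, rfl⟩; exact ⟨y, h1, h2, rfl⟩
  · rintro ⟨y, h1, h2, rfl⟩; exact ⟨y, ⟨h1, h2⟩, rfl⟩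

theorem chil_biUnion (H : Sys P r N K0 a0) (w : List (Fin m)) (c : ℕ) :
    (chil P (cl P w) c).biUnion id = wext (cl P w) c := by
  ext v
  simp only [Finset.mem_biUnion, mem_chil, mem_wext_cl, id]
  constructor
  · rintro ⟨W, ⟨y, h1, h2, rfl⟩, hv⟩
    rw [mem_cl] at hv
    exact ⟨by rw [← hv.length, h1], h2.trans (H.conn_take hv _)⟩
  · rintro ⟨h1, h2⟩
    exact ⟨_, ⟨v, h1, h2, rfl⟩, self_mem_cl⟩

theorem chil_disj {w : List (Fin m)} {c : ℕ} {W W' : Finset (List (Fin m))}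
    (h : W ∈ chil P (cl P w) c) (h' : W' ∈ chil P (cl P w) c) (hne : W ≠ W') : Disjoint W W' := by
  rw [mem_chil] at h h'
  obtain ⟨y, -, -, rfl⟩ := h
  obtain ⟨y', -, -, rfl⟩ := h'
  exact cl_disj hne

theorem chil_card (H : Sys P r N K0 a0) (w : List (Fin m)) (c : ℕ) :
    ∑ W ∈ chil P (cl P w) c, W.card = (cl P w).card * m ^ c := by
  rw [← card_wext (c := c) cl_length (A := cl P w), ← chil_biUnion H, Finset.card_biUnion]
  · rfl
  · intro W h W' h' hne
    exact chil_disj h h' hne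

theorem chil_US (H : Sys P r N K0 a0) (w : List (Fin m)) (c : ℕ) :
    US P (cl P w) = ⋃ W : chil P (cl P w) c, US P W.1 := by
  rw [US_split H _ c, ← chil_biUnion H]
  ext x
  simp only [US, Set.mem_iUnion, Finset.mem_biUnion, id, exists_prop, Subtype.exists]
  constructor
  · rintro ⟨i, ⟨W, hW, hi⟩, hx⟩; exact ⟨W, hW, i, hi, hx⟩
  · rintro ⟨W, hW, i, hi, hx⟩; exact ⟨i, ⟨W, hW, hi⟩, hx⟩

theorem cl_app_max (H : Sys P r N K0 a0) {w0 : List (Fin m)}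
    (hw0 : ∀ w, (cl P w).card ≤ (cl P w0).card) (x : List (Fin m)) :
    cl P (x ++ w0) = (cl P w0).image (x ++ ·) := by
  symm
  apply Finset.eq_of_subset_of_card_le
  · intro y hy
    rw [Finset.mem_image] at hy
    obtain ⟨v, hv, rfl⟩ := hy
    rw [mem_cl] at hv ⊢
    exact H.conn_app hv x
  · rw [Finset.card_image_of_injective _ (fun a b h => List.append_cancel_left h)]
    exact hw0 _

/-- recurrent tails -/
def RecT (P : List (Fin m) → Set α) (w0 t : List (Fin m)) : Prop :=
  w0.length ≤ t.length ∧ Conn P w0 (t.take w0.length)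

theorem rec_conn (H : Sys P r N K0 a0) {w0 : List (Fin m)}
    (hw0 : ∀ w, (cl P w).card ≤ (cl P w0).card) {x t v : List (Fin m)} (ht : RecT P w0 t)
    (h : Conn P (x ++ t) v) : ∃ t', v = x ++ t' ∧ Conn P t t' := by
  induction h with
  | refl => exact ⟨t, rfl, Conn.rfl'⟩
  | @tail b c hb hc ih =>
    obtain ⟨t', rfl, h'⟩ := ih
    have h1 : Conn P (x ++ t) c := Relation.ReflTransGen.tail hb hc
    have h2 := H.conn_take h1 (x.length + w0.length)
    rw [List.take_length_add_append] at h2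
    have h3 : Conn P (x ++ w0) (c.take (x.length + w0.length)) := (H.conn_app ht.2 x).trans h2
    rw [← mem_cl, cl_app_max H hw0, Finset.mem_image] at h3
    obtain ⟨s, hs, h3⟩ := h3
    have h4 : c = x ++ (s ++ c.drop (x.length + w0.length)) := by
      rw [← List.append_assoc, h3, List.take_append_drop]
    refine ⟨_, h4, ?_⟩
    rw [h4] at hc
    refine Relation.ReflTransGen.tail h' ⟨?_, (H.refl _ _ _).1 hc.2⟩
    simpa using hc.1

theorem cl_rec (H : Sys P r N K0 a0) {w0 : List (Fin m)}
    (hw0 : ∀ w, (cl P w).card ≤ (cl P w0).card) {x t : List (Fin m)} (ht : RecT P w0 t) :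
    cl P (x ++ t) = (cl P t).image (x ++ ·) := by
  ext v
  rw [mem_cl, Finset.mem_image]
  constructor
  · intro h
    obtain ⟨t', rfl, h'⟩ := rec_conn H hw0 ht h
    exact ⟨t', mem_cl.2 h', rfl⟩
  · rintro ⟨t', h, rfl⟩
    exact H.conn_app (mem_cl.1 h) x

theorem card_cl_rec (H : Sys P r N K0 a0) {w0 : List (Fin m)}
    (hw0 : ∀ w, (cl P w).card ≤ (cl P w0).card) {x t : List (Fin m)} (ht : RecT P w0 t) :
    (cl P (x ++ t)).card = (cl P t).card := by
  rw [cl_rec H hw0 ht, Finset.card_image_of_injective _ (fun a b h => List.append_cancel_left h)]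

theorem rec_ext (H : Sys P r N K0 a0) {w0 : List (Fin m)}
    (hw0 : ∀ w, (cl P w).card ≤ (cl P w0).card) {x t y : List (Fin m)} (ht : RecT P w0 t)
    (hy : Conn P (x ++ t) (y.take (x ++ t).length)) :
    ∃ t', y = x ++ t' ∧ RecT P w0 t' := by
  obtain ⟨t', h1, h2⟩ := rec_conn H hw0 ht hy
  refine ⟨t' ++ y.drop (x ++ t).length, by rw [← List.append_assoc, ← h1, List.take_append_drop], ?_, ?_⟩
  · have := h2.length; have := ht.1; simp; omega
  · rw [List.take_append_of_le_length (by rw [← h2.length]; exact ht.1)]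
    exact ht.2.trans (H.conn_take h2 _)
end

/-! ### Part 5 : grouping -/
theorem greedy {X Y : Type*} (R : Finset X) (A : Finset Y) (hA : A.Nonempty) (wt : X → ℕ) (N : ℕ)
    (hwt : ∀ x ∈ R, wt x ≤ N) : ∃ φ : X → Y, (∀ x, φ x ∈ A) ∧
      ∀ a ∈ A, ∀ b ∈ A, (∑ x ∈ R, if φ x = a then wt x else 0) ≤
        (∑ x ∈ R, if φ x = b then wt x else 0) + N := by
  induction R using Finset.induction_on with
  | empty => obtain ⟨a, ha⟩ := hA; exact ⟨fun _ => a, fun _ => ha, by simp⟩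
  | insert x R hx ih =>
    obtain ⟨φ, h1, h2⟩ := ih (fun y hy => hwt y (Finset.mem_insert_of_mem hy))
    obtain ⟨e, he, hmin⟩ := A.exists_min_image (fun a => ∑ x ∈ R, if φ x = a then wt x else 0) hA
    refine ⟨Function.update φ x e, ?_, ?_⟩
    · intro y
      by_cases h : y = x
      · subst h; simpa using he
      · rw [Function.update_of_ne h]; exact h1 y
    · have key : ∀ a, (∑ y ∈ insert x R, if Function.update φ x e y = a then wt y else 0) =
          (if e = a then wt x else 0) + ∑ y ∈ R, if φ y = a then wt y else 0 := by
        intro a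
        rw [Finset.sum_insert hx, Function.update_self]
        congr 1
        apply Finset.sum_congr rfl
        intro y hy
        have hyx : y ≠ x := by rintro rfl; exact hx hy
        rw [Function.update_of_ne hyx]
      intro a ha b hb
      rw [key, key]
      have hx' := hwt x (Finset.mem_insert_self _ _)
      have e1 := h2 a ha b hb
      have e2 := hmin b hb
      by_cases hea : e = a
      · subst hea
        rw [if_pos rfl]
        split_ifs <;> omega
      · rw [if_neg hea]
        split_ifs <;> omega

theorem fiber {X Y : Type*} [Nonempty Y] (T : Finset X) (A : Finset Y) (n : Y → ℕ)
    (h : ∑ a ∈ A, n a = T.card) : ∃ ψ : X → Y, (∀ x ∈ T, ψ x ∈ A) ∧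
      ∀ a ∈ A, (T.filter (fun x => ψ x = a)).card = n a := by
  induction A using Finset.induction_on generalizing T with
  | empty =>
    have : T = ∅ := by simpa using h.symm
    subst this
    exact ⟨fun _ => Classical.arbitrary Y, by simp, by simp⟩
  | insert a A ha ih =>
    rw [Finset.sum_insert ha] at h
    obtain ⟨T1, hT1, hc⟩ := Finset.exists_subset_card_eq (s := T) (n := n a) (by omega)
    obtain ⟨ψ, h1, h2⟩ := ih (T \ T1) (by rw [Finset.card_sdiff_of_subset hT1]; omega)
    refine ⟨fun x => if x ∈ T1 then a else ψ x, ?_, ?_⟩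
    · intro x hx
      by_cases h : x ∈ T1
      · simp [h]
      · simp only [h, if_false]; exact Finset.mem_insert_of_mem (h1 x (by simp [hx, h]))
    · intro b hb
      by_cases hba : b = a
      · subst hba
        rw [← hc]
        congr 1
        ext x
        simp only [Finset.mem_filter]
        constructor
        · rintro ⟨hx, h⟩
          by_contra hn
          rw [if_neg hn] at h
          have := h1 x (by simp [hx, hn])
          rw [h] at this
          exact ha this
        · intro hx; exact ⟨hT1 hx, by simp [hx]⟩
      · have hb' : b ∈ A := by
          rcases Finset.mem_insert.1 hb with h | h
          · exact absurd h hba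
          · exact h
        rw [← h2 b hb']
        congr 1
        ext x
        simp only [Finset.mem_filter, Finset.mem_sdiff]
        constructor
        · rintro ⟨hx, h⟩
          by_cases hn : x ∈ T1
          · rw [if_pos hn] at h; exact absurd h.symm hba
          · rw [if_neg hn] at h; exact ⟨⟨hx, hn⟩, h⟩
        · rintro ⟨⟨hx, hn⟩, h⟩
          exact ⟨hx, by rw [if_neg hn]; exact h⟩

theorem grouping {X Y : Type*} (𝒲 : Finset X) (A : Finset Y) (hA : A.Nonempty) (wt : X → ℕ)
    (𝒮 : Finset ℕ) (N d M K : ℕ) (hd : 0 < d) (c : ℕ → ℤ)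
    (hc : ∑ s ∈ 𝒮, c s * (s : ℤ) = d) (hdvd : ∀ x ∈ 𝒲, d ∣ wt x) (hds : ∀ s ∈ 𝒮, d ∣ s)
    (hwt : ∀ x ∈ 𝒲, wt x ≤ N) (hK : ∀ s ∈ 𝒮, (N : ℤ) * |c s| ≤ K)
    (tot : ∑ x ∈ 𝒲, wt x = A.card * (d * M))
    (occ : ∀ s ∈ 𝒮, A.card * K ≤ (𝒲.filter (fun x => wt x = s)).card) :
    ∃ φ : X → Y, (∀ x ∈ 𝒲, φ x ∈ A) ∧
      ∀ a ∈ A, ∑ x ∈ 𝒲.filter (fun x => φ x = a), wt x = d * M := by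
  have : Nonempty Y := ⟨hA.choose⟩
  have hT : ∀ s, ∃ T : Finset X, s ∈ 𝒮 → (T ⊆ 𝒲.filter (fun x => wt x = s) ∧ T.card = A.card * K) := by
    intro s
    by_cases hs : s ∈ 𝒮
    · obtain ⟨T, h1, h2⟩ := Finset.exists_subset_card_eq (occ s hs)
      exact ⟨T, fun _ => ⟨h1, h2⟩⟩
    · exact ⟨∅, fun h => absurd h hs⟩
  choose T hT using hT
  have hTw : ∀ s ∈ 𝒮, ∀ x ∈ T s, x ∈ 𝒲 ∧ wt x = s := by
    intro s hs x hx
    have := (hT s hs).1 hx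
    simpa using this
  have hTU : 𝒮.biUnion T ⊆ 𝒲 := by
    intro x hx
    rw [Finset.mem_biUnion] at hx
    obtain ⟨s, hs, hx⟩ := hx
    exact (hTw s hs x hx).1
  have hTd : (𝒮 : Set ℕ).PairwiseDisjoint T := by
    intro s hs s' hs' hne
    rw [Function.onFun, Finset.disjoint_left]
    intro x h1 h2
    exact hne ((hTw s hs x h1).2.symm.trans (hTw s' hs' x h2).2)
  set R := 𝒲 \ 𝒮.biUnion T with hR
  have hsum : ∀ f : X → ℤ, ∑ x ∈ 𝒲, f x = ∑ x ∈ R, f x + ∑ s ∈ 𝒮, ∑ x ∈ T s, f x := by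
    intro f
    rw [← Finset.sum_biUnion hTd, hR, Finset.sum_sdiff hTU]
  have hRW : ∀ x ∈ R, x ∈ 𝒲 := fun x hx => (Finset.mem_sdiff.1 hx).1
  obtain ⟨φ0, g1, g2⟩ := greedy R A hA wt N (fun x hx => hwt x (hRW x hx))
  let σ : Y → ℤ := fun a => ((∑ x ∈ R, if φ0 x = a then wt x else 0 : ℕ) : ℤ)
  let δ : Y → ℤ := fun a => d * M - K * ∑ s ∈ 𝒮, (s : ℤ) - σ a
  have hδd : ∀ a, (d : ℤ) ∣ δ a := by
    intro a
    refine dvd_sub (dvd_sub (dvd_mul_right _ _) (Dvd.dvd.mul_left ?_ _)) ?_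
    · exact Finset.dvd_sum fun s hs => Int.natCast_dvd_natCast.2 (hds s hs)
    · apply Int.natCast_dvd_natCast.2
      apply Finset.dvd_sum
      intro x hx
      split_ifs
      · exact hdvd x (hRW x hx)
      · exact dvd_zero _
  choose δ' hδ' using hδd
  have hσ : ∑ a ∈ A, σ a = ∑ x ∈ R, (wt x : ℤ) := by
    simp only [σ]
    push_cast
    rw [Finset.sum_comm]
    apply Finset.sum_congr rfl
    intro x hx
    rw [Finset.sum_ite_eq, if_pos (g1 x)]
  have hδ0 : ∑ a ∈ A, δ a = 0 := by
    simp only [δ]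
    rw [Finset.sum_sub_distrib, hσ, Finset.sum_const]
    have h1 := hsum (fun x => (wt x : ℤ))
    have h2 : ∑ s ∈ 𝒮, ∑ x ∈ T s, (wt x : ℤ) = (A.card * K) * ∑ s ∈ 𝒮, (s : ℤ) := by
      rw [Finset.mul_sum]
      apply Finset.sum_congr rfl
      intro s hs
      rw [Finset.sum_congr rfl (g := fun _ => (s : ℤ)) (fun x hx => by rw [(hTw s hs x hx).2])]
      rw [Finset.sum_const, (hT s hs).2]
      simp
    have h3 : ∑ x ∈ 𝒲, (wt x : ℤ) = A.card * (d * M) := by exact_mod_cast tot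
    rw [h2, h3] at h1
    simp only [nsmul_eq_mul]
    linarith
  have hδ'0 : ∑ a ∈ A, δ' a = 0 := by
    have : (d : ℤ) * ∑ a ∈ A, δ' a = 0 := by
      rw [Finset.mul_sum, ← hδ0]
      exact Finset.sum_congr rfl fun a _ => (hδ' a).symm
    rcases mul_eq_zero.1 this with h | h
    · exact absurd h (by positivity)
    · exact h
  have hδN : ∀ a ∈ A, |δ a| ≤ N := by
    intro a ha
    have hd2 : ∀ b ∈ A, ∀ b' ∈ A, δ b ≤ δ b' + N := by
      intro b hb b' hb'
      have : σ b' ≤ σ b + N := by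
        have := g2 b' hb' b hb
        simp only [σ]
        exact_mod_cast this
      simp only [δ]; linarith
    obtain ⟨b, hb, hb0⟩ : ∃ b ∈ A, δ b ≤ 0 := by
      by_contra hcon
      push Not at hcon
      have := Finset.sum_pos hcon hA
      omega
    obtain ⟨b', hb', hb0'⟩ : ∃ b ∈ A, 0 ≤ δ b := by
      by_contra hcon
      push Not at hcon
      have := Finset.sum_neg hcon hA
      omega
    rw [abs_le]
    constructor
    · linarith [hd2 b' hb' a ha]
    · linarith [hd2 a ha b hb]
  have hδN' : ∀ a ∈ A, |δ' a| ≤ N := by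
    intro a ha
    refine le_trans ?_ (hδN a ha)
    rw [hδ' a, abs_mul, Nat.abs_cast]
    have : (1 : ℤ) ≤ d := by exact_mod_cast hd
    nlinarith [abs_nonneg (δ' a)]
  have hpos : ∀ s ∈ 𝒮, ∀ a ∈ A, 0 ≤ (K : ℤ) + δ' a * c s := by
    intro s hs a ha
    have h1 := hK s hs
    have h2 := mul_le_mul_of_nonneg_right (hδN' a ha) (abs_nonneg (c s))
    rw [← abs_mul] at h2
    have := neg_abs_le (δ' a * c s)
    linarith
  have hψ : ∀ s, ∃ ψ : X → Y, s ∈ 𝒮 → ((∀ x ∈ T s, ψ x ∈ A) ∧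
      ∀ a ∈ A, (((T s).filter (fun x => ψ x = a)).card : ℤ) = K + δ' a * c s) := by
    intro s
    by_cases hs : s ∈ 𝒮
    · obtain ⟨ψ, h1, h2⟩ := fiber (T s) A (fun a => ((K : ℤ) + δ' a * c s).toNat) (by
        rw [(hT s hs).2]
        zify
        rw [Finset.sum_congr rfl (g := fun a => (K : ℤ) + δ' a * c s)
          (fun a ha => Int.toNat_of_nonneg (hpos s hs a ha))]
        rw [Finset.sum_add_distrib, ← Finset.sum_mul, hδ'0]
        simp)
      refine ⟨ψ, fun _ => ⟨h1, fun a ha => ?_⟩⟩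
      rw [h2 a ha, Int.toNat_of_nonneg (hpos s hs a ha)]
    · exact ⟨φ0, fun h => absurd h hs⟩
  choose ψ hψ using hψ
  have hRT : ∀ s ∈ 𝒮, ∀ x ∈ T s, x ∉ R := by
    intro s hs x hx hxR
    exact (Finset.mem_sdiff.1 hxR).2 (Finset.mem_biUnion.2 ⟨s, hs, hx⟩)
  refine ⟨fun x => if x ∈ R then φ0 x else ψ (wt x) x, ?_, ?_⟩
  · intro x hx
    by_cases hxR : x ∈ R
    · simp only [hxR, if_true]; exact g1 x
    · simp only [hxR, if_false]
      have : x ∈ 𝒮.biUnion T := by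
        by_contra h; exact hxR (Finset.mem_sdiff.2 ⟨hx, h⟩)
      obtain ⟨s, hs, hxs⟩ := Finset.mem_biUnion.1 this
      rw [(hTw s hs x hxs).2]
      exact (hψ s hs).1 x hxs
  · intro a ha
    zify
    rw [Finset.sum_filter, hsum]
    have e1 : (∑ x ∈ R, if (if x ∈ R then φ0 x else ψ (wt x) x) = a then (wt x : ℤ) else 0) = σ a := by
      simp only [σ]
      push_cast
      apply Finset.sum_congr rfl
      intro x hx
      simp only [hx, if_true]
    have e2 : (∑ s ∈ 𝒮, ∑ x ∈ T s, if (if x ∈ R then φ0 x else ψ (wt x) x) = a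
        then (wt x : ℤ) else 0) = ∑ s ∈ 𝒮, (K * (s : ℤ) + δ' a * (c s * s)) := by
      apply Finset.sum_congr rfl
      intro s hs
      rw [← Finset.sum_filter]
      rw [Finset.sum_congr (g := fun _ => (s : ℤ)) (s₂ := (T s).filter (fun x => ψ s x = a))]
      · rw [Finset.sum_const, nsmul_eq_mul, (hψ s hs).2 a ha]; ring
      · ext x
        simp only [Finset.mem_filter]
        constructor
        · rintro ⟨h1, h2⟩
          rw [if_neg (hRT s hs x h1), (hTw s hs x h1).2] at h2
          exact ⟨h1, h2⟩
        · rintro ⟨h1, h2⟩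
          refine ⟨h1, ?_⟩
          rw [if_neg (hRT s hs x h1), (hTw s hs x h1).2]
          exact h2
      · intro x hx
        rw [(hTw s hs x (Finset.mem_filter.1 hx).1).2]
    rw [e1, e2, Finset.sum_add_distrib, ← Finset.mul_sum, ← Finset.mul_sum, hc]
    have := hδ' a
    simp only [δ] at this
    linarith

/-! ### Part 6 : recurrent clusters -/
theorem bezout (𝒮 : Finset ℕ) : ∃ (d : ℕ) (c : ℕ → ℤ), (∀ s ∈ 𝒮, d ∣ s) ∧
    ∑ s ∈ 𝒮, c s * (s : ℤ) = d := by
  induction 𝒮 using Finset.induction_on with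
  | empty => exact ⟨0, fun _ => 0, by simp, by simp⟩
  | insert a S ha ih =>
    obtain ⟨d, c, h1, h2⟩ := ih
    refine ⟨Nat.gcd a d, fun s => if s = a then Nat.gcdA a d else Nat.gcdB a d * c s, ?_, ?_⟩
    · intro s hs
      rcases Finset.mem_insert.1 hs with h | h
      · rw [h]; exact Nat.gcd_dvd_left _ _
      · exact (Nat.gcd_dvd_right _ _).trans (h1 s h)
    · rw [Finset.sum_insert ha]
      beta_reduce
      rw [if_pos rfl, Nat.gcd_eq_gcd_ab, ← h2, Finset.sum_mul]
      rw [mul_comm]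
      congr 1
      apply Finset.sum_congr rfl
      intro s hs
      have : s ≠ a := by rintro rfl; exact ha hs
      rw [if_neg this]
      ring

theorem reg {m : ℕ} (hm : 2 ≤ m) {α : Type*} [MetricSpace α] {P : List (Fin m) → Set α} {r : ℝ}
    [h : Fact (0 < r ∧ r < 1)] {N : ℕ} {K0 a0 : ℝ} (H : Sys P r N K0 a0) (ha0 : 0 < a0)
    {w0 : List (Fin m)} (hw0 : ∀ w, (cl P w).card ≤ (cl P w0).card) :
    ∃ (d : ℕ) (C : ℝ), 0 < d ∧ 0 < C ∧ d ∣ (cl P w0).card ∧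
      ∀ (x : List (Fin m)) (A : Finset (List (Fin m))),
        (∀ a ∈ A, a.length = x.length + w0.length) →
        (∀ a ∈ A, ∀ a' ∈ A, a.take x.length = a'.take x.length) →
        d * A.card = (cl P w0).card →
        ARel C 0 (US P (cl P (x ++ w0))) (VA r A (x.length + w0.length)) := by
  have h0 := h.1.1
  have h1 := h.1.2
  have hw0r : RecT P w0 w0 := ⟨le_rfl, by rw [List.take_length]; exact Conn.rfl'⟩
  have hpos : ∀ w, 0 < (cl P w).card := fun w => Finset.card_pos.2 ⟨w, self_mem_cl⟩
  set 𝒮 := (Finset.range (N + 1)).filter (fun s => ∃ t, RecT P w0 t ∧ (cl P t).card = s) with h𝒮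
  have hmem : ∀ t, RecT P w0 t → (cl P t).card ∈ 𝒮 := by
    intro t ht
    rw [h𝒮, Finset.mem_filter, Finset.mem_range]
    exact ⟨Nat.lt_succ_of_le (H.card t), t, ht, rfl⟩
  obtain ⟨d, c, hd1, hc⟩ := bezout 𝒮
  have hd : 0 < d := Nat.pos_of_dvd_of_pos (hd1 _ (hmem _ hw0r)) (hpos w0)
  have ht : ∀ s, ∃ t, s ∈ 𝒮 → (RecT P w0 t ∧ (cl P t).card = s) := by
    intro s
    by_cases hs : s ∈ 𝒮
    · rw [h𝒮, Finset.mem_filter] at hs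
      obtain ⟨-, t, ht⟩ := hs
      exact ⟨t, fun _ => ht⟩
    · exact ⟨[], fun h => absurd h hs⟩
  choose tt htt using ht
  set K : ℕ := ∑ s ∈ 𝒮, N * (c s).natAbs with hKdef
  have hK : ∀ s ∈ 𝒮, (N : ℤ) * |c s| ≤ K := by
    intro s hs
    have := Finset.single_le_sum (f := fun s => N * (c s).natAbs) (fun _ _ => Nat.zero_le _) hs
    rw [Int.abs_eq_natAbs]
    exact_mod_cast this
  set τ : ℕ := ∑ s ∈ 𝒮, (tt s).length with hτdef
  have hτ : ∀ s ∈ 𝒮, (tt s).length ≤ τ := fun s hs =>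
    Finset.single_le_sum (f := fun s => (tt s).length) (fun _ _ => Nat.zero_le _) hs
  set e : ℕ := w0.length + 1 + τ + N * K with he
  have hNK : N * K ≤ m ^ (N * K) := (Nat.lt_pow_self (by omega)).le
  have hre : 0 < r ^ e := pow_pos h0 e
  obtain ⟨C, hC, B⟩ := bisim (α := α) (β := Sy m r) (r := r) (D := max K0 (r ^ e)⁻¹)
    (c := min a0 1 * r ^ e) (C₀ := 1) h0 h1 (by positivity) (le_max_of_le_right (by positivity))
    (fun k U V => ∃ (x t : List (Fin m)) (A : Finset (List (Fin m))), RecT P w0 t ∧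
      k = (x ++ t).length ∧ (∀ a ∈ A, a.length = k) ∧
      (∀ a ∈ A, ∀ a' ∈ A, a.take (k - e) = a'.take (k - e)) ∧
      d * A.card = (cl P (x ++ t)).card ∧ U = US P (cl P (x ++ t)) ∧ V = VA r A k)
    (by
      rintro k U V ⟨x, t, A, ht, hk, hA, hA2, hcard, rfl, rfl⟩
      have hAne : A.Nonempty := by
        rw [← Finset.card_pos]
        have := hpos (x ++ t)
        rw [← hcard] at this
        exact Nat.pos_of_mul_pos_left this
      exact ⟨US_ne H _, VA_nonempty (by omega) hA hAne, US_cpt H _, VA_compact _ _⟩)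
    (by
      rintro k U V ⟨x, t, A, ht, hk, hA, hA2, hcard, rfl, rfl⟩ u hu v hv
      rw [hk]
      exact (US_diam H _ u hu v hv).trans
        (mul_le_mul_of_nonneg_right (le_max_left _ _) (pow_pos h0 _).le))
    (by
      rintro k U V ⟨x, t, A, ht, hk, hA, hA2, hcard, rfl, rfl⟩ u hu v hv
      exact (VA_diam hA2 hu hv).trans
        (mul_le_mul_of_nonneg_right (le_max_right _ _) (pow_pos h0 _).le))
    (by
      rintro k U V ⟨x, t, A, ht, hk, hA, hA2, hcard, rfl, rfl⟩
      set w := x ++ t with hw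
      have hApos : 0 < A.card := by
        have := hpos w
        rw [← hcard] at this
        exact Nat.pos_of_mul_pos_left this
      have hAne : A.Nonempty := Finset.card_pos.1 hApos
      have hAN : A.card ≤ N := by
        have := H.card w
        rw [← hcard] at this
        nlinarith
      set 𝒲 := chil P (cl P w) e with h𝒲
      have hWrec : ∀ W ∈ 𝒲, ∃ t', RecT P w0 t' ∧ (x ++ t').length = k + e ∧ W = cl P (x ++ t') := by
        intro W hW
        rw [h𝒲, mem_chil] at hW
        obtain ⟨y, hy1, hy2, rfl⟩ := hW
        obtain ⟨t', rfl, ht'⟩ := rec_ext H hw0 ht hy2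
        exact ⟨t', ht', by rw [hy1, hk], rfl⟩
      have hWmem : ∀ W ∈ 𝒲, W.card ∈ 𝒮 := by
        intro W hW
        obtain ⟨t', ht', -, rfl⟩ := hWrec W hW
        rw [card_cl_rec H hw0 ht']
        exact hmem t' ht'
      obtain ⟨φ, hφA, hφ⟩ := grouping 𝒲 A hAne Finset.card 𝒮 N d (m ^ e) K hd c hc
        (fun W hW => hd1 _ (hWmem W hW)) hd1
        (fun W hW => by
          obtain ⟨t', ht', -, rfl⟩ := hWrec W hW
          exact H.card _) hK
        (by rw [h𝒲, chil_card H, ← hcard]; ring)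
        (by
          intro s hs
          obtain ⟨hts, htc⟩ := htt s hs
          have hle : A.card * K ≤ (Wd m (e - (tt s).length)).card := by
            rw [card_Wd]
            calc A.card * K ≤ N * K := Nat.mul_le_mul_right _ hAN
              _ ≤ m ^ (N * K) := hNK
              _ ≤ _ := Nat.pow_le_pow_right (by omega) (by have := hτ s hs; omega)
          refine hle.trans ?_
          apply Finset.card_le_card_of_injOn (fun z => cl P (w ++ z ++ tt s))
          · intro z hz
            rw [Finset.mem_coe, mem_Wd] at hz
            rw [Finset.mem_coe, Finset.mem_filter, h𝒲, mem_chil]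
            refine ⟨⟨_, ?_, ?_, rfl⟩, ?_⟩
            · simp only [List.length_append, hz]
              have := hτ s hs
              omega
            · rw [List.append_assoc, List.take_left']
              · exact Conn.rfl'
              · rfl
            · rw [card_cl_rec H hw0 hts, htc]
          · intro z hz z' hz' hzz
            rw [Finset.mem_coe, mem_Wd] at hz hz'
            have h3 : w ++ z ++ tt s ∈ cl P (w ++ z' ++ tt s) := by
              have h4 : cl P (w ++ z ++ tt s) = cl P (w ++ z' ++ tt s) := hzz
              rw [← h4]; exact self_mem_cl
            rw [cl_rec H hw0 hts, Finset.mem_image] at h3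
            obtain ⟨v, hv, h3⟩ := h3
            have h3' : w ++ (z' ++ v) = w ++ (z ++ tt s) := by
              rw [← List.append_assoc, ← List.append_assoc]; exact h3
            have h5 := List.append_cancel_left h3'
            exact (List.append_inj_left h5 (by rw [hz, hz'])).symm)
      have hφ : ∀ a ∈ A, ∑ W ∈ 𝒲.filter (fun W => φ W = a), W.card = d * m ^ e := by
        intro a ha
        rw [← hφ a ha]
        congr!
      -- split
      have hψ : ∀ a, ∃ ψ : List (Fin m) → Finset (List (Fin m)), a ∈ A →
          ((∀ y ∈ wext {a} e, ψ y ∈ 𝒲.filter (fun W => φ W = a)) ∧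
          ∀ W ∈ 𝒲.filter (fun W => φ W = a),
            ((wext {a} e).filter (fun y => ψ y = W)).card = W.card / d) := by
        intro a
        by_cases ha : a ∈ A
        · obtain ⟨ψ, h1, h2⟩ := fiber (wext {a} e) (𝒲.filter (fun W => φ W = a))
            (fun W => W.card / d) (by
              rw [card_wext (k := k) (by simpa using hA a ha), Finset.card_singleton, one_mul]
              apply Nat.eq_of_mul_eq_mul_left hd
              rw [← hφ a ha, Finset.mul_sum]
              apply Finset.sum_congr rfl
              intro W hW
              exact Nat.mul_div_cancel' (hd1 _ (hWmem W (Finset.mem_filter.1 hW).1)))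
          exact ⟨ψ, fun _ => ⟨h1, fun W hW => by rw [← h2 W hW]; congr!⟩⟩
        · exact ⟨fun _ => ∅, fun h => absurd h ha⟩
      choose ψ hψ using hψ
      let Ψ : List (Fin m) → Finset (List (Fin m)) := fun y => ψ (y.take k) y
      have hsing : ∀ a ∈ A, ∀ y, y ∈ wext {a} e ↔ y.length = k + e ∧ y.take k = a := by
        intro a ha y
        rw [mem_wext (k := k) (by simpa using hA a ha), Finset.mem_singleton]
      have hΨ : ∀ y ∈ wext A e, Ψ y ∈ 𝒲 ∧ φ (Ψ y) = y.take k := by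
        intro y hy
        rw [mem_wext hA] at hy
        have := (hψ _ hy.2).1 y ((hsing _ hy.2 y).2 ⟨hy.1, rfl⟩)
        exact Finset.mem_filter.1 this
      have hfil : ∀ W ∈ 𝒲, (wext A e).filter (fun y => Ψ y = W) =
          (wext {φ W} e).filter (fun y => ψ (φ W) y = W) := by
        intro W hW
        ext y
        simp only [Finset.mem_filter]
        constructor
        · rintro ⟨h1, h2⟩
          have h3 := (hΨ y h1).2
          rw [mem_wext hA] at h1
          rw [h2] at h3
          refine ⟨(hsing _ (hφA W hW) y).2 ⟨h1.1, h3.symm⟩, ?_⟩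
          rw [h3]; exact h2
        · rintro ⟨h1, h2⟩
          rw [hsing _ (hφA W hW)] at h1
          refine ⟨(mem_wext hA).2 ⟨h1.1, by rw [h1.2]; exact hφA W hW⟩, ?_⟩
          show ψ (y.take k) y = W
          rw [h1.2]; exact h2
      refine ⟨𝒲, fun W => US P W.1, fun W => VA r ((wext A e).filter (fun y => Ψ y = W.1)) (k + e),
        chil_US H w e, ?_, ?_, ?_, ?_⟩
      · rw [← VA_wext e hA]
        ext u
        rw [Set.mem_iUnion]
        constructor
        · intro hu
          have hu' : pre (k + e) u ∈ wext A e := hu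
          exact ⟨⟨_, (hΨ _ hu').1⟩, Finset.mem_filter.2 ⟨hu', rfl⟩⟩
        · rintro ⟨W, hW⟩
          exact (Finset.mem_filter.1 hW).1
      · rintro ⟨W, hW⟩ ⟨W', hW'⟩ hne u hu v hv
        obtain ⟨t', ht', hl, rfl⟩ := hWrec W hW
        obtain ⟨t'', ht'', hl', rfl⟩ := hWrec W' hW'
        have := US_sep H (hl.trans hl'.symm) (fun hh => hne (Subtype.ext hh)) u hu v hv
        refine le_trans ?_ this
        rw [hl, mul_assoc, ← pow_add, add_comm e k]
        exact mul_le_mul_of_nonneg_right (min_le_left _ _) (pow_pos h0 _).le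
      · rintro ⟨W, hW⟩ ⟨W', hW'⟩ hne u hu v hv
        have : r ^ (k + e) ≤ dist u v := by
          refine VA_sep ?_ hu hv
          rw [Finset.disjoint_left]
          intro y h1 h2
          simp only [Finset.mem_filter] at h1 h2
          exact hne (Subtype.ext (h1.2.symm.trans h2.2))
        refine le_trans ?_ this
        rw [mul_assoc, ← pow_add, add_comm e k]
        exact (mul_le_mul_of_nonneg_right (min_le_right _ _) (pow_pos h0 _).le).trans (one_mul _).le
      · rintro ⟨W, hW⟩
        left
        obtain ⟨t', ht', hl, hWe⟩ := hWrec W hW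
        refine ⟨k + e, by omega, x, t', _, ht', hl.symm, ?_, ?_, ?_, congrArg (US P) hWe, rfl⟩
        · intro y hy
          rw [Finset.mem_filter, mem_wext hA] at hy
          exact hy.1.1
        · have : ∀ y ∈ (wext A e).filter (fun y => Ψ y = W), y.take (k + e - e) = φ W := by
            intro y hy
            rw [hfil W hW, Finset.mem_filter, hsing _ (hφA W hW)] at hy
            rw [Nat.add_sub_cancel, hy.1.2]
          intro y hy y' hy'
          rw [this y hy, this y' hy']
        · simp only
          rw [hfil W hW, (hψ _ (hφA W hW)).2 W (Finset.mem_filter.2 ⟨hW, rfl⟩), ← hWe]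
          exact Nat.mul_div_cancel' (hd1 _ (hWmem W hW)))
  refine ⟨d, C, hd, hC, hd1 _ (hmem _ hw0r), ?_⟩
  intro x A hA hA2 hcard
  refine B (x.length + w0.length) _ _ ⟨x, w0, A, hw0r, by simp, hA, ?_, ?_, rfl, rfl⟩
  · intro a ha a' ha'
    have e1 : x.length + w0.length - e ≤ x.length := by omega
    have := congrArg (List.take (x.length + w0.length - e)) (hA2 a ha a' ha')
    rwa [List.take_take, List.take_take, min_eq_left e1] at this
  · rw [card_cl_rec H hw0 hw0r, hcard]

/-! ### Part 7 : general clusters -/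
theorem first_good {X : Type*} (Good : X → Prop) (c : ℕ) : ∃ F : (ℕ → X) → X, ∀ s : ℕ → X,
    ∃ j ≤ c, F s = s j ∧ (∀ s' : ℕ → X, (∀ i ≤ j, s' i = s i) → F s' = F s) ∧
      ((1 ≤ j ∧ Good (s j)) ∨ (j = c ∧ ∀ i, 1 ≤ i → i ≤ c → ¬ Good (s i))) := by
  let Q : (ℕ → X) → ℕ → Prop := fun s j => 1 ≤ j ∧ j ≤ c ∧ Good (s j)
  refine ⟨fun s => if h : ∃ j, Q s j then s (Nat.find h) else s c, ?_⟩
  intro s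
  by_cases h : ∃ j, Q s j
  · have hs := Nat.find_spec h
    refine ⟨Nat.find h, hs.2.1, by simp only [dif_pos h], ?_, Or.inl ⟨hs.1, hs.2.2⟩⟩
    intro s' hs'
    have hQ : Q s' (Nat.find h) := ⟨hs.1, hs.2.1, by rw [hs' _ le_rfl]; exact hs.2.2⟩
    have h' : ∃ j, Q s' j := ⟨_, hQ⟩
    have e : Nat.find h' = Nat.find h := by
      apply le_antisymm (Nat.find_min' h' hQ)
      by_contra hlt
      push Not at hlt
      have h3 := Nat.find_spec h'
      refine Nat.find_min h hlt ⟨h3.1, h3.2.1, ?_⟩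
      rw [← hs' _ hlt.le]; exact h3.2.2
    simp only [dif_pos h, dif_pos h']
    rw [e]
    exact hs' _ le_rfl
  · refine ⟨c, le_rfl, by simp only [dif_neg h], ?_, Or.inr ⟨rfl, ?_⟩⟩
    · intro s' hs'
      have h' : ¬ ∃ j, Q s' j := by
        rintro ⟨j, h1, h2, h3⟩
        exact h ⟨j, h1, h2, by rw [← hs' j h2]; exact h3⟩
      simp only [dif_neg h, dif_neg h']
      exact hs' c le_rfl
    · intro i h1 h2 h3
      exact h ⟨i, h1, h2, h3⟩

theorem count_bad {m : ℕ} (w0 : List (Fin m)) (k : ℕ) (A : Finset (List (Fin m)))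
    (hA : ∀ a ∈ A, a.length = k) (c : ℕ) :
    ((wext A (c * w0.length)).filter (fun y => ∀ j < c,
      (y.drop (k + j * w0.length)).take w0.length ≠ w0)).card ≤
      A.card * (m ^ w0.length - 1) ^ c := by
  induction c with
  | zero =>
    refine (Finset.card_filter_le _ _).trans ?_
    rw [card_wext hA]
    simp
  | succ c ih =>
    set κ := w0.length with hκ
    rw [pow_succ, ← mul_assoc]
    have h1 : ((Wd m κ).erase w0).card = m ^ κ - 1 := by
      rw [Finset.card_erase_of_mem (mem_Wd.2 rfl), card_Wd]
    refine le_trans ?_ (Nat.mul_le_mul_right (m ^ κ - 1) ih)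
    rw [← h1]
    rw [← Finset.card_product]
    apply Finset.card_le_card_of_injOn
      (fun y => (y.take (k + c * κ), y.drop (k + c * κ)))
    · intro y hy
      rw [Finset.mem_coe, Finset.mem_filter, mem_wext hA] at hy
      obtain ⟨⟨hl, ht⟩, hj⟩ := hy
      have hl' : y.length = k + c * κ + κ := by rw [hl]; ring
      rw [Finset.mem_coe, Finset.mem_product, Finset.mem_filter, mem_wext hA, Finset.mem_erase,
        mem_Wd]
      refine ⟨⟨⟨?_, ?_⟩, ?_⟩, ?_, ?_⟩
      · simp only [List.length_take]; omega
      · simp only [List.take_take]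
        rw [min_eq_left (by omega)]; exact ht
      · intro j hjc
        have := hj j (by omega)
        have hle : j * κ + κ ≤ c * κ := by
          calc j * κ + κ = (j + 1) * κ := by ring
            _ ≤ c * κ := Nat.mul_le_mul_right _ hjc
        simp only [List.drop_take, List.take_take]
        rw [min_eq_left (by omega)]
        exact this
      · have := hj c (by omega)
        rw [List.take_of_length_le] at this
        · exact this
        · simp only [List.length_drop]; omega
      · simp only [List.length_drop]; omega
    · intro y hy y' hy' h
      simp only [Prod.mk.injEq] at h
      rw [← List.take_append_drop (k + c * κ) y, h.1, h.2, List.take_append_drop]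

theorem exists_c (N q : ℕ) (hq : 0 < q) : ∃ c, N * (q - 1) ^ c < q ^ c := by
  have hq' : (0 : ℝ) < q := by exact_mod_cast hq
  have hN : (0 : ℝ) < (N : ℝ) + 1 := by positivity
  obtain ⟨c, hc⟩ := exists_pow_lt_of_lt_one (show (0 : ℝ) < ((N : ℝ) + 1)⁻¹ by positivity)
    (show ((q : ℝ) - 1) / q < 1 by rw [div_lt_one hq']; linarith)
  refine ⟨c, ?_⟩
  have h1 : ((q - 1 : ℕ) : ℝ) = (q : ℝ) - 1 := by push_cast [Nat.cast_sub (show 1 ≤ q from hq)]; ring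
  have : (N : ℝ) * ((q - 1 : ℕ) : ℝ) ^ c < (q : ℝ) ^ c := by
    rw [h1]
    rw [div_pow, div_lt_iff₀ (by positivity), ← div_eq_inv_mul, lt_div_iff₀ hN] at hc
    have : 0 ≤ ((q : ℝ) - 1) ^ c := by
      rw [← h1]; positivity
    linarith
  exact_mod_cast this

/-- decomposition of a cluster into good and bad clusters -/
theorem decomp {m : ℕ} {α : Type*} [MetricSpace α] {P : List (Fin m) → Set α} {r : ℝ}
    [h : Fact (0 < r ∧ r < 1)] {N : ℕ} {K0 a0 : ℝ} (H : Sys P r N K0 a0)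
    (w0 : List (Fin m)) (c : ℕ) (hc : 0 < c) (hm : 0 < m) (w : List (Fin m)) :
    ∃ Gd Bd : Finset (Finset (List (Fin m))),
      Disjoint Gd Bd ∧ Gd.Nonempty ∧ Gd.card ≤ N * m ^ (c * w0.length) ∧
      Bd.card ≤ N * (m ^ w0.length - 1) ^ c ∧
      (∀ I ∈ Gd, ∃ x, I = cl P (x ++ w0) ∧ w.length ≤ x.length ∧
        x.length + w0.length ≤ w.length + c * w0.length) ∧
      (∀ I ∈ Bd, ∃ y, I = cl P y ∧ y.length = w.length + c * w0.length) ∧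
      US P (cl P w) = (⋃ I : (Gd ∪ Bd : Finset _), US P I.1) ∧
      (∀ I ∈ Gd ∪ Bd, ∀ I' ∈ Gd ∪ Bd, I ≠ I' → ∀ x ∈ US P I, ∀ x' ∈ US P I',
        a0 * r ^ (w.length + c * w0.length) ≤ dist x x') := by
  set κ := w0.length with hκ
  set k := w.length with hk
  obtain ⟨F, hF⟩ := first_good (fun I : Finset (List (Fin m)) => ∃ x, I = cl P (x ++ w0)) c
  set Y := wext (cl P w) (c * κ) with hY
  let sq : List (Fin m) → ℕ → Finset (List (Fin m)) := fun y j => cl P (y.take (k + j * κ))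
  let σ : List (Fin m) → Finset (List (Fin m)) := fun y => F (sq y)
  have hYm : ∀ y, y ∈ Y ↔ y.length = k + c * κ ∧ Conn P w (y.take k) := fun y => mem_wext_cl
  have hjle : ∀ j ≤ c, j * κ ≤ c * κ := fun j hj => Nat.mul_le_mul_right _ hj
  -- main property
  have hσ : ∀ y0 ∈ Y, ∃ j ≤ c, σ y0 = cl P (y0.take (k + j * κ)) ∧
      (∀ y ∈ Y, Conn P (y0.take (k + j * κ)) (y.take (k + j * κ)) → σ y = σ y0) ∧
      ((1 ≤ j ∧ ∃ x, σ y0 = cl P (x ++ w0)) ∨ (j = c ∧ ∀ i, 1 ≤ i → i ≤ c →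
        ¬ ∃ x, cl P (y0.take (k + i * κ)) = cl P (x ++ w0))) := by
    intro y0 hy0
    obtain ⟨j, hj, e1, e2, e3⟩ := hF (sq y0)
    refine ⟨j, hj, e1, ?_, ?_⟩
    · intro y hy hyy
      apply e2
      intro i hi
      have hi' : i * κ ≤ j * κ := Nat.mul_le_mul_right _ hi
      have := H.conn_take hyy (k + i * κ)
      rw [List.take_take, List.take_take, min_eq_left (by omega)] at this
      exact (cl_eq this).symm
    · rcases e3 with ⟨h1, h2⟩ | h
      · left
        refine ⟨h1, ?_⟩
        show ∃ x, F (sq y0) = _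
        rw [e1]
        exact h2
      · exact Or.inr h
  let good : Finset (List (Fin m)) → Prop := fun I => ∃ x, I = cl P (x ++ w0) ∧ k ≤ x.length ∧
        x.length + κ ≤ k + c * κ
  set ℐ := Y.image σ with hℐ
  have hcov : ℐ.filter good ∪ ℐ.filter (fun I => ¬ good I) = ℐ := Finset.filter_union_filter_not_eq _ _
  have hcardY : Y.card ≤ N * m ^ (c * κ) := by
    rw [hY, card_wext cl_length]
    exact Nat.mul_le_mul_right _ (H.card w)
  have hbad : ∀ I ∈ ℐ.filter (fun I => ¬ good I), ∃ y ∈ Y, I = cl P y ∧ ∀ j < c,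
      (y.drop (k + j * κ)).take κ ≠ w0 := by
    intro I hI
    rw [Finset.mem_filter, hℐ, Finset.mem_image] at hI
    obtain ⟨⟨y, hy, rfl⟩, hng⟩ := hI
    obtain ⟨j, hj, e1, e2, e3⟩ := hσ y hy
    have hyl := ((hYm y).1 hy).1
    rcases e3 with ⟨h1, x, hx⟩ | ⟨rfl, h2⟩
    · exfalso
      apply hng
      refine ⟨x, hx, ?_⟩
      have h3 : y.take (k + j * κ) ∈ cl P (x ++ w0) := by
        rw [← hx, e1]; exact self_mem_cl
      have h4 := cl_length _ h3
      have h5 := hjle j hj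
      have h6 : κ ≤ j * κ := Nat.le_mul_of_pos_left _ h1
      simp only [List.length_take, List.length_append] at h4
      omega
    · refine ⟨y, hy, ?_, ?_⟩
      · rw [e1, List.take_of_length_le hyl.le]
      · intro i hi hcon
        refine h2 (i + 1) (by omega) (by omega) ⟨y.take (k + i * κ), ?_⟩
        rw [add_mul, one_mul, ← add_assoc, List.take_add, hcon]
  refine ⟨ℐ.filter good, ℐ.filter (fun I => ¬ good I), Finset.disjoint_filter_filter_not _ _ _,
    ?_, ?_, ?_, ?_, ?_, ?_, ?_⟩
  · -- a good one
    let z : List (Fin m) := List.replicate ((c - 1) * κ) ⟨0, hm⟩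
    have hck : κ + (c - 1) * κ = c * κ := by
      obtain ⟨c', rfl⟩ : ∃ c', c = c' + 1 := ⟨c - 1, by omega⟩
      simp; ring
    have hl : (w ++ w0 ++ z).length = k + c * κ := by simp [z]; omega
    have hy : w ++ w0 ++ z ∈ Y := by
      rw [hYm]
      refine ⟨hl, ?_⟩
      rw [List.append_assoc, List.take_left' hk.symm]
      exact Conn.rfl'
    refine ⟨σ (w ++ w0 ++ z), Finset.mem_filter.2 ⟨Finset.mem_image_of_mem _ hy, ?_⟩⟩
    by_contra hng
    have hmem : σ (w ++ w0 ++ z) ∈ ℐ.filter (fun I => ¬ good I) :=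
      Finset.mem_filter.2 ⟨Finset.mem_image_of_mem _ hy, hng⟩
    obtain ⟨j, hj, e1, e2, e3⟩ := hσ _ hy
    rcases e3 with ⟨h1, x, hx⟩ | ⟨rfl, h2⟩
    · apply hng
      refine ⟨x, hx, ?_⟩
      have h3 : (w ++ w0 ++ z).take (k + j * κ) ∈ cl P (x ++ w0) := by
        rw [← hx, e1]; exact self_mem_cl
      have h4 := cl_length _ h3
      have h5 := hjle j hj
      have h6 : κ ≤ j * κ := Nat.le_mul_of_pos_left _ h1
      rw [List.length_take, hl] at h4
      simp only [List.length_append] at h4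
      omega
    · apply h2 1 le_rfl hc
      refine ⟨w, ?_⟩
      rw [one_mul, List.take_left']
      simp [hk, hκ]
  · exact (Finset.card_filter_le _ _).trans (Finset.card_image_le.trans hcardY)
  · have h1 := count_bad w0 k (cl P w) cl_length c
    refine le_trans ?_ (h1.trans (Nat.mul_le_mul_right _ (H.card w)))
    refine (Finset.card_le_card (t := Finset.image (cl P) ((wext (cl P w) (c * w0.length)).filter
      (fun y => ∀ j < c, (y.drop (k + j * w0.length)).take w0.length ≠ w0))) ?_).trans
      Finset.card_image_le
    intro I hI
    obtain ⟨y, hy, e, hj⟩ := hbad I hI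
    exact Finset.mem_image.2 ⟨y, Finset.mem_filter.2 ⟨hy, hj⟩, e.symm⟩
  · intro I hI
    exact (Finset.mem_filter.1 hI).2
  · intro I hI
    obtain ⟨y, hy, e, hj⟩ := hbad I hI
    exact ⟨y, e, ((hYm y).1 hy).1⟩
  · rw [hcov]
    ext u
    rw [Set.mem_iUnion]
    constructor
    · intro hu
      rw [US_split H _ (c * κ)] at hu
      simp only [US, Set.mem_iUnion, exists_prop] at hu
      obtain ⟨y, hy, hu⟩ := hu
      refine ⟨⟨σ y, Finset.mem_image_of_mem _ hy⟩, ?_⟩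
      obtain ⟨j, hj, e1, -, -⟩ := hσ y hy
      simp only [e1, US, Set.mem_iUnion, exists_prop]
      exact ⟨_, self_mem_cl, H.sub_take _ _ hu⟩
    · rintro ⟨⟨I, hI⟩, hu⟩
      rw [hℐ, Finset.mem_image] at hI
      obtain ⟨y, hy, rfl⟩ := hI
      obtain ⟨j, hj, e1, -, -⟩ := hσ y hy
      simp only [e1, US, Set.mem_iUnion, exists_prop] at hu ⊢
      obtain ⟨v, hv, hu⟩ := hu
      refine ⟨v.take k, ?_, H.sub_take _ _ hu⟩
      rw [mem_cl] at hv ⊢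
      have := H.conn_take hv k
      rw [List.take_take, min_eq_left (by omega)] at this
      exact ((hYm y).1 hy).2.trans this
  · rw [hcov]
    have key : ∀ I ∈ ℐ, ∀ u ∈ US P I, ∃ y ∈ Y, σ y = I ∧ u ∈ P y := by
      intro I hI u hu
      rw [hℐ, Finset.mem_image] at hI
      obtain ⟨y, hy, rfl⟩ := hI
      obtain ⟨j, hj, e1, e2, -⟩ := hσ y hy
      have hyY := (hYm y).1 hy
      have h5 := hjle j hj
      have hu' := hu
      rw [e1, US_split H _ (c * κ - j * κ)] at hu'
      simp only [US, Set.mem_iUnion, exists_prop] at hu'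
      obtain ⟨v, hv, hu'⟩ := hu'
      rw [mem_wext_cl] at hv
      have hl : (y.take (k + j * κ)).length = k + j * κ := by
        rw [List.length_take]; omega
      rw [hl] at hv
      have hvY : v ∈ Y := by
        rw [hYm]
        refine ⟨by omega, ?_⟩
        have := H.conn_take hv.2 k
        rw [List.take_take, List.take_take, min_eq_left (by omega)] at this
        exact hyY.2.trans this
      exact ⟨v, hvY, e2 v hvY hv.2, hu'⟩
    intro I hI I' hI' hne u hu u' hu'
    obtain ⟨y, hy, e, hu⟩ := key I hI u hu
    obtain ⟨y', hy', e', hu'⟩ := key I' hI' u' hu'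
    have l1 := ((hYm y).1 hy).1
    have l2 := ((hYm y').1 hy').1
    rw [← l1]
    refine H.sep y y' (by omega) ?_ u hu u' hu'
    intro hcon
    apply hne
    rw [← e, ← e']
    have hcn : Conn P y y' := Relation.ReflTransGen.single ⟨by omega, hcon⟩
    obtain ⟨j, hj, e1, e2, -⟩ := hσ y hy
    exact (e2 y' hy' (H.conn_take hcn _)).symm

/-- splitting the words of length `p + i` among the bad and good clusters -/
theorem split_words {m : ℕ} {X : Type*} (Gd Bd : Finset X) (p i : ℕ)
    (hd : Disjoint Gd Bd) (hG : Gd.Nonempty) (hGc : Gd.card ≤ m ^ i) (hB : Bd.card < m ^ p) :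
    ∃ (Λ : List (Fin m) → X) (ι : X → List (Fin m)),
      (∀ u, Λ u ∈ Gd ∨ Λ u ∈ Bd) ∧ (∀ B ∈ Bd, (ι B).length = p) ∧
      (∀ B ∈ Bd, ∀ u : List (Fin m), Λ u = B ↔ u.take p = ι B) ∧
      (∀ G ∈ Gd, ∃ u : List (Fin m), u.length = p + i ∧ Λ u = G) := by
  obtain ⟨ι⟩ : Nonempty (Bd ↪ Wd m p) := by
    rw [Function.Embedding.nonempty_iff_card_le]
    simp only [Fintype.card_coe, card_Wd]
    exact hB.le
  obtain ⟨ζ⟩ : Nonempty (Gd ↪ Wd m i) := by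
    rw [Function.Embedding.nonempty_iff_card_le]
    simpa [card_Wd] using hGc
  have : Nonempty Gd := hG.to_subtype
  obtain ⟨us, hus, hus'⟩ : ∃ u ∈ Wd m p, u ∉ Finset.univ.image (fun B : Bd => (ι B).1) := by
    by_contra hcon
    push Not at hcon
    have h1 := Finset.card_le_card (s := Wd m p) hcon
    have h2 := Finset.card_image_le (s := Finset.univ) (f := fun B : Bd => (ι B).1)
    rw [card_Wd] at h1
    simp only [Finset.card_univ, Fintype.card_coe] at h2
    omega
  let f : List (Fin m) → X := fun z => if hz : z ∈ Wd m i then (Function.invFun ζ ⟨z, hz⟩).1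
    else (Classical.arbitrary Gd).1
  have hf : ∀ z, f z ∈ Gd := by
    intro z
    simp only [f]
    split_ifs
    · exact Subtype.coe_prop _
    · exact Subtype.coe_prop _
  let Λ : List (Fin m) → X := fun u => if hu : ∃ B : Bd, (ι B).1 = u.take p then hu.choose.1
    else f (u.drop p)
  have hΛ1 : ∀ (B : Bd) u, u.take p = (ι B).1 → Λ u = B.1 := by
    intro B u hu
    have hex : ∃ B : Bd, (ι B).1 = u.take p := ⟨B, hu.symm⟩
    simp only [Λ]
    rw [dif_pos hex]
    have := hex.choose_spec
    rw [ι.injective (Subtype.ext (this.trans hu))]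
  refine ⟨Λ, fun x => if hx : x ∈ Bd then (ι ⟨x, hx⟩).1 else [], ?_, ?_, ?_, ?_⟩
  · intro u
    simp only [Λ]
    split_ifs with hu
    · exact Or.inr hu.choose.2
    · exact Or.inl (hf _)
  · intro B hB
    beta_reduce
    rw [dif_pos hB]
    exact mem_Wd.1 (ι ⟨B, hB⟩).2
  · intro B hB u
    beta_reduce
    rw [dif_pos hB]
    constructor
    · intro hu
      by_cases hex : ∃ B : Bd, (ι B).1 = u.take p
      · obtain ⟨B', hB'⟩ := hex
        have := hΛ1 B' u hB'.symm
        rw [hu] at this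
        rw [← hB']
        congr 2
        exact Subtype.ext this.symm
      · simp only [Λ] at hu
        rw [dif_neg hex] at hu
        exact absurd hB (Finset.disjoint_left.1 hd (hu ▸ hf _))
    · intro hu
      exact hΛ1 ⟨B, hB⟩ u hu
  · intro G hG
    have hl := mem_Wd.1 hus
    refine ⟨us ++ (ζ ⟨G, hG⟩).1, by simp [hl, mem_Wd.1 (ζ ⟨G, hG⟩).2], ?_⟩
    simp only [Λ]
    rw [dif_neg, List.drop_left' hl]
    · simp only [f]
      rw [dif_pos (ζ ⟨G, hG⟩).2]
      rw [Subtype.coe_eta, Function.leftInverse_invFun ζ.injective]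
    · rintro ⟨B, hB⟩
      rw [List.take_left' hl] at hB
      exact hus' (Finset.mem_image.2 ⟨B, Finset.mem_univ _, hB⟩)

theorem irr {m : ℕ} (hm : 2 ≤ m) {α : Type*} [MetricSpace α] {P : List (Fin m) → Set α} {r : ℝ}
    [h : Fact (0 < r ∧ r < 1)] {N : ℕ} {K0 a0 : ℝ} (H : Sys P r N K0 a0) (ha0 : 0 < a0) :
    ∃ C : ℝ, 0 < C ∧ ARel C 0 (P []) (Set.univ : Set (Sy m r)) := by
  have h0 := h.1.1
  have h1 := h.1.2
  have hpos : ∀ w, 0 < (cl P w).card := fun w => Finset.card_pos.2 ⟨w, self_mem_cl⟩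
  obtain ⟨w0, hw0, hκ⟩ : ∃ w0 : List (Fin m), (∀ w, (cl P w).card ≤ (cl P w0).card) ∧
      0 < w0.length := by
    have hfin : (Set.range fun w => (cl P w).card).Finite :=
      (Set.finite_Iic N).subset (by rintro _ ⟨w, rfl⟩; exact H.card w)
    obtain ⟨_, ⟨w1, rfl⟩, hw1⟩ := hfin.exists_maximal (Set.range_nonempty _)
    have hmax : ∀ w, (cl P w).card ≤ (cl P w1).card := by
      intro w
      rcases le_total (cl P w).card (cl P w1).card with h | h
      · exact h
      · exact hw1 ⟨w, rfl⟩ h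
    refine ⟨[⟨0, by omega⟩] ++ w1, ?_, by simp⟩
    intro w
    rw [cl_app_max H hmax, Finset.card_image_of_injective _ (fun a b h => List.append_cancel_left h)]
    exact hmax w
  obtain ⟨d, C1, hd, hC1, hdvd, R⟩ := reg hm H ha0 hw0
  set κ := w0.length with hκdef
  obtain ⟨c, hc⟩ := exists_c N (m ^ κ) (by positivity)
  have hN : 0 < N := lt_of_lt_of_le (hpos w0) (H.card w0)
  have hc0 : 0 < c := by
    rcases Nat.eq_zero_or_pos c with rfl | h
    · simp at hc; omega
    · exact h
  set i := N * m ^ (c * κ) with hi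
  have him : i ≤ m ^ i := (Nat.lt_pow_self (by omega)).le
  set e := c * κ + i with he
  have hcκ : 0 < c * κ := by positivity
  obtain ⟨C2, hC2, MO⟩ := many_one hm (r := r) e (by omega)
  have hre : 0 < r ^ e := pow_pos h0 e
  obtain ⟨C, hC, B⟩ := bisim (α := α) (β := Sy m r) (r := r) (D := max K0 1)
    (c := min a0 1 * r ^ e) (C₀ := C1 * C2 * C2) h0 h1 (by positivity)
    (le_max_of_le_right zero_le_one)
    (fun k U V => ∃ (w a : List (Fin m)), w.length = k ∧ a.length = k ∧ U = US P (cl P w) ∧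
      V = VA r {a} k)
    (by
      rintro k U V ⟨w, a, hw, ha, rfl, rfl⟩
      exact ⟨US_ne H _, VA_nonempty (by omega) (by simpa using ha) (by simp), US_cpt H _,
        VA_compact _ _⟩)
    (by
      rintro k U V ⟨w, a, hw, ha, rfl, rfl⟩ u hu v hv
      rw [← hw]
      exact (US_diam H _ u hu v hv).trans
        (mul_le_mul_of_nonneg_right (le_max_left _ _) (pow_pos h0 _).le))
    (by
      rintro k U V ⟨w, a, hw, ha, rfl, rfl⟩ u hu v hv
      have := VA_diam (p := 0) (by simp) hu hv
      refine this.trans (mul_le_mul_of_nonneg_right ?_ (pow_pos h0 _).le)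
      simp)
    (by
      rintro k U V ⟨w, a, hw, ha, rfl, rfl⟩
      obtain ⟨Gd, Bd, hdis, hGne, hGc, hBc, hGood, hBad, hU, hsep⟩ :=
        decomp H w0 c hc0 (by omega) w
      rw [hw] at hGood hBad hsep
      simp only [← hκdef] at hGood hBad hsep
      obtain ⟨Λ, ι, hΛ, hι, hΛB, hΛG⟩ := split_words (m := m) Gd Bd (c * κ) i hdis hGne
        (hGc.trans him) (by
          rw [mul_comm c κ, pow_mul]
          exact lt_of_le_of_lt hBc hc)
      have hal : ∀ y ∈ ({a} : Finset (List (Fin m))), y.length = k := by simpa using ha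
      have hmem : ∀ y, y ∈ wext {a} e ↔ y.length = k + e ∧ y.take k = a := by
        intro y; rw [mem_wext hal, Finset.mem_singleton]
      refine ⟨(Gd ∪ Bd : Finset _), fun I => US P I.1,
        fun I => VA r ((wext {a} e).filter (fun y => Λ (y.drop k) = I.1)) (k + e), hU, ?_, ?_, ?_, ?_⟩
      · rw [← VA_wext e hal]
        ext u
        rw [Set.mem_iUnion]
        constructor
        · intro hu
          have hu' : pre (k + e) u ∈ wext {a} e := hu
          exact ⟨⟨_, Finset.mem_union.2 (hΛ _)⟩, Finset.mem_filter.2 ⟨hu', rfl⟩⟩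
        · rintro ⟨W, hW⟩
          exact (Finset.mem_filter.1 hW).1
      · rintro ⟨I, hI⟩ ⟨I', hI'⟩ hne u hu v hv
        have := hsep I hI I' hI' (fun hh => hne (Subtype.ext hh)) u hu v hv
        refine le_trans ?_ this
        rw [mul_assoc, ← pow_add]
        refine mul_le_mul (min_le_left _ _) ?_ (pow_pos h0 _).le ha0.le
        exact pow_le_pow_of_le_one h0.le h1.le (by omega)
      · rintro ⟨I, hI⟩ ⟨I', hI'⟩ hne u hu v hv
        have : r ^ (k + e) ≤ dist u v := by
          refine VA_sep ?_ hu hv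
          rw [Finset.disjoint_left]
          intro y h1 h2
          simp only [Finset.mem_filter] at h1 h2
          exact hne (Subtype.ext (h1.2.symm.trans h2.2))
        refine le_trans ?_ this
        rw [mul_assoc, ← pow_add, add_comm e k]
        exact (mul_le_mul_of_nonneg_right (min_le_right _ _) (pow_pos h0 _).le).trans (one_mul _).le
      · rintro ⟨I, hI⟩
        by_cases hIB : I ∈ Bd
        · left
          obtain ⟨y, hIy, hyl⟩ := hBad I hIB
          refine ⟨k + c * κ, by omega, y, a ++ ι I, hyl, by simp [ha, hι I hIB], congrArg (US P) hIy, ?_⟩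
          have hl2 : ∀ z ∈ ({a ++ ι I} : Finset (List (Fin m))), z.length = k + c * κ := by
            simp [ha, hι I hIB]
          show VA r ((wext {a} e).filter (fun y => Λ (y.drop k) = I)) (k + e) = _
          rw [← VA_wext i hl2]
          have e1 : k + e = k + c * κ + i := by omega
          rw [e1]
          congr 1
          ext z
          rw [Finset.mem_filter, hmem, mem_wext hl2, Finset.mem_singleton]
          rw [hΛB I hIB, e1, and_assoc, List.take_add, ← ha]
          refine and_congr_right fun hzl => ?_
          constructor
          · rintro ⟨h2, h3⟩
            rw [h2, h3]
          · intro h2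
            exact List.append_inj h2 (by rw [List.length_take]; omega)
        · right
          have hIG : I ∈ Gd := by
            rcases Finset.mem_union.1 hI with h | h
            · exact h
            · exact absurd h hIB
          obtain ⟨x, rfl, hx1, hx2⟩ := hGood I hIG
          have hxl : ∀ z ∈ ({x} : Finset (List (Fin m))), z.length = x.length := by simp
          obtain ⟨A, hAs, hAc⟩ := Finset.exists_subset_card_eq (s := wext {x} κ)
            (n := (cl P w0).card / d) (by
              rw [card_wext hxl, Finset.card_singleton, one_mul, ← card_Wd]
              refine (Nat.div_le_self _ _).trans (Finset.card_le_card ?_)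
              exact Finset.filter_subset _ _)
          have hA : ∀ z ∈ A, z.length = x.length + κ ∧ z.take x.length = x := by
            intro z hz
            have := hAs hz
            rw [mem_wext hxl, Finset.mem_singleton] at this
            exact this
          have hAm : d * A.card = (cl P w0).card := by
            rw [hAc]; exact Nat.mul_div_cancel' hdvd
          have hAne : A.Nonempty := by
            rw [← Finset.card_pos]
            have := hpos w0
            rw [← hAm] at this
            exact Nat.pos_of_mul_pos_left this
          have r1 := R x A (fun z hz => (hA z hz).1)
            (fun z hz z' hz' => by rw [(hA z hz).2, (hA z' hz').2]) hAm
          set f := k + e - (x.length + κ) with hf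
          rw [← VA_wext f (fun z hz => (hA z hz).1)] at r1
          have hL : x.length + κ + f = k + e := by omega
          rw [hL] at r1
          have hAf : ∀ z ∈ wext A f, z.length = k + e ∧ z.take k = x.take k := by
            intro z hz
            rw [mem_wext (fun z hz => (hA z hz).1)] at hz
            refine ⟨by omega, ?_⟩
            have h2 := (hA _ hz.2).2
            rw [List.take_take, min_eq_left (by omega)] at h2
            rw [← h2, List.take_take, min_eq_left (by omega)]
          have hwne : (wext A f).Nonempty := by
            rw [← Finset.card_pos, card_wext (fun z hz => (hA z hz).1)]
            have := hAne.card_pos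
            positivity
          let e0 : List (Fin m) := List.replicate (k + e) ⟨0, by omega⟩
          have r2 := MO (k + e) (wext A f) e0 (fun z hz => (hAf z hz).1) hwne
            (fun z hz z' hz' => by
              rw [Nat.add_sub_cancel, (hAf z hz).2, (hAf z' hz').2]) (by simp [e0])
          have r3 := MO (k + e) ((wext {a} e).filter (fun y => Λ (y.drop k) = cl P (x ++ w0))) e0
            (fun z hz => by
              rw [Finset.mem_filter, hmem] at hz; exact hz.1.1)
            (by
              obtain ⟨u, hu, hu2⟩ := hΛG _ hIG
              refine ⟨a ++ u, ?_⟩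
              rw [Finset.mem_filter, hmem, List.drop_left' ha, List.take_left' ha]
              exact ⟨⟨by simp [ha, hu]; omega, rfl⟩, hu2⟩)
            (fun z hz z' hz' => by
              rw [Finset.mem_filter, hmem] at hz hz'
              rw [Nat.add_sub_cancel, hz.1.2, hz'.1.2]) (by simp [e0])
          exact (r1.trans hC1.le hC2.le r2).trans (by positivity) hC2.le r3.symm)
  refine ⟨C, hC, ?_⟩
  have := B 0 _ _ ⟨[], [], rfl, rfl, rfl, rfl⟩
  have e1 : US P (cl P []) = P [] := by
    have : cl P [] = {[]} := by
      ext v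
      rw [Finset.mem_singleton]
      constructor
      · intro hv
        exact List.length_eq_zero_iff.1 (cl_length v hv)
      · rintro rfl; exact self_mem_cl
    rw [this]
    simp [US]
  have e2 : VA r {([] : List (Fin m))} 0 = Set.univ := by
    ext u
    simp only [Set.mem_univ, iff_true]
    show pre 0 u ∈ ({[]} : Finset (List (Fin m)))
    exact Finset.mem_singleton.2 rfl
  rwa [e1, e2] at this

/-! ### Part 7 : from the self-similar set to a system -/
theorem unif_pos {ι : Type*} {Φ : Set ι} (hΦ : Φ.Finite) (Q : ι → ℝ → Prop)
    (hQ : ∀ i a a', a' ≤ a → Q i a → Q i a') (h : ∀ i ∈ Φ, ∃ a, 0 < a ∧ Q i a) :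
    ∃ a, 0 < a ∧ ∀ i ∈ Φ, Q i a := by
  induction Φ, hΦ using Set.Finite.induction_on with
  | empty => exact ⟨1, one_pos, by simp⟩
  | insert _ _ ih =>
    obtain ⟨a, ha, h1⟩ := ih fun i hi => h i (Set.mem_insert_of_mem _ hi)
    obtain ⟨a', ha', h2⟩ := h _ (Set.mem_insert _ _)
    refine ⟨min a a', lt_min ha ha', ?_⟩
    rintro i (rfl | hi)
    · exact hQ _ _ _ (min_le_right _ _) h2
    · exact hQ _ _ _ (min_le_left _ _) (h1 i hi)

theorem sep_compact {X : Type*} [MetricSpace X] {A B : Set X} (hA : IsCompact A)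
    (hB : IsCompact B) (h : Disjoint A B) : ∃ a, 0 < a ∧ ∀ x ∈ A, ∀ y ∈ B, a ≤ dist x y := by
  obtain ⟨δ, hδ, h1⟩ := h.exists_thickenings hA hB.isClosed
  refine ⟨δ, hδ, fun x hx y hy => ?_⟩
  by_contra hlt
  push Not at hlt
  have h2 : y ∈ Metric.thickening δ A := Metric.mem_thickening_iff.2 ⟨x, hx, by rwa [dist_comm]⟩
  exact Set.disjoint_left.1 h1 h2 (Metric.self_subset_thickening hδ _ hy)

theorem clopen_nbhd {X : Type*} [MetricSpace X] {E Z : Set X} (hE : IsCompact E)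
    (hZ : IsCompact Z) (hEZ : E ⊆ Z) (htd : IsTotallyDisconnected Z) :
    ∃ U ⊆ Z, E ⊆ U ∧ (∀ x ∈ U, ∃ e ∈ E, dist x e < 1) ∧
      ∃ δ, 0 < δ ∧ ∀ x ∈ U, ∀ y ∈ Z, y ∉ U → δ ≤ dist x y := by
  have : CompactSpace Z := isCompact_iff_compactSpace.1 hZ
  have : TotallyDisconnectedSpace Z := totallyDisconnectedSpace_subtype_iff.2 htd
  set O : Set Z := Subtype.val ⁻¹' (Metric.thickening 1 E) with hO
  have hOo : IsOpen O := Metric.isOpen_thickening.preimage continuous_subtype_val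
  have hc : IsCompact (Subtype.val ⁻¹' E : Set Z) :=
    (hE.isClosed.preimage continuous_subtype_val).isCompact
  have key : ∃ V : Set Z, IsClopen V ∧ Subtype.val ⁻¹' E ⊆ V ∧ V ⊆ O := by
    refine hc.induction_on (p := fun s => ∃ V : Set Z, IsClopen V ∧ s ⊆ V ∧ V ⊆ O) ?_ ?_ ?_ ?_
    · exact ⟨∅, isClopen_empty, le_rfl, Set.empty_subset _⟩
    · rintro s t hst ⟨V, h1, h2, h3⟩
      exact ⟨V, h1, hst.trans h2, h3⟩
    · rintro s t ⟨V, h1, h2, h3⟩ ⟨V', h1', h2', h3'⟩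
      exact ⟨V ∪ V', h1.union h1', Set.union_subset_union h2 h2', Set.union_subset h3 h3'⟩
    · intro x hx
      obtain ⟨V, h1, h2, h3⟩ := compact_exists_isClopen_in_isOpen hOo
        (show x ∈ O from Metric.self_subset_thickening one_pos _ hx)
      exact ⟨V, mem_nhdsWithin_of_mem_nhds (h1.isOpen.mem_nhds h2), V, h1, le_rfl, h3⟩
  obtain ⟨V, h1, h2, h3⟩ := key
  refine ⟨Subtype.val '' V, by rintro _ ⟨x, _, rfl⟩; exact x.2, ?_, ?_, ?_⟩
  · intro x hx
    exact ⟨⟨x, hEZ hx⟩, h2 hx, rfl⟩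
  · rintro _ ⟨x, hx, rfl⟩
    exact Metric.mem_thickening_iff.1 (h3 hx)
  · obtain ⟨a, ha, h⟩ := sep_compact (h1.isClosed.isCompact)
      (h1.compl.isClosed.isCompact) disjoint_compl_right
    refine ⟨a, ha, ?_⟩
    rintro _ ⟨x, hx, rfl⟩ y hy hyn
    exact h x hx ⟨y, hy⟩ fun hyV => hyn ⟨_, hyV, rfl⟩

theorem sys_of {X : Type*} [MetricSpace X] {m : ℕ} (T : List (Fin m) → X → X) (E : Set X) {r : ℝ}
    (hr : 0 < r) (hr1 : r < 1) (hEne : E.Nonempty) (hEc : IsCompact E)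
    (htd : IsTotallyDisconnected E) (T0 : T [] = id) (Tapp : ∀ w u, T (w ++ u) = T w ∘ T u)
    (Tdist : ∀ w x y, dist (T w x) (T w y) = r ^ w.length * dist x y)
    (hEeq : E = ⋃ i, T [i] '' E)
    (Tinj : ∀ w w', w.length = w'.length → T w = T w' → w = w')
    (Φ : Set (X → X)) (hΦ : Φ.Finite) (hΦi : ∀ φ ∈ Φ, Isometry φ)
    (hT : ∀ w w' : List (Fin m), w.length = w'.length → (∃ φ ∈ Φ, T w' = T w ∘ φ) ∨
      ∀ x ∈ E, ∀ y ∈ E, r ^ w.length ≤ dist (T w x) (T w' y)) :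
    ∃ N K0 a0, 0 < a0 ∧ Sys (fun w => T w '' E) r N K0 a0 := by
  have Tinjective : ∀ w, Function.Injective (T w) := by
    intro w x y hxy
    have := Tdist w x y
    rw [hxy, dist_self] at this
    rcases mul_eq_zero.1 this.symm with h | h
    · exact absurd h (pow_pos hr _).ne'
    · exact dist_eq_zero.1 h
  have Tcont : ∀ w, Continuous (T w) := by
    intro w
    refine (LipschitzWith.of_dist_le_mul (K := ⟨r ^ w.length, (pow_pos hr _).le⟩) ?_).continuous
    intro x y
    exact (Tdist w x y).le
  have Esplit : ∀ c, E = ⋃ u ∈ Wd m c, T u '' E := by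
    intro c
    induction c with
    | zero =>
      ext x
      simp only [Set.mem_iUnion, mem_Wd, List.length_eq_zero_iff, exists_prop, exists_eq_left, T0,
        Set.image_id]
    | succ c ih =>
      ext x
      simp only [Set.mem_iUnion, mem_Wd, exists_prop]
      constructor
      · intro hx
        rw [hEeq] at hx
        obtain ⟨i, y, hy, rfl⟩ := Set.mem_iUnion.1 hx
        rw [ih] at hy
        simp only [Set.mem_iUnion, mem_Wd, exists_prop] at hy
        obtain ⟨u, hu, z, hz, rfl⟩ := hy
        refine ⟨[i] ++ u, by simp [hu], z, hz, ?_⟩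
        rw [Tapp]; rfl
      · rintro ⟨u, hu, z, hz, rfl⟩
        match u, hu with
        | i :: u, hu =>
          have hu' : u.length = c := by simpa using hu
          have : T u z ∈ E := by
            rw [ih]
            simp only [Set.mem_iUnion, mem_Wd, exists_prop]
            exact ⟨u, hu', z, hz, rfl⟩
          rw [hEeq]
          refine Set.mem_iUnion.2 ⟨i, T u z, this, ?_⟩
          have := Tapp [i] u
          exact (congrFun this z).symm
  have TE : ∀ w, ∀ x ∈ E, T w x ∈ E := by
    intro w x hx
    rw [Esplit w.length]
    simp only [Set.mem_iUnion, mem_Wd, exists_prop]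
    exact ⟨w, rfl, x, hx, rfl⟩
  -- diameter
  obtain ⟨D, hD⟩ : ∃ D, ∀ x ∈ E, ∀ y ∈ E, dist x y ≤ D := by
    obtain ⟨D, hD⟩ := Metric.isBounded_iff.1 hEc.isBounded
    exact ⟨D, fun x hx y hy => hD hx hy⟩
  have hD0 : 0 ≤ D := by
    obtain ⟨e, he⟩ := hEne
    simpa using hD e he e he
  -- separation
  obtain ⟨a1, ha1, hsep⟩ := unif_pos hΦ
    (fun φ a => Disjoint E (φ '' E) → ∀ x ∈ E, ∀ y ∈ E, a ≤ dist x (φ y))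
    (fun φ a a' h h1 hd x hx y hy => h.trans (h1 hd x hx y hy))
    (by
      intro φ hφ
      by_cases hd : Disjoint E (φ '' E)
      · obtain ⟨a, ha, h⟩ := sep_compact hEc (hEc.image (hΦi φ hφ).continuous) hd
        exact ⟨a, ha, fun _ x hx y hy => h x hx _ ⟨y, hy, rfl⟩⟩
      · exact ⟨1, one_pos, fun h => absurd h hd⟩)
  -- clusters
  set Z : Set (X → X) → Set X := fun F => E ∪ ⋃ φ ∈ F, φ '' E with hZ
  obtain ⟨δ, hδ, hcl⟩ := unif_pos hΦ.finite_subsets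
    (fun F δ => IsTotallyDisconnected (Z F) → ∃ U ⊆ Z F, E ⊆ U ∧ (∀ x ∈ U, ∃ e ∈ E, dist x e < 1) ∧
      ∀ x ∈ U, ∀ y ∈ Z F, y ∉ U → δ ≤ dist x y)
    (by
      intro F a a' h h1 ht
      obtain ⟨U, h2, h3, h4, h5⟩ := h1 ht
      exact ⟨U, h2, h3, h4, fun x hx y hy hn => h.trans (h5 x hx y hy hn)⟩)
    (by
      intro F hF
      by_cases ht : IsTotallyDisconnected (Z F)
      · have hZc : IsCompact (Z F) := by
          refine hEc.union ((hΦ.subset hF).isCompact_biUnion fun φ hφ => ?_)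
          exact hEc.image (hΦi φ (hF hφ)).continuous
        obtain ⟨U, h2, h3, h4, δ, hδ, h5⟩ := clopen_nbhd hEc hZc Set.subset_union_left ht
        exact ⟨δ, hδ, fun _ => ⟨U, h2, h3, h4, h5⟩⟩
      · exact ⟨1, one_pos, fun h => absurd h ht⟩)
  obtain ⟨j, hj⟩ : ∃ j : ℕ, r ^ j * D < δ := by
    obtain ⟨j, hj⟩ := exists_pow_lt_of_lt_one (show 0 < δ / (D + 1) by positivity) hr1
    refine ⟨j, ?_⟩
    rw [lt_div_iff₀ (by positivity)] at hj
    have := pow_pos hr j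
    nlinarith
  have close : ∀ w w' : List (Fin m), w.length = w'.length → ∀ x ∈ E, ∀ y ∈ E,
      dist (T w x) (T w' y) < r ^ w.length → ∃ φ ∈ Φ, T w' = T w ∘ φ := by
    intro w w' hl x hx y hy hlt
    rcases hT w w' hl with h | h
    · exact h
    · exact absurd (h x hx y hy) (not_le.2 hlt)
  have main : ∀ v : List (Fin m), j ≤ v.length → ∃ U : Set X,
      (∀ x ∈ U, ∃ e ∈ E, dist x e < 1) ∧
      ∀ v', Conn (fun w => T w '' E) v v' → T v' '' E ⊆ T (v.take (v.length - j)) '' U := by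
    intro v hv
    set k := v.length - j with hk
    set w := v.take k with hw
    have hwl : w.length = k := by rw [hw, List.length_take]; omega
    set F : Set (X → X) := {φ ∈ Φ | ∃ w', T w' = T w ∘ φ} with hF
    have hZE : T w '' Z F ⊆ E := by
      rintro _ ⟨x, hx | hx, rfl⟩
      · exact TE w x hx
      · simp only [Set.mem_iUnion] at hx
        obtain ⟨φ, ⟨_, w', hw'⟩, y, hy, rfl⟩ := hx
        have := congrFun hw' y
        simp only [Function.comp] at this
        rw [← this]
        exact TE w' y hy
    have htZ : IsTotallyDisconnected (Z F) :=
      isTotallyDisconnected_of_image (f := T w) (Tcont w).continuousOn (Tinjective w)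
        (fun t ht => htd t (ht.trans hZE))
    obtain ⟨U, hUZ, hEU, hU1, hUs⟩ := hcl F (fun φ hφ => hφ.1) htZ
    refine ⟨U, hU1, ?_⟩
    intro v' hc
    induction hc with
    | refl =>
      rintro _ ⟨x, hx, rfl⟩
      refine ⟨T (v.drop k) x, hEU (TE _ x hx), ?_⟩
      have := Tapp w (v.drop k)
      rw [hw, List.take_append_drop] at this
      rw [this]; rfl
    | tail hc1 hadj ih =>
      rename_i v1 v2
      have hl1 : v1.length = v.length := (Conn.length hc1).symm
      have hl2 : v2.length = v.length := hadj.1.symm.trans hl1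
      obtain ⟨p, hp1, hp2⟩ := hadj.2
      obtain ⟨q, hq, rfl⟩ := ih hp1
      obtain ⟨e, he, hqe⟩ := hU1 q hq
      obtain ⟨y, hy, hyp⟩ := hp2
      set w2 := v2.take k with hw2
      have hw2l : w2.length = k := by rw [hw2, List.length_take]; omega
      have h2 : T v2 = T w2 ∘ T (v2.drop k) := by
        rw [← Tapp, hw2, List.take_append_drop]
      obtain ⟨φ, hφ, hφ'⟩ := close w w2 (hwl.trans hw2l.symm) e he (T (v2.drop k) y) (TE _ _ hy)
        (by
          have : T w2 (T (v2.drop k) y) = T w q := by rw [← hyp, h2]; rfl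
          rw [this, Tdist, dist_comm]
          exact mul_lt_of_lt_one_right (pow_pos hr _) hqe)
      rintro _ ⟨x, hx, rfl⟩
      refine ⟨φ (T (v2.drop k) x), ?_, ?_⟩
      · by_contra hn
        have h3 := hUs q hq _ (Or.inr (Set.mem_biUnion (show φ ∈ F from ⟨hφ, w2, hφ'⟩)
          ⟨_, TE _ _ hx, rfl⟩)) hn
        have h4 : T v2 x = T w (φ (T (v2.drop k) x)) := by rw [h2, hφ']; rfl
        have h5 : dist (T w q) (T v2 x) = r ^ v2.length * dist y x := by rw [← hyp, Tdist]
        rw [h4, Tdist, hwl, show v2.length = k + j by omega, pow_add, mul_assoc] at h5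
        have h6 := mul_left_cancel₀ (pow_pos hr k).ne' h5
        have h7 : r ^ j * dist y x ≤ r ^ j * D :=
          mul_le_mul_of_nonneg_left (hD y hy x hx) (pow_pos hr j).le
        linarith
      · rw [h2, hφ']; rfl
  refine ⟨hΦ.toFinset.card * m ^ j + (m + 1) ^ j, (D + 2) * (r ^ j)⁻¹, min a1 1,
    lt_min ha1 one_pos, ?_⟩
  refine ⟨fun w => hEne.image _, fun w => hEc.image (Tcont w), ?_, ?_, ?_, ?_, ?_⟩
  · intro w c
    show T w '' E = ⋃ u ∈ Wd m c, T (w ++ u) '' E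
    conv_lhs => rw [Esplit c]
    rw [Set.image_iUnion₂]
    refine Set.iUnion₂_congr fun u _ => ?_
    rw [Tapp, Set.image_comp]
  · intro w u v
    show (T (w ++ u) '' E ∩ T (w ++ v) '' E).Nonempty ↔ (T u '' E ∩ T v '' E).Nonempty
    rw [Tapp, Tapp, Set.image_comp, Set.image_comp, ← Set.image_inter (Tinjective w),
      Set.image_nonempty]
  · intro v
    by_cases hv : j ≤ v.length
    · obtain ⟨U, hU1, hU⟩ := main v hv
      set k := v.length - j with hk
      set w := v.take k with hw
      have hwl : w.length = k := by rw [hw, List.length_take]; omega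
      have h1 : ∀ v' ∈ cl (fun w => T w '' E) v, ∃ φ ∈ Φ, T (v'.take k) = T w ∘ φ := by
        intro v' hv'
        have hl := cl_length v' hv'
        obtain ⟨y, hy⟩ := hEne
        obtain ⟨q, hq, hqy⟩ := hU v' (mem_cl.1 hv') ⟨y, hy, rfl⟩
        obtain ⟨e, he, hqe⟩ := hU1 q hq
        have h2 : T v' = T (v'.take k) ∘ T (v'.drop k) := by
          rw [← Tapp, List.take_append_drop]
        refine close w (v'.take k) (by rw [hwl, List.length_take]; omega) e he (T (v'.drop k) y)
          (TE _ _ hy) ?_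
        have : T (v'.take k) (T (v'.drop k) y) = T w q := by rw [hqy, h2]; rfl
        rw [this, Tdist, dist_comm]
        exact mul_lt_of_lt_one_right (pow_pos hr _) hqe
      have : Nonempty (X → X) := ⟨id⟩
      choose! φ hφ hφ' using h1
      have : (cl (fun w => T w '' E) v).card ≤ (hΦ.toFinset ×ˢ Wd m j).card := by
        refine Finset.card_le_card_of_injOn (fun v' => (φ v', v'.drop k)) ?_ ?_
        · intro v' hv'
          have hl := cl_length v' hv'
          simp only [Finset.coe_product, Set.mem_prod, Finset.mem_coe, Set.Finite.mem_toFinset,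
            mem_Wd, List.length_drop]
          exact ⟨hφ v' hv', by omega⟩
        · intro v1 h1 v2 h2 h12
          have hl1 := cl_length v1 h1
          have hl2 := cl_length v2 h2
          simp only [Prod.mk.injEq] at h12
          have := Tinj (v1.take k) (v2.take k) (by rw [List.length_take, List.length_take]; omega)
            (by rw [hφ' v1 h1, hφ' v2 h2, h12.1])
          rw [← List.take_append_drop k v1, ← List.take_append_drop k v2, this, h12.2]
      rw [Finset.card_product, card_Wd] at this
      omega
    · have : (cl (fun w => T w '' E) v).card ≤ m ^ v.length := by
        rw [← card_Wd]
        exact Finset.card_le_card (Finset.filter_subset _ _)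
      have h2 : m ^ v.length ≤ (m + 1) ^ v.length := Nat.pow_le_pow_left (by omega) _
      have h3 : (m + 1) ^ v.length ≤ (m + 1) ^ j := Nat.pow_le_pow_right (by omega) (by omega)
      omega
  · intro v u hu u' hu' x hx y hy
    by_cases hv : j ≤ v.length
    · obtain ⟨U, hU1, hU⟩ := main v hv
      set k := v.length - j with hk
      set w := v.take k with hw
      have hwl : w.length = k := by rw [hw, List.length_take]; omega
      obtain ⟨q, hq, rfl⟩ := hU u (mem_cl.1 hu) hx
      obtain ⟨q', hq', rfl⟩ := hU u' (mem_cl.1 hu') hy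
      obtain ⟨e, he, hqe⟩ := hU1 q hq
      obtain ⟨e', he', hqe'⟩ := hU1 q' hq'
      have : dist q q' ≤ D + 2 := by
        have h1 := dist_triangle4 q e e' q'
        have h2 := hD e he e' he'
        rw [dist_comm e' q'] at h1
        linarith
      rw [Tdist, hwl, show v.length = j + k by omega, pow_add, ← mul_assoc, mul_assoc (D + 2),
        inv_mul_cancel₀ (pow_pos hr j).ne', mul_one, mul_comm]
      exact mul_le_mul_of_nonneg_right this (pow_pos hr k).le
    · obtain ⟨x, hx, rfl⟩ := hx
      obtain ⟨y, hy, rfl⟩ := hy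
      have h1 := hD _ (TE u x hx) _ (TE u' y hy)
      have h2 : r ^ j ≤ r ^ v.length := pow_le_pow_of_le_one hr.le hr1.le (by omega)
      have h3 : 1 ≤ (r ^ j)⁻¹ * r ^ v.length := by
        rw [← inv_mul_cancel₀ (pow_pos hr j).ne']
        exact mul_le_mul_of_nonneg_left h2 (inv_pos.2 (pow_pos hr j)).le
      rw [mul_assoc]
      nlinarith
  · intro u v hl hne x hx y hy
    obtain ⟨x, hx, rfl⟩ := hx
    obtain ⟨y, hy, rfl⟩ := hy
    have hp := pow_pos hr u.length
    rcases hT u v hl with ⟨φ, hφ, h⟩ | h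
    · have hd : Disjoint E (φ '' E) := by
        rw [Set.disjoint_left]
        rintro z hz ⟨z', hz', rfl⟩
        refine hne ⟨T u (φ z'), ⟨_, hz, rfl⟩, z', hz', ?_⟩
        rw [h]; rfl
      have h1 := hsep φ hφ hd x hx y hy
      have h2 : T v y = T u (φ y) := by rw [h]; rfl
      rw [h2, Tdist, mul_comm]
      exact mul_le_mul_of_nonneg_left ((min_le_left _ _).trans h1) hp.le
    · have h1 := h x hx y hy
      have h2 : min a1 1 ≤ 1 := min_le_right _ _
      nlinarith

/-! ### Part 8 : conclusion -/
theorem bilip_of_arel {X : Type*} [MetricSpace X] {E : Set X} {m : ℕ} {r C : ℝ}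
    [h : Fact (0 < r ∧ r < 1)] (hC : 0 < C) (hA : ARel C 0 E (Set.univ : Set (Sy m r))) :
    BilipWithSymb E m r := by
  obtain ⟨R, h1, h2, h3⟩ := hA
  choose f hf using fun x : E => h1 x.1 x.2
  have hfd : ∀ x y : E, dist x y ≤ C * dist (f x) (f y) ∧ dist (f x) (f y) ≤ C * dist x y := by
    intro x y
    have := h3 x.1 x.2 y.1 y.2 (f x) trivial (f y) trivial (hf x).2 (hf y).2
    rw [add_zero, add_zero] at this
    exact this
  refine ⟨f, ⟨?_, ?_⟩, max 1 C, le_max_left _ _, ?_⟩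
  · intro x y hxy
    have h4 := (hfd x y).1
    have h5 : dist (f x) (f y) = 0 := by
      have : (f x : Sy m r) = f y := hxy
      rw [this, dist_self]
    rw [h5, mul_zero] at h4
    exact dist_le_zero.1 h4
  · intro y
    obtain ⟨x, hx, hxy⟩ := h2 y trivial
    refine ⟨⟨x, hx⟩, ?_⟩
    have h4 := (h3 x hx x hx (f ⟨x, hx⟩) trivial y trivial (hf ⟨x, hx⟩).2 hxy).2
    rw [dist_self, mul_zero, zero_add] at h4
    have h5 : (f ⟨x, hx⟩ : Sy m r) = y := dist_le_zero.1 h4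
    exact h5
  · intro x y
    obtain ⟨h4, h5⟩ := hfd x y
    have hm : 0 < max 1 C := lt_max_of_lt_left one_pos
    constructor
    · rw [inv_mul_le_iff₀ hm]
      exact h4.trans (mul_le_mul_of_nonneg_right (le_max_right _ _) dist_nonneg)
    · exact h5.trans (mul_le_mul_of_nonneg_right (le_max_right _ _) dist_nonneg)

theorem wordMap_append {X : Type*} {m : ℕ} (S : Fin m → X → X) (w u : List (Fin m)) :
    wordMap S (w ++ u) = wordMap S w ∘ wordMap S u := by
  induction w with
  | nil => rfl
  | cons i w ih =>
    show S i ∘ wordMap S (w ++ u) = (S i ∘ wordMap S w) ∘ wordMap S u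
    rw [ih]; rfl

theorem wordMap_form {l : ℕ}
    (Γ : AddSubgroup (EuclideanSpace ℝ (Fin l)))
    (𝔾 : Subgroup (EuclideanSpace ℝ (Fin l) ≃ₗᵢ[ℝ] EuclideanSpace ℝ (Fin l)))
    (h𝔾Γ : ∀ g ∈ 𝔾, ∀ x ∈ Γ, g x ∈ Γ)
    (n : ℕ) (hn : 2 ≤ n) (m : ℕ)
    (g : Fin m → (EuclideanSpace ℝ (Fin l) ≃ₗᵢ[ℝ] EuclideanSpace ℝ (Fin l)))
    (b : Fin m → EuclideanSpace ℝ (Fin l))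
    (hg : ∀ i, g i ∈ 𝔾) (hb : ∀ i, b i ∈ Γ)
    (S : Fin m → EuclideanSpace ℝ (Fin l) → EuclideanSpace ℝ (Fin l))
    (hS : ∀ i x, S i x = (n : ℝ)⁻¹ • (g i x) + b i) (w : List (Fin m)) :
    ∃ G ∈ 𝔾, ∃ c : EuclideanSpace ℝ (Fin l), (n : ℝ) ^ w.length • c ∈ Γ ∧
      ∀ x, wordMap S w x = ((n : ℝ)⁻¹) ^ w.length • G x + c := by
  have hn0 : (n : ℝ) ≠ 0 := by positivity
  induction w with
  | nil => exact ⟨1, 𝔾.one_mem, 0, by simp, fun x => by simp [wordMap]⟩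
  | cons i w ih =>
    obtain ⟨G, hG, c, hc, h⟩ := ih
    refine ⟨g i * G, 𝔾.mul_mem (hg i) hG, (n : ℝ)⁻¹ • g i c + b i, ?_, ?_⟩
    · have h1 := h𝔾Γ _ (hg i) _ hc
      rw [map_smul] at h1
      have h2 : (n : ℝ) ^ (i :: w).length • b i ∈ Γ := by
        have := Γ.nsmul_mem (hb i) (n ^ (i :: w).length)
        rw [← Nat.cast_smul_eq_nsmul ℝ] at this
        push_cast at this
        exact this
      rw [smul_add]
      refine Γ.add_mem ?_ h2
      rw [List.length_cons, pow_succ, smul_smul, mul_assoc, mul_inv_cancel₀ hn0, mul_one]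
      exact h1
    · intro x
      show S i (wordMap S w x) = _
      rw [h, hS, map_add, map_smul, smul_add, smul_smul, List.length_cons, pow_succ', add_assoc]
      rfl


/-- **Theorem 3.** Let `Γ` be a discrete additive subgroup of `ℝ^l`, `𝔾` a finite
group of linear isometries of `ℝ^l` preserving `Γ`, and `n ≥ 2` an integer.
Suppose `E = ⋃_{i=1}^m (gᵢ E / n + bᵢ) ∈ Λ` (with `gᵢ ∈ 𝔾`, `bᵢ ∈ Γ`) is a
totally disconnected self-similar set without complete overlaps. Then `E` is
bilipschitz equivalent to the symbolic space `Σ_m^{1/n}`. -/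
theorem selfSimilar_lambda_bilip_symb {l : ℕ}
    (Γ : AddSubgroup (EuclideanSpace ℝ (Fin l))) (hΓ : DiscreteTopology Γ)
    (𝔾 : Subgroup (EuclideanSpace ℝ (Fin l) ≃ₗᵢ[ℝ] EuclideanSpace ℝ (Fin l)))
    (h𝔾fin : Finite 𝔾) (h𝔾Γ : ∀ g ∈ 𝔾, ∀ x ∈ Γ, g x ∈ Γ)
    (n : ℕ) (hn : 2 ≤ n) (m : ℕ)
    (g : Fin m → (EuclideanSpace ℝ (Fin l) ≃ₗᵢ[ℝ] EuclideanSpace ℝ (Fin l)))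
    (b : Fin m → EuclideanSpace ℝ (Fin l))
    (hg : ∀ i, g i ∈ 𝔾) (hb : ∀ i, b i ∈ Γ)
    (S : Fin m → EuclideanSpace ℝ (Fin l) → EuclideanSpace ℝ (Fin l))
    (hS : ∀ i x, S i x = (n : ℝ)⁻¹ • (g i x) + b i)
    (E : Set (EuclideanSpace ℝ (Fin l)))
    (hEne : E.Nonempty) (hEc : IsCompact E)
    (hEeq : E = ⋃ i, S i '' E)
    (htd : IsTotallyDisconnected E)
    (hover : ¬ HasCompleteOverlaps S) :
    BilipWithSymb E m ((n : ℝ)⁻¹) := by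
  have hn0 : (n : ℝ) ≠ 0 := by positivity
  have hn2 : (2 : ℝ) ≤ n := by exact_mod_cast hn
  have hr : 0 < (n : ℝ)⁻¹ := by positivity
  have hr1 : (n : ℝ)⁻¹ < 1 := inv_lt_one_of_one_lt₀ (by linarith)
  set r : ℝ := (n : ℝ)⁻¹ with hrdef
  have hfact : Fact (0 < r ∧ r < 1) := ⟨hr, hr1⟩
  have form := wordMap_form Γ 𝔾 h𝔾Γ n hn m g b hg hb S hS
  have Tdist : ∀ w x y, dist (wordMap S w x) (wordMap S w y) = r ^ w.length * dist x y := by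
    intro w x y
    obtain ⟨G, hG, c, hc, h⟩ := form w
    rw [h, h, dist_add_right, dist_smul₀, Real.norm_of_nonneg (pow_pos hr _).le, G.dist_map]
  obtain ⟨D0, hD0⟩ : ∃ D0, ∀ x ∈ E, ‖x‖ ≤ D0 := hEc.isBounded.exists_norm_le
  rcases Nat.lt_or_ge m 2 with hm | hm
  · -- at most one map
    have hdist : ∀ k : ℕ, ∀ x ∈ E, ∀ y ∈ E, dist x y ≤ r ^ k * (2 * D0) := by
      intro k
      induction k with
      | zero =>
        intro x hx y hy
        have := dist_le_norm_add_norm x y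
        have h1 := hD0 x hx
        have h2 := hD0 y hy
        simp only [pow_zero, one_mul]
        linarith
      | succ k ih =>
        intro x hx y hy
        rw [hEeq] at hx hy
        obtain ⟨i, x, hx1, rfl⟩ := Set.mem_iUnion.1 hx
        obtain ⟨i', y, hy1, rfl⟩ := Set.mem_iUnion.1 hy
        have hii : i' = i := by apply Fin.ext; omega
        subst hii
        have h1 := Tdist [i'] x y
        simp only [wordMap, Function.comp, id, List.length_singleton, pow_one] at h1
        rw [h1, pow_succ', mul_assoc]
        exact mul_le_mul_of_nonneg_left (ih x hx1 y hy1) hr.le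
    have hsub : ∀ x ∈ E, ∀ y ∈ E, x = y := by
      intro x hx y hy
      have hlim : Filter.Tendsto (fun k : ℕ => r ^ k * (2 * D0)) Filter.atTop (nhds 0) := by
        have := (tendsto_pow_atTop_nhds_zero_of_lt_one hr.le hr1).mul_const (2 * D0)
        rwa [zero_mul] at this
      exact dist_le_zero.1 (ge_of_tendsto' hlim fun k => hdist k x hx y hy)
    obtain ⟨e, he⟩ := hEne
    obtain ⟨i0⟩ : Nonempty (Fin m) := by
      rw [hEeq] at he
      exact ⟨(Set.mem_iUnion.1 he).choose⟩
    refine ⟨fun _ _ => i0, ⟨?_, ?_⟩, 1, le_rfl, ?_⟩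
    · intro x y _
      exact Subtype.ext (hsub x.1 x.2 y.1 y.2)
    · intro y
      refine ⟨⟨e, he⟩, ?_⟩
      funext k
      apply Fin.ext
      have := (y k).2
      have := i0.2
      omega
    · intro x y
      have : x = y := Subtype.ext (hsub x.1 x.2 y.1 y.2)
      rw [this]
      simp [symbDist]
  · -- main case
    have hΓf : ((Metric.closedBall (0 : EuclideanSpace ℝ (Fin l)) (1 + 2 * D0)) ∩
        (Γ : Set (EuclideanSpace ℝ (Fin l)))).Finite := by
      have hd : DiscreteTopology (Γ : Set (EuclideanSpace ℝ (Fin l))) := hΓ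
      refine Metric.finite_isBounded_inter_isClosed DiscreteTopology.isDiscrete
        Metric.isBounded_closedBall ?_
      exact AddSubgroup.isClosed_of_discrete
    set Φ : Set (EuclideanSpace ℝ (Fin l) → EuclideanSpace ℝ (Fin l)) :=
      Set.image2 (fun (h : EuclideanSpace ℝ (Fin l) ≃ₗᵢ[ℝ] EuclideanSpace ℝ (Fin l)) c x => h x + c)
        (𝔾 : Set (EuclideanSpace ℝ (Fin l) ≃ₗᵢ[ℝ] EuclideanSpace ℝ (Fin l)))
        ((Metric.closedBall (0 : EuclideanSpace ℝ (Fin l)) (1 + 2 * D0)) ∩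
        (Γ : Set (EuclideanSpace ℝ (Fin l)))) with hΦdef
    have hΦ : Φ.Finite := Set.Finite.image2 _ (Set.toFinite _) hΓf
    have hΦi : ∀ φ ∈ Φ, Isometry φ := by
      rintro _ ⟨h, _, c, _, rfl⟩
      refine Isometry.of_dist_eq fun x y => ?_
      rw [dist_add_right, h.dist_map]
    obtain ⟨N, K0, a0, ha0, H⟩ := sys_of (wordMap S) E hr hr1 hEne hEc htd rfl (wordMap_append S)
      Tdist hEeq
      (by
        intro w w' hl hw
        by_contra hne
        refine hover ⟨w, w', ?_, ?_, hne, hw⟩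
        · rintro rfl
          exact hne (List.length_eq_zero_iff.1 hl.symm).symm
        · rintro rfl
          exact hne (List.length_eq_zero_iff.1 hl))
      Φ hΦ hΦi
      (by
        intro w w' hl
        obtain ⟨G, hG, c, hc, h⟩ := form w
        obtain ⟨G', hG', c', hc', h'⟩ := form w'
        rw [← hl] at hc' h'
        set k := w.length with hk
        set d := G⁻¹ ((n : ℝ) ^ k • (c' - c)) with hd
        have hdΓ : d ∈ Γ := by
          refine h𝔾Γ _ (𝔾.inv_mem hG) _ ?_
          rw [smul_sub]
          exact Γ.sub_mem hc' hc
        have hw' : wordMap S w' = wordMap S w ∘ fun x => (G⁻¹ * G') x + d := by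
          funext x
          have e1 : G ((G⁻¹ * G') x) = G' x := G.apply_symm_apply _
          have e2 : G d = (n : ℝ) ^ k • (c' - c) := G.apply_symm_apply _
          simp only [Function.comp]
          rw [h, h', map_add, e1, e2, smul_add, smul_smul, ← mul_pow,
            inv_mul_cancel₀ hn0, one_pow, one_smul]
          abel
        by_cases hR : ‖d‖ ≤ 1 + 2 * D0
        · left
          exact ⟨_, ⟨G⁻¹ * G', 𝔾.mul_mem (𝔾.inv_mem hG) hG', d,
            ⟨mem_closedBall_zero_iff.2 hR, hdΓ⟩, rfl⟩, hw'⟩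
        · right
          intro x hx y hy
          rw [hw']
          simp only [Function.comp]
          rw [Tdist]
          refine le_mul_of_one_le_right (pow_pos hr _).le ?_
          have h1 := hD0 x hx
          have h2 := hD0 y hy
          have h3 : ‖(G⁻¹ * G') y‖ = ‖y‖ := LinearIsometryEquiv.norm_map _ _
          have h4 : ‖d‖ ≤ ‖x‖ + ‖(G⁻¹ * G') y‖ + dist x ((G⁻¹ * G') y + d) := by
            rw [dist_eq_norm]
            have e : d = x - (G⁻¹ * G') y - (x - ((G⁻¹ * G') y + d)) := by abel
            calc ‖d‖ = ‖x - (G⁻¹ * G') y - (x - ((G⁻¹ * G') y + d))‖ := by rw [← e]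
              _ ≤ ‖x - (G⁻¹ * G') y‖ + ‖x - ((G⁻¹ * G') y + d)‖ := norm_sub_le _ _
              _ ≤ _ := by gcongr; exact norm_sub_le _ _
          push Not at hR
          linarith)
    obtain ⟨C, hC, hA⟩ := irr hm H ha0
    have e0 : wordMap S [] '' E = E := Set.image_id E
    simp only [e0] at hA
    exact bilip_of_arel hC hA
end

section
/- Suppose E = ⋃_{i=1}^m (g_i E/n + b_i) ∈ Λ is the self-similar set generated by the similitudes S_i(x) = g_i(x)/n + b_i (g_i ∈ 𝔾, b_i ∈ Γ, i = 1,…,m), and suppose E is totally disconnected and has no complete overlaps. Then E ∈ 𝔄_m^{1/n}; that is, there exist dust-like graph-directed sets K_1, …, K_p with ratio 1/n and integer characteristic m such that E = K_1. -/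
open scoped Classical

theorem aux_memGD_of {X : Type*} [MetricSpace X] {V : Type*} [Finite V] (K : V → Set X)
    (wt : V → ℝ) (r : ℝ) (m : ℕ) (hwt : ∀ v, 0 < wt v) (hne : ∀ v, (K v).Nonempty)
    (hc : ∀ v, IsCompact (K v))
    (H : ∀ v, ∃ (ι : Type) (_ : Fintype ι) (tgt : ι → V) (f : ι → X → X),
      (∀ e x y, dist (f e x) (f e y) = r * dist x y) ∧
      (K v = ⋃ e, f e '' K (tgt e)) ∧
      (∀ e e', e ≠ e' → Disjoint (f e '' K (tgt e)) (f e' '' K (tgt e'))) ∧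
      ∑ e, wt (tgt e) = m * wt v) (v0 : V) : MemGDClass (K v0) r m := by
  choose ι hι tgt f hf hU hD hw using H
  have hpos : 0 < Nat.card V := Nat.card_pos_iff.2 ⟨⟨v0⟩, inferInstance⟩
  obtain ⟨φ, hφ⟩ : ∃ φ : V ≃ Fin (Nat.card V), φ v0 = ⟨0, hpos⟩ := by
    refine ⟨(Finite.equivFin V).trans (Equiv.swap (Finite.equivFin V v0) ⟨0, hpos⟩), ?_⟩
    simp
  let T : Fin (Nat.card V) → Fin (Nat.card V) → Type :=
    fun i j => {e : ι (φ.symm i) // tgt _ e = φ.symm j}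
  let ψ : ∀ i j, T i j ≃ Fin (Fintype.card (T i j)) := fun i j => Fintype.equivFin (T i j)
  let G : GraphDirected X (Nat.card V) r :=
    { a := fun i j => Fintype.card (T i j)
      S := fun i j e => f (φ.symm i) ((ψ i j).symm e).1
      sim := fun i j e x y => hf _ _ _ _
      K := fun i => K (φ.symm i)
      nonempty := fun i => hne _
      compact := fun i => hc _
      union := by
        intro i
        refine (hU (φ.symm i)).trans ?_
        ext x
        simp only [Set.mem_iUnion]
        constructor
        · rintro ⟨e, he⟩
          refine ⟨φ (tgt _ e), ψ i (φ (tgt _ e)) ⟨e, by simp⟩, ?_⟩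
          simpa using he
        · rintro ⟨j, e, he⟩
          refine ⟨((ψ i j).symm e).1, ?_⟩
          rw [((ψ i j).symm e).2]
          exact he
      disj := by
        intro i j j' e e' hne'
        have h1 := ((ψ i j).symm e).2
        have h2 := ((ψ i j').symm e').2
        have hne2 : ((ψ i j).symm e).1 ≠ ((ψ i j').symm e').1 := by
          intro heq
          apply hne'
          have hj : j = j' := by
            rw [heq] at h1
            exact φ.symm.injective (h1.symm.trans h2)
          subst hj
          have : e = e' := (ψ i j).symm.injective (Subtype.ext heq)
          rw [this]
        have key := hD _ _ _ hne2
        rw [h1, h2] at key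
        exact key }
  refine ⟨Nat.card V, hpos, G, ⟨fun i => wt (φ.symm i), fun i => hwt _, ?_⟩, ?_⟩
  · intro i
    rw [← hw (φ.symm i)]
    have : ∀ j, ((G.a i j : ℕ) : ℝ) * wt (φ.symm j) =
        ∑ e : ι (φ.symm i) with φ (tgt _ e) = j, wt (tgt _ e) := by
      intro j
      have h1 : ∑ e : ι (φ.symm i) with φ (tgt _ e) = j, wt (tgt _ e)
         = ∑ e : ι (φ.symm i) with φ (tgt _ e) = j, wt (φ.symm j) := by
        apply Finset.sum_congr rfl
        intro e he
        rw [Finset.mem_filter] at he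
        rw [← he.2]; simp
      rw [h1, Finset.sum_const, nsmul_eq_mul]
      congr 2
      change Fintype.card (T i j) = _
      rw [Fintype.card_subtype]
      congr 1
      ext e
      simp [Equiv.eq_symm_apply]
    simp_rw [this]
    exact Finset.sum_fiberwise _ _ _
  · change K v0 = K (φ.symm ⟨0, hpos⟩)
    rw [← hφ]; simp

/-- Separation property of zero-dimensional sets. -/
def AuxSep {X : Type*} [TopologicalSpace X] (A : Set X) : Prop :=
  ∀ P Q : Set X, IsClosed P → IsClosed Q → Disjoint P Q →
    ∃ A1 A2 : Set X, IsClosed A1 ∧ IsClosed A2 ∧ Disjoint A1 A2 ∧ A1 ∪ A2 = A ∧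
      P ∩ A ⊆ A1 ∧ Q ∩ A ⊆ A2

theorem aux_sep_of_td {X : Type*} [TopologicalSpace X] [T2Space X] {A : Set X}
    (hA : IsCompact A) (htd : IsTotallyDisconnected A) : AuxSep A := by
  intro P Q hP hQ hPQ
  have : CompactSpace A := isCompact_iff_compactSpace.1 hA
  have : TotallyDisconnectedSpace A := totallyDisconnectedSpace_subtype_iff.2 htd
  obtain ⟨C, hC, h1, h2⟩ := exists_clopen_of_closed_subset_open
    (X := A) (Z := (Subtype.val ⁻¹' P)) (U := (Subtype.val ⁻¹' Q)ᶜ)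
    (hP.preimage continuous_subtype_val)
    (hQ.preimage continuous_subtype_val).isOpen_compl
    (fun x hx hx' => Set.disjoint_left.1 hPQ hx hx')
  have hcl := hA.isClosed.isClosedEmbedding_subtypeVal
  refine ⟨Subtype.val '' C, Subtype.val '' Cᶜ, hcl.isClosedMap _ hC.1,
    hcl.isClosedMap _ hC.compl.1, ?_, ?_, ?_, ?_⟩
  · exact (Set.disjoint_image_iff Subtype.val_injective).2 disjoint_compl_right
  · rw [← Set.image_union, Set.union_compl_self]; simp
  · rintro x ⟨hx, hxA⟩
    exact ⟨⟨x, hxA⟩, h1 hx, rfl⟩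
  · rintro x ⟨hx, hxA⟩
    exact ⟨⟨x, hxA⟩, fun hxC => h2 hxC hx, rfl⟩

theorem aux_sep_union {X : Type*} [TopologicalSpace X] {A B : Set X}
    (hA : AuxSep A) (hB : AuxSep B) : AuxSep (A ∪ B) := by
  intro P Q hP hQ hPQ
  obtain ⟨A1, A2, c1, c2, d, u, s1, s2⟩ := hA P Q hP hQ hPQ
  have hd : Disjoint (P ∪ A1) (Q ∪ A2) := by
    rw [Set.disjoint_left] at *
    rintro x (hx | hx) (hy | hy)
    · exact hPQ hx hy
    · exact d (s1 ⟨hx, u ▸ Or.inr hy⟩) hy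
    · exact d hx (s2 ⟨hy, u ▸ Or.inl hx⟩)
    · exact d hx hy
  obtain ⟨B1, B2, c1', c2', d', u', s1', s2'⟩ :=
    hB (P ∪ A1) (Q ∪ A2) (hP.union c1) (hQ.union c2) hd
  refine ⟨A1 ∪ B1, A2 ∪ B2, c1.union c1', c2.union c2', ?_, ?_, ?_, ?_⟩
  · rw [Set.disjoint_left] at *
    rintro x (hx | hx) (hy | hy)
    · exact d hx hy
    · exact d' (s1' ⟨Or.inr hx, u' ▸ Or.inr hy⟩) hy
    · exact d' hx (s2' ⟨Or.inr hy, u' ▸ Or.inl hx⟩)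
    · exact d' hx hy
  · rw [← u, ← u']; ext x; simp only [Set.mem_union]; tauto
  · rintro x ⟨hx, h | h⟩
    · exact Or.inl (s1 ⟨hx, h⟩)
    · exact Or.inr (s1' ⟨Or.inl hx, h⟩)
  · rintro x ⟨hx, h | h⟩
    · exact Or.inl (s2 ⟨hx, h⟩)
    · exact Or.inr (s2' ⟨Or.inl hx, h⟩)

theorem aux_sep_biUnion {X ι : Type*} [TopologicalSpace X] {M : Set ι} (hM : M.Finite)
    (K : ι → Set X) (hK : ∀ i, AuxSep (K i)) : AuxSep (⋃ i ∈ M, K i) := by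
  induction M, hM using Set.Finite.induction_on with
  | empty =>
    intro P Q _ _ _
    exact ⟨∅, ∅, by simp⟩
  | insert _ _ ih =>
    rw [Set.biUnion_insert]
    exact aux_sep_union (hK _) ih

section AuxCells

variable {V : Type*} [NormedAddCommGroup V] [NormedSpace ℝ V]

/-- The cell `h E + a`. -/
def auxK (E : Set V) (c : (V ≃ₗᵢ[ℝ] V) × V) : Set V := (fun x => c.1 x + c.2) '' E

/-- The `i`-th child of a cell. -/
noncomputable def auxCh (n : ℕ) {m : ℕ} (g : Fin m → (V ≃ₗᵢ[ℝ] V)) (b : Fin m → V)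
    (c : (V ≃ₗᵢ[ℝ] V) × V) (i : Fin m) : (V ≃ₗᵢ[ℝ] V) × V :=
  (c.1 * g i, (n : ℝ) • (c.2 + c.1 (b i)))

/-- The cell of a (reversed) word. -/
noncomputable def auxCell (n : ℕ) {m : ℕ} (g : Fin m → (V ≃ₗᵢ[ℝ] V)) (b : Fin m → V) :
    List (Fin m) → (V ≃ₗᵢ[ℝ] V) × V
  | [] => (1, 0)
  | i :: w => auxCh n g b (auxCell n g b w) i

/-- Cells of level `t`. -/
noncomputable def auxL (n : ℕ) {m : ℕ} (g : Fin m → (V ≃ₗᵢ[ℝ] V)) (b : Fin m → V) :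
    ℕ → Finset ((V ≃ₗᵢ[ℝ] V) × V)
  | 0 => {(1, 0)}
  | t + 1 => (auxL n g b t ×ˢ Finset.univ).image (fun p => auxCh n g b p.1 p.2)

/-- Reachability through touching cells. -/
def auxR (E : Set V) (F : Finset ((V ≃ₗᵢ[ℝ] V) × V)) :
    (V ≃ₗᵢ[ℝ] V) × V → (V ≃ₗᵢ[ℝ] V) × V → Prop :=
  Relation.ReflTransGen (fun c d => (c ∈ F ∧ d ∈ F) ∧ (auxK E c ∩ auxK E d).Nonempty)

/-- Component of a cell. -/
noncomputable def auxComp (E : Set V) (F : Finset ((V ≃ₗᵢ[ℝ] V) × V)) (c : (V ≃ₗᵢ[ℝ] V) × V) :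
    Finset ((V ≃ₗᵢ[ℝ] V) × V) := F.filter (auxR E F c)

/-- Translation of a cell. -/
def auxSh (a : V) (c : (V ≃ₗᵢ[ℝ] V) × V) : (V ≃ₗᵢ[ℝ] V) × V := (c.1, c.2 + a)

/-- Union of cells. -/
def auxKs (E : Set V) (F : Finset ((V ≃ₗᵢ[ℝ] V) × V)) : Set V := ⋃ c ∈ F, auxK E c

theorem auxSh_inj (a : V) : Function.Injective (auxSh a) := by
  rintro ⟨h, x⟩ ⟨h', x'⟩ hh
  simpa [auxSh] using hh

theorem mem_auxK_sh {E : Set V} {a x : V} {c : (V ≃ₗᵢ[ℝ] V) × V} :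
    x ∈ auxK E (auxSh a c) ↔ x - a ∈ auxK E c := by
  simp only [auxK, auxSh, Set.mem_image]
  constructor
  · rintro ⟨y, hy, rfl⟩
    exact ⟨y, hy, by abel⟩
  · rintro ⟨y, hy, h⟩
    exact ⟨y, hy, by rw [← add_assoc, h]; abel⟩

theorem auxR_symm {E : Set V} {F : Finset ((V ≃ₗᵢ[ℝ] V) × V)} {c d : (V ≃ₗᵢ[ℝ] V) × V}
    (h : auxR E F c d) : auxR E F d c := by
  have hs : Std.Symm
      (fun c d => (c ∈ F ∧ d ∈ F) ∧ (auxK E c ∩ auxK E d).Nonempty) :=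
    ⟨fun a b hab => ⟨hab.1.symm, by rw [Set.inter_comm]; exact hab.2⟩⟩
  exact (Relation.ReflTransGen.stdSymm (r := fun c d =>
    (c ∈ F ∧ d ∈ F) ∧ (auxK E c ∩ auxK E d).Nonempty)).symm _ _ h

theorem auxComp_eq {E : Set V} {F : Finset ((V ≃ₗᵢ[ℝ] V) × V)} {c d : (V ≃ₗᵢ[ℝ] V) × V}
    (h : auxR E F c d) : auxComp E F c = auxComp E F d := by
  ext x
  simp only [auxComp, Finset.mem_filter, and_congr_right_iff]
  intro _
  exact ⟨fun h' => (auxR_symm h).trans h', fun h' => h.trans h'⟩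

theorem aux_wordMap_append {X : Type*} {m : ℕ} (S : Fin m → X → X) (w w' : List (Fin m)) :
    wordMap S (w ++ w') = wordMap S w ∘ wordMap S w' := by
  induction w with
  | nil => rfl
  | cons i w ih => simp [wordMap, ih, Function.comp_assoc]

variable {n m : ℕ} {g : Fin m → (V ≃ₗᵢ[ℝ] V)} {b : Fin m → V} {S : Fin m → V → V} {E : Set V}

theorem aux_wordMap (hn : n ≠ 0) (hS : ∀ i x, S i x = (n : ℝ)⁻¹ • (g i x) + b i)
    (w : List (Fin m)) (x : V) :
    wordMap S w.reverse x = ((n : ℝ)⁻¹) ^ w.length •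
      ((auxCell n g b w).1 x + (auxCell n g b w).2) := by
  have hn' : (n : ℝ) ≠ 0 := by exact_mod_cast hn
  induction w generalizing x with
  | nil => simp [wordMap, auxCell]
  | cons i w ih =>
    rw [List.reverse_cons, aux_wordMap_append]
    simp only [Function.comp_apply, wordMap, id, ih, hS, List.length_cons, auxCell, auxCh, pow_succ,
      mul_smul]
    congr 1
    simp only [map_add, map_smul, smul_add, smul_smul, inv_mul_cancel₀ hn', one_smul,
      LinearIsometryEquiv.coe_mul, Function.comp_apply]
    abel

theorem aux_mem_L {t : ℕ} {c : (V ≃ₗᵢ[ℝ] V) × V} (h : c ∈ auxL n g b t) :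
    ∃ w : List (Fin m), w.length = t ∧ auxCell n g b w = c := by
  induction t generalizing c with
  | zero =>
    simp only [auxL, Finset.mem_singleton] at h
    exact ⟨[], rfl, h.symm⟩
  | succ t ih =>
    simp only [auxL, Finset.mem_image, Finset.mem_product, Finset.mem_univ, and_true] at h
    obtain ⟨⟨c', i⟩, h', rfl⟩ := h
    obtain ⟨w, hw, rfl⟩ := ih h'
    exact ⟨i :: w, by simp [hw], rfl⟩

theorem aux_ch_inj (hn : n ≠ 0) (hS : ∀ i x, S i x = (n : ℝ)⁻¹ • (g i x) + b i)
    (hover : ¬ HasCompleteOverlaps S) {t : ℕ} {c c' : (V ≃ₗᵢ[ℝ] V) × V}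
    (h : c ∈ auxL n g b t) (h' : c' ∈ auxL n g b t) {i i' : Fin m}
    (heq : auxCh n g b c i = auxCh n g b c' i') : c = c' ∧ i = i' := by
  obtain ⟨w, hw, rfl⟩ := aux_mem_L h
  obtain ⟨w', hw', rfl⟩ := aux_mem_L h'
  by_contra hne
  apply hover
  refine ⟨(i :: w).reverse, (i' :: w').reverse, by simp, by simp, ?_, ?_⟩
  · intro hh
    have := List.reverse_injective hh
    rw [List.cons.injEq] at this
    exact hne ⟨by rw [this.2], this.1⟩
  · ext x
    rw [aux_wordMap hn hS, aux_wordMap hn hS]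
    simp only [auxCell, List.length_cons, hw, hw', heq]

theorem aux_L_succ {t : ℕ} {d : (V ≃ₗᵢ[ℝ] V) × V} :
    d ∈ auxL n g b (t + 1) ↔ ∃ c ∈ auxL n g b t, ∃ i, auxCh n g b c i = d := by
  simp only [auxL, Finset.mem_image, Finset.mem_product, Finset.mem_univ, and_true]
  constructor
  · rintro ⟨⟨c, i⟩, h, h'⟩
    exact ⟨c, h, i, h'⟩
  · rintro ⟨c, h, i, h'⟩
    exact ⟨⟨c, i⟩, h, h'⟩

theorem aux_L_grp {Γ : AddSubgroup V} {𝔾 : Subgroup (V ≃ₗᵢ[ℝ] V)}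
    (h𝔾Γ : ∀ g ∈ 𝔾, ∀ x ∈ Γ, g x ∈ Γ) (hg : ∀ i, g i ∈ 𝔾) (hb : ∀ i, b i ∈ Γ)
    {t : ℕ} {c : (V ≃ₗᵢ[ℝ] V) × V} (h : c ∈ auxL n g b t) : c.1 ∈ 𝔾 ∧ c.2 ∈ Γ := by
  induction t generalizing c with
  | zero =>
    simp only [auxL, Finset.mem_singleton] at h
    subst h
    exact ⟨𝔾.one_mem, Γ.zero_mem⟩
  | succ t ih =>
    obtain ⟨c', h', i, rfl⟩ := aux_L_succ.1 h
    obtain ⟨h1, h2⟩ := ih h'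
    refine ⟨𝔾.mul_mem h1 (hg i), ?_⟩
    simp only [auxCh]
    rw [Nat.cast_smul_eq_nsmul]
    exact Γ.nsmul_mem (Γ.add_mem h2 (h𝔾Γ _ h1 _ (hb i))) n

theorem aux_ch_sub (hn : n ≠ 0) (hS : ∀ i x, S i x = (n : ℝ)⁻¹ • (g i x) + b i)
    (hEeq : E = ⋃ i, S i '' E) {c : (V ≃ₗᵢ[ℝ] V) × V} {i : Fin m} {x : V}
    (hx : x ∈ auxK E (auxCh n g b c i)) : (n : ℝ)⁻¹ • x ∈ auxK E c := by
  have hn' : (n : ℝ) ≠ 0 := by exact_mod_cast hn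
  obtain ⟨y, hy, rfl⟩ := hx
  refine ⟨S i y, ?_, ?_⟩
  · rw [hEeq]
    exact Set.mem_iUnion.2 ⟨i, y, hy, rfl⟩
  · simp only [auxCh, hS, map_add, map_smul, smul_add, smul_smul, inv_mul_cancel₀ hn', one_smul,
      LinearIsometryEquiv.coe_mul, Function.comp_apply]
    abel

theorem aux_ch_ex (hn : n ≠ 0) (hS : ∀ i x, S i x = (n : ℝ)⁻¹ • (g i x) + b i)
    (hEeq : E = ⋃ i, S i '' E) {c : (V ≃ₗᵢ[ℝ] V) × V} {x : V}
    (hx : x ∈ auxK E c) : ∃ i, (n : ℝ) • x ∈ auxK E (auxCh n g b c i) := by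
  have hn' : (n : ℝ) ≠ 0 := by exact_mod_cast hn
  obtain ⟨y, hy, rfl⟩ := hx
  rw [hEeq] at hy
  obtain ⟨i, z, hz, rfl⟩ := Set.mem_iUnion.1 hy
  refine ⟨i, z, hz, ?_⟩
  simp only [auxCh, hS, map_add, map_smul, smul_add, smul_smul, mul_inv_cancel₀ hn', one_smul,
      LinearIsometryEquiv.coe_mul, Function.comp_apply]
  abel

theorem aux_anc (hn : n ≠ 0) (hS : ∀ i x, S i x = (n : ℝ)⁻¹ • (g i x) + b i)
    (hEeq : E = ⋃ i, S i '' E) (t k : ℕ) {d : (V ≃ₗᵢ[ℝ] V) × V}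
    (hd : d ∈ auxL n g b (t + k)) :
    ∃ p ∈ auxL n g b t, ∀ x ∈ auxK E d, ((n : ℝ)⁻¹) ^ k • x ∈ auxK E p := by
  induction k generalizing d with
  | zero => exact ⟨d, hd, by simp⟩
  | succ k ih =>
    obtain ⟨c, hc, i, rfl⟩ := aux_L_succ.1 (show d ∈ auxL n g b ((t + k) + 1) from hd)
    obtain ⟨p, hp, h⟩ := ih hc
    refine ⟨p, hp, fun x hx => ?_⟩
    rw [pow_succ, mul_smul]
    exact h _ (aux_ch_sub hn hS hEeq hx)

theorem aux_child_closed (hn : n ≠ 0) (hS : ∀ i x, S i x = (n : ℝ)⁻¹ • (g i x) + b i)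
    (hEeq : E = ⋃ i, S i '' E) {t : ℕ} {c d d' : (V ≃ₗᵢ[ℝ] V) × V}
    (hd : ∃ p ∈ auxComp E (auxL n g b t) c, ∃ i, auxCh n g b p i = d)
    (h : auxR E (auxL n g b (t + 1)) d d') :
    ∃ p ∈ auxComp E (auxL n g b t) c, ∃ i, auxCh n g b p i = d' := by
  induction h with
  | refl => exact hd
  | tail _ hstep ih =>
    obtain ⟨p, hp, i, rfl⟩ := ih
    obtain ⟨⟨_, hd'⟩, x, hx1, hx2⟩ := hstep
    obtain ⟨p', hp', i', rfl⟩ := aux_L_succ.1 hd'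
    refine ⟨p', ?_, i', rfl⟩
    simp only [auxComp, Finset.mem_filter] at hp ⊢
    refine ⟨hp', hp.2.tail ⟨⟨hp.1, hp'⟩, _, aux_ch_sub hn hS hEeq hx1, aux_ch_sub hn hS hEeq hx2⟩⟩

theorem aux_finite_cells [ProperSpace V] (Γ : AddSubgroup V) (hΓ : DiscreteTopology Γ)
    (𝔾 : Subgroup (V ≃ₗᵢ[ℝ] V)) (h𝔾fin : Finite 𝔾) (R : ℝ) :
    {c : (V ≃ₗᵢ[ℝ] V) × V | c.1 ∈ 𝔾 ∧ c.2 ∈ Γ ∧ ‖c.2‖ ≤ R}.Finite := by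
  have h1 : (Metric.closedBall (0 : V) R ∩ (Γ : Set V)).Finite :=
    Metric.finite_isBounded_inter_isClosed DiscreteTopology.isDiscrete
      Metric.isBounded_closedBall AddSubgroup.isClosed_of_discrete
  have h2 : (𝔾 : Set (V ≃ₗᵢ[ℝ] V)).Finite := Set.toFinite _
  refine (h2.prod h1).subset ?_
  rintro ⟨h, a⟩ ⟨ha, hb, hc⟩
  exact ⟨ha, by simpa using hc, hb⟩

theorem aux_sep_K (hEc : IsCompact E) (htd : IsTotallyDisconnected E)
    (c : (V ≃ₗᵢ[ℝ] V) × V) : IsCompact (auxK E c) ∧ AuxSep (auxK E c) := by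
  have hcont : Continuous (fun x => c.1 x + c.2) := by fun_prop
  have hi : Isometry (fun x => c.1 x + c.2) := by
    apply Isometry.of_dist_eq
    intro x y
    rw [dist_add_right, LinearIsometryEquiv.dist_map]
  have h := hEc.image hcont
  exact ⟨h, aux_sep_of_td h (hi.isEmbedding.isTotallyDisconnected_image.2 htd)⟩

theorem aux_bound [ProperSpace V] (hn : 2 ≤ n)
    (hS : ∀ i x, S i x = (n : ℝ)⁻¹ • (g i x) + b i)
    (hEeq : E = ⋃ i, S i '' E) (hEne : E.Nonempty) (hEc : IsCompact E)
    (htd : IsTotallyDisconnected E) {Γ : AddSubgroup V} (hΓ : DiscreteTopology Γ)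
    {𝔾 : Subgroup (V ≃ₗᵢ[ℝ] V)} (h𝔾fin : Finite 𝔾)
    (h𝔾Γ : ∀ g ∈ 𝔾, ∀ x ∈ Γ, g x ∈ Γ) (hg : ∀ i, g i ∈ 𝔾) (hb : ∀ i, b i ∈ Γ) :
    ∃ R : ℝ, ∀ t, ∀ c ∈ auxL n g b t, ∀ d ∈ auxL n g b t, auxR E (auxL n g b t) c d →
      ‖d.2 - c.2‖ ≤ R := by
  have hn0 : n ≠ 0 := by omega
  have hnR : (n : ℝ) ≠ 0 := by exact_mod_cast hn0
  have hn1 : (1 : ℝ) ≤ n := by exact_mod_cast (by omega : 1 ≤ n)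
  obtain ⟨D, hD, hED⟩ := hEc.isBounded.exists_pos_norm_le
  have hKn : ∀ (c : (V ≃ₗᵢ[ℝ] V) × V), ∀ x ∈ auxK E c, ‖x - c.2‖ ≤ D := by
    rintro c _ ⟨y, hy, rfl⟩
    simpa using hED y hy
  have hKne : ∀ (c : (V ≃ₗᵢ[ℝ] V) × V), (auxK E c).Nonempty := fun c => hEne.image _
  have hMfin := aux_finite_cells Γ hΓ 𝔾 h𝔾fin (3 * D)
  set M := {c : (V ≃ₗᵢ[ℝ] V) × V | c.1 ∈ 𝔾 ∧ c.2 ∈ Γ ∧ ‖c.2‖ ≤ 3 * D} with hM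
  have hsep := aux_sep_biUnion hMfin (auxK E) (fun c => (aux_sep_K hEc htd c).2)
  have hcomp : IsCompact (⋃ c ∈ M, auxK E c) :=
    hMfin.isCompact_biUnion (fun c _ => (aux_sep_K hEc htd c).1)
  obtain ⟨A, B, cA, cB, dAB, uAB, hPA, hQB⟩ := hsep (Metric.closedBall 0 D)
    (Metric.ball 0 (2 * D))ᶜ Metric.isClosed_closedBall Metric.isOpen_ball.isClosed_compl (by
      rw [Set.disjoint_compl_right_iff_subset]
      exact Metric.closedBall_subset_ball (by linarith))
  have hA2 : ∀ x ∈ A, ‖x‖ < 2 * D := by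
    intro x hx
    by_contra hlt
    refine Set.disjoint_left.1 dAB hx (hQB ⟨?_, uAB ▸ Or.inl hx⟩)
    simpa using hlt
  have hAc : IsCompact A := hcomp.of_isClosed_subset cA (uAB ▸ Set.subset_union_left)
  obtain ⟨δ, hδ, hsepd⟩ := Metric.exists_pos_forall_lt_edist hAc cB dAB
  have hδ' : (0 : ℝ) < δ := hδ
  obtain ⟨k, hk⟩ := exists_pow_lt_of_lt_one (show (0 : ℝ) < δ / (2 * D) by positivity)
    (show ((n : ℝ)⁻¹) < 1 from inv_lt_one_of_one_lt₀ (by exact_mod_cast (by omega : 1 < n)))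
  rw [lt_div_iff₀ (by positivity)] at hk
  have hinv : (n : ℝ) ^ k * ((n : ℝ)⁻¹) ^ k = 1 := by
    rw [← mul_pow, mul_inv_cancel₀ hnR, one_pow]
  have hnk : (0 : ℝ) < (n : ℝ) ^ k := by positivity
  have hik : (0 : ℝ) < ((n : ℝ)⁻¹) ^ k := by positivity
  -- the bound from points of the cells
  have hpts : ∀ (c d : (V ≃ₗᵢ[ℝ] V) × V), ∀ x ∈ auxK E c, ∀ y ∈ auxK E d,
      ‖d.2 - c.2‖ ≤ ‖y - x‖ + 2 * D := by
    intro c d x hx y hy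
    have h1 := hKn c x hx
    have h2 := hKn d y hy
    have : d.2 - c.2 = (y - x) + (x - c.2) - (y - d.2) := by abel
    rw [this]
    have h3 := norm_sub_le ((y - x) + (x - c.2)) (y - d.2)
    have h4 := norm_add_le (y - x) (x - c.2)
    linarith
  refine ⟨(n : ℝ) ^ k * (4 * D) + 2 * D, fun s c hc d hd hcd => ?_⟩
  obtain ⟨x, hx⟩ := hKne c
  obtain ⟨y, hy⟩ := hKne d
  refine (hpts c d x hx y hy).trans ?_
  have main : ∀ z w : V, ‖((n : ℝ)⁻¹) ^ k • z - w‖ ≤ 2 * D → ∀ z' : V,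
      ‖((n : ℝ)⁻¹) ^ k • z' - w‖ ≤ 2 * D → ‖z' - z‖ ≤ (n : ℝ) ^ k * (4 * D) := by
    intro z w h z' h'
    have h1 : z' - z = (n : ℝ) ^ k • ((((n : ℝ)⁻¹) ^ k • z' - w) - (((n : ℝ)⁻¹) ^ k • z - w)) := by
      rw [sub_sub_sub_cancel_right, ← smul_sub, smul_smul, hinv, one_smul]
    rw [h1, norm_smul, Real.norm_of_nonneg hnk.le]
    gcongr
    refine (norm_sub_le _ _).trans (by linarith)
  have hgoal : ‖y - x‖ ≤ (n : ℝ) ^ k * (4 * D) := by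
    rcases lt_or_ge s k with hsk | hsk
    · -- small levels
      have hsmall : ∀ c ∈ auxL n g b s, ∀ x ∈ auxK E c, ‖((n : ℝ)⁻¹) ^ k • x - 0‖ ≤ 2 * D := by
        intro c hc x hx
        obtain ⟨p, hp, h⟩ := aux_anc (E := E) hn0 hS hEeq 0 s (d := c) (by simpa using hc)
        simp only [auxL, Finset.mem_singleton] at hp
        subst hp
        have h1 := hKn _ _ (h x hx)
        simp only [sub_zero, norm_smul, norm_pow, norm_inv, Real.norm_natCast] at h1 ⊢
        have h2 : ((n : ℝ)⁻¹) ^ k ≤ ((n : ℝ)⁻¹) ^ s :=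
          pow_le_pow_of_le_one (by positivity) (inv_le_one_of_one_le₀ hn1) hsk.le
        have h3 := mul_le_mul_of_nonneg_right h2 (norm_nonneg x)
        linarith
      exact main x 0 (hsmall c hc x hx) y (hsmall d hd y hy)
    · obtain ⟨t, rfl⟩ : ∃ t, s = t + k := ⟨s - k, by omega⟩
      obtain ⟨p0, hp0, hanc0⟩ := aux_anc (E := E) hn0 hS hEeq t k hc
      have hp0g := aux_L_grp h𝔾Γ hg hb hp0
      have hbase : ∀ x ∈ auxK E c, ((n : ℝ)⁻¹) ^ k • x - p0.2 ∈ A := by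
        intro x hx
        have h1 := hanc0 x hx
        refine hPA ⟨by simpa using hKn _ _ h1, ?_⟩
        refine Set.mem_biUnion (x := auxSh (-p0.2) p0) ⟨hp0g.1, ?_, ?_⟩ ?_
        · simp [auxSh]
        · simp [auxSh]; positivity
        · rw [mem_auxK_sh]; simpa using h1
      have hall : ∀ x ∈ auxK E d, ((n : ℝ)⁻¹) ^ k • x - p0.2 ∈ A := by
        clear hy hd
        induction hcd with
        | refl => exact hbase
        | @tail d d' _ hstep ih =>
          obtain ⟨⟨_, hd'⟩, x, hx1, hx2⟩ := hstep
          intro y hy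
          obtain ⟨p, hp, hanc⟩ := aux_anc (E := E) hn0 hS hEeq t k hd'
          have hpg := aux_L_grp h𝔾Γ hg hb hp
          have hxA := ih x hx1
          have hxn := hA2 _ hxA
          have hMp : auxSh (-p0.2) p ∈ M := by
            refine ⟨hpg.1, ?_, ?_⟩
            · exact Γ.add_mem hpg.2 (Γ.neg_mem hp0g.2)
            · have h1 := hKn _ _ (hanc x hx2)
              have h2 : (auxSh (-p0.2) p).2 = (((n : ℝ)⁻¹) ^ k • x - p0.2)
                - (((n : ℝ)⁻¹) ^ k • x - p.2) := by simp only [auxSh]; abel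
              rw [h2]
              refine (norm_sub_le _ _).trans (by linarith)
          have hyU : ((n : ℝ)⁻¹) ^ k • y - p0.2 ∈ A ∪ B := by
            rw [uAB]
            refine Set.mem_biUnion hMp ?_
            rw [mem_auxK_sh]; simpa using hanc y hy
          rcases hyU with h | h
          · exact h
          · exfalso
            have h1 := hsepd _ hxA _ h
            rw [edist_dist, ENNReal.coe_nnreal_eq, ENNReal.ofReal_lt_ofReal_iff_of_nonneg hδ'.le,
              dist_sub_right, dist_eq_norm, ← smul_sub, norm_smul, Real.norm_of_nonneg hik.le] at h1
            have h2 : ‖x - y‖ ≤ 2 * D := by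
              have e1 := hKn _ _ hx2
              have e2 := hKn _ _ hy
              have : x - y = (x - d'.2) - (y - d'.2) := by abel
              rw [this]
              refine (norm_sub_le _ _).trans (by linarith)
            have h3 := mul_le_mul_of_nonneg_left h2 hik.le
            linarith
      exact main x p0.2 (hA2 _ (hbase x hx)).le y (hA2 _ (hall y hy)).le
  linarith

end AuxCells

/-- **Theorem 3 (graph-directed part).** Let `Γ` be a discrete additive subgroup
of `ℝ^l`, `𝔾` a finite group of linear isometries of `ℝ^l` preserving `Γ`, and
`n ≥ 2` an integer. Suppose `E = ⋃_{i=1}^m (gᵢ E / n + bᵢ) ∈ Λ` (with `gᵢ ∈ 𝔾`,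
`bᵢ ∈ Γ`) is a totally disconnected self-similar set without complete overlaps.
Then `E ∈ 𝔄_m^{1/n}`: `E = K_1` for some dust-like graph-directed sets
`K_1, …, K_p` with ratio `1/n` and integer characteristic `m`. -/
theorem selfSimilar_lambda_mem_gdClass {l : ℕ}
    (Γ : AddSubgroup (EuclideanSpace ℝ (Fin l))) (hΓ : DiscreteTopology Γ)
    (𝔾 : Subgroup (EuclideanSpace ℝ (Fin l) ≃ₗᵢ[ℝ] EuclideanSpace ℝ (Fin l)))
    (h𝔾fin : Finite 𝔾) (h𝔾Γ : ∀ g ∈ 𝔾, ∀ x ∈ Γ, g x ∈ Γ)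
    (n : ℕ) (hn : 2 ≤ n) (m : ℕ)
    (g : Fin m → (EuclideanSpace ℝ (Fin l) ≃ₗᵢ[ℝ] EuclideanSpace ℝ (Fin l)))
    (b : Fin m → EuclideanSpace ℝ (Fin l))
    (hg : ∀ i, g i ∈ 𝔾) (hb : ∀ i, b i ∈ Γ)
    (S : Fin m → EuclideanSpace ℝ (Fin l) → EuclideanSpace ℝ (Fin l))
    (hS : ∀ i x, S i x = (n : ℝ)⁻¹ • (g i x) + b i)
    (E : Set (EuclideanSpace ℝ (Fin l)))
    (hEne : E.Nonempty) (hEc : IsCompact E)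
    (hEeq : E = ⋃ i, S i '' E)
    (htd : IsTotallyDisconnected E)
    (hover : ¬ HasCompleteOverlaps S) :
    MemGDClass E ((n : ℝ)⁻¹) m := by
  have hn0 : n ≠ 0 := by omega
  have hnR : (n : ℝ) ≠ 0 := by exact_mod_cast hn0
  obtain ⟨R, hR⟩ := aux_bound hn hS hEeq hEne hEc htd hΓ h𝔾fin h𝔾Γ hg hb
  let W := EuclideanSpace ℝ (Fin l)
  let good : Set (Finset ((W ≃ₗᵢ[ℝ] W) × W)) := {C | ∃ t, ∃ c ∈ auxL n g b t,
    C = (auxComp E (auxL n g b t) c).image (auxSh (-c.2))}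
  have hfin : good.Finite := by
    have hM := aux_finite_cells Γ hΓ 𝔾 h𝔾fin R
    refine (hM.toFinset.powerset.finite_toSet).subset ?_
    rintro C ⟨t, c, hc, rfl⟩
    simp only [Finset.coe_powerset, Set.Finite.coe_toFinset, Set.mem_preimage, Set.mem_powerset_iff]
    intro d hd
    simp only [Finset.coe_image, Set.mem_image, Finset.mem_coe, auxComp, Finset.mem_filter] at hd
    obtain ⟨d, ⟨hd, hr⟩, rfl⟩ := hd
    have h1 := aux_L_grp h𝔾Γ hg hb hc
    have h2 := aux_L_grp h𝔾Γ hg hb hd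
    refine ⟨h2.1, Γ.add_mem h2.2 (Γ.neg_mem h1.2), ?_⟩
    have := hR t c hc d hd hr
    simpa [auxSh, sub_eq_add_neg] using this
  have : Finite good := hfin
  have hself : ∀ t, ∀ c ∈ auxL n g b t, c ∈ auxComp E (auxL n g b t) c := by
    intro t c hc
    simp only [auxComp, Finset.mem_filter]
    exact ⟨hc, Relation.ReflTransGen.refl⟩
  have hgne : ∀ C ∈ good, C.Nonempty := by
    rintro C ⟨t, c, hc, rfl⟩
    exact ⟨_, Finset.mem_image_of_mem _ (hself t c hc)⟩
  have hKs : ∀ (C : Finset ((W ≃ₗᵢ[ℝ] W) × W)) (a x : W),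
      x ∈ auxKs E (C.image (auxSh (-a))) ↔ ∃ c ∈ C, x + a ∈ auxK E c := by
    intro C a x
    simp only [auxKs, Set.mem_iUnion, Finset.mem_image, exists_prop]
    constructor
    · rintro ⟨_, ⟨c, hc, rfl⟩, hx⟩
      rw [mem_auxK_sh] at hx
      exact ⟨c, hc, by simpa using hx⟩
    · rintro ⟨c, hc, hx⟩
      exact ⟨_, ⟨c, hc, rfl⟩, by rw [mem_auxK_sh]; simpa using hx⟩
  have h0 : ({(1, 0)} : Finset ((W ≃ₗᵢ[ℝ] W) × W)) ∈ good := by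
    have hm : ((1, 0) : (W ≃ₗᵢ[ℝ] W) × W) ∈ auxL n g b 0 := by simp [auxL]
    refine ⟨0, (1, 0), hm, ?_⟩
    have : auxComp E (auxL n g b 0) (1, 0) = {(1, 0)} := by
      apply Finset.Subset.antisymm
      · intro d hd
        simp only [auxComp, Finset.mem_filter] at hd
        exact hd.1
      · simpa using hself 0 _ hm
    rw [this]
    simp [auxSh]
  have hE0 : E = auxKs E ({(1, 0)} : Finset ((W ≃ₗᵢ[ℝ] W) × W)) := by
    simp [auxKs, auxK]
  have key : MemGDClass (auxKs E (⟨_, h0⟩ : good).1) ((n : ℝ)⁻¹) m := by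
    refine aux_memGD_of (V := good) (fun v => auxKs E v.1) (fun v => (v.1.card : ℝ)) _ m
      ?_ ?_ ?_ ?_ ⟨_, h0⟩
    · rintro ⟨C, hC⟩
      have := Finset.card_pos.2 (hgne C hC)
      exact_mod_cast this
    · rintro ⟨C, hC⟩
      obtain ⟨c, hc⟩ := hgne C hC
      obtain ⟨x, hx⟩ := hEne
      exact ⟨_, Set.mem_biUnion hc ⟨x, hx, rfl⟩⟩
    · rintro ⟨C, hC⟩
      exact C.finite_toSet.isCompact_biUnion (fun c _ => (aux_sep_K hEc htd c).1)
    · rintro ⟨_, t, c, hc, rfl⟩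
      let C := auxComp E (auxL n g b t) c
      have hCL : ∀ p ∈ C, p ∈ auxL n g b t := fun p hp => (Finset.mem_filter.1 hp).1
      let ch : Finset ((W ≃ₗᵢ[ℝ] W) × W) :=
        (C ×ˢ Finset.univ).image (fun p => auxCh n g b p.1 p.2)
      have hch : ∀ d, d ∈ ch ↔ ∃ p ∈ C, ∃ i, auxCh n g b p i = d := by
        intro d
        simp only [ch, Finset.mem_image, Finset.mem_product, Finset.mem_univ, and_true]
        constructor
        · rintro ⟨⟨p, i⟩, h, h'⟩
          exact ⟨p, h, i, h'⟩
        · rintro ⟨p, h, i, h'⟩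
          exact ⟨⟨p, i⟩, h, h'⟩
      have hchL : ∀ d ∈ ch, d ∈ auxL n g b (t + 1) := by
        intro d hd
        obtain ⟨p, hp, i, rfl⟩ := (hch d).1 hd
        exact aux_L_succ.2 ⟨p, hCL p hp, i, rfl⟩
      have hclosed : ∀ d ∈ ch, ∀ d', auxR E (auxL n g b (t + 1)) d d' → d' ∈ ch := by
        intro d hd d' hr
        exact (hch d').2 (aux_child_closed hn0 hS hEeq ((hch d).1 hd) hr)
      let Ed : Finset (Finset ((W ≃ₗᵢ[ℝ] W) × W)) := ch.image (auxComp E (auxL n g b (t + 1)))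
      have hEd : ∀ e : Ed, ∃ d ∈ ch, auxComp E (auxL n g b (t + 1)) d = e.1 := fun e =>
        Finset.mem_image.1 e.2
      choose dd hdd hdde using hEd
      have hmemE : ∀ (e : Ed) q, q ∈ e.1 → q ∈ ch ∧ auxComp E (auxL n g b (t + 1)) q = e.1 := by
        intro e q hq
        rw [← hdde e] at hq ⊢
        have hq' := (Finset.mem_filter.1 hq).2
        exact ⟨hclosed _ (hdd e) _ hq', (auxComp_eq hq').symm⟩
      refine ⟨Ed, inferInstance, fun e => ⟨e.1.image (auxSh (-(dd e).2)),
        t + 1, dd e, hchL _ (hdd e), by rw [hdde e]⟩,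
        fun e x => (n : ℝ)⁻¹ • (x + (dd e).2) - c.2, ?_, ?_, ?_, ?_⟩
      · intro e x y
        rw [dist_sub_right, dist_eq_norm, dist_eq_norm, ← smul_sub, norm_smul,
          add_sub_add_right_eq_sub, Real.norm_of_nonneg (by positivity)]
      · ext x
        simp only [Set.mem_iUnion, Set.mem_image]
        rw [hKs]
        constructor
        · rintro ⟨p, hp, hx⟩
          obtain ⟨i, hi⟩ := aux_ch_ex hn0 hS hEeq hx
          have hq : auxCh n g b p i ∈ ch := (hch _).2 ⟨p, hp, i, rfl⟩
          let e0 : Ed := ⟨_, Finset.mem_image_of_mem _ hq⟩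
          refine ⟨e0, (n : ℝ) • (x + c.2) - (dd e0).2, ?_, ?_⟩
          · rw [hKs]
            exact ⟨auxCh n g b p i, hself _ _ (hchL _ hq), by simpa using hi⟩
          · rw [sub_add_cancel, smul_smul, inv_mul_cancel₀ hnR, one_smul, add_sub_cancel_right]
        · rintro ⟨e, y, hy, rfl⟩
          rw [hKs] at hy
          obtain ⟨q, hq, hy⟩ := hy
          obtain ⟨p, hp, i, rfl⟩ := (hch q).1 (hmemE e q hq).1
          exact ⟨p, hp, by simpa using aux_ch_sub hn0 hS hEeq hy⟩
      · intro e e' hne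
        rw [Set.disjoint_left]
        rintro _ ⟨y, hy, rfl⟩ ⟨y', hy', heq⟩
        apply hne
        have heq' : y' + (dd e').2 = y + (dd e).2 := by
          have := sub_left_injective heq
          exact smul_right_injective _ (inv_ne_zero hnR) this
        rw [hKs] at hy hy'
        obtain ⟨q, hq, hy⟩ := hy
        obtain ⟨q', hq', hy'⟩ := hy'
        rw [heq'] at hy'
        obtain ⟨a1, a2⟩ := hmemE e q hq
        obtain ⟨b1, b2⟩ := hmemE e' q' hq'
        apply Subtype.ext
        rw [← a2, ← b2]
        exact auxComp_eq (Relation.ReflTransGen.single ⟨⟨hchL _ a1, hchL _ b1⟩, _, hy, hy'⟩)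
      · simp only [Finset.card_image_of_injective _ (auxSh_inj _)]
        have hcard : ch.card = C.card * m := by
          rw [Finset.card_image_of_injOn, Finset.card_product, Finset.card_univ, Fintype.card_fin]
          rintro ⟨p, i⟩ hp ⟨p', i'⟩ hp' heq
          simp only [Finset.coe_product, Set.mem_prod, Finset.mem_coe] at hp hp'
          obtain ⟨h1, h2⟩ := aux_ch_inj hn0 hS hover (hCL _ hp.1) (hCL _ hp'.1) heq
          exact Prod.ext h1 h2
        have hsum := Finset.card_eq_sum_card_image (auxComp E (auxL n g b (t + 1))) ch
        have hfib : ∀ e ∈ Ed, (ch.filter (fun d => auxComp E (auxL n g b (t + 1)) d = e)).card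
            = e.card := by
          intro e he
          congr 1
          ext q
          rw [Finset.mem_filter]
          constructor
          · rintro ⟨h1, rfl⟩
            exact hself _ _ (hchL _ h1)
          · exact fun hq => hmemE ⟨e, he⟩ q hq
        rw [Finset.sum_congr rfl hfib, hcard] at hsum
        rw [Finset.sum_coe_sort Ed (fun e => (e.card : ℝ)), ← Nat.cast_sum, ← hsum]
        push_cast
        ring
  have hE1 : auxKs E (⟨_, h0⟩ : good).1 = E := hE0.symm
  rw [hE1] at key
  exact key
end

section
/- Let a_1, …, a_s (s ≥ 2) be positive integers with gcd(a_1,…,a_s) = 1, and let φ ∈ ℕ be such that for every integer N > φ there exist nonnegative integers x_1,…,x_s with a_1 x_1 + ⋯ + a_s x_s = N. Let b, c be positive integers with b > 2s·(max_t a_t)·(max_t a_t + φ). Let Ω be a finite index set, θ : Ω → {1,…,s} a map, and set l_ω = a_{θ(ω)} for ω ∈ Ω. Suppose ∑_{ω ∈ Ω} l_ω = b·c and, for every j ∈ {1,…,s}, #{ω ∈ Ω : θ(ω) = j} ≥ (max_t a_t + φ)·c. Then there is a partition Ω = Ω_1 ∪ ⋯ ∪ Ω_c into pairwise disjoint subsets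 such that ∑_{ω ∈ Ω_t} l_ω = b for every 1 ≤ t ≤ c. -/
theorem fpl_greedy {s : ℕ} (a m : Fin s → ℕ) (M : ℕ) (hM : 0 < M) (haM : ∀ j, a j ≤ M)
    (ha : ∀ j, 0 < a j) (B : ℕ) (hB : B ≤ ∑ j, a j * m j) :
    ∃ y : Fin s → ℕ, (∀ j, y j ≤ m j) ∧ ∑ j, a j * y j ≤ B ∧ B < ∑ j, a j * y j + M := by
  induction B with
  | zero => exact ⟨fun _ => 0, by simp, by simp, by simpa using hM⟩
  | succ B ih =>
    obtain ⟨y, h1, h2, h3⟩ := ih (by omega)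
    by_cases h : B + 1 < ∑ j, a j * y j + M
    · exact ⟨y, h1, by omega, h⟩
    have hlt : ∑ j, a j * y j < ∑ j, a j * m j := by omega
    obtain ⟨j, -, hj⟩ := Finset.exists_lt_of_sum_lt hlt
    have hj' : y j < m j := lt_of_mul_lt_mul_left hj (Nat.zero_le _)
    have hs : ∑ i, a i * (y i + if i = j then 1 else 0) = ∑ i, a i * y i + a j := by
      simp [mul_add, Finset.sum_add_distrib]
    have := haM j
    have := ha j
    refine ⟨fun i => y i + if i = j then 1 else 0, ?_, ?_, ?_⟩
    · intro i
      have := h1 i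
      by_cases hij : i = j
      · subst hij; simp; omega
      · simp [hij, this]
    · simp only [hs]; omega
    · simp only [hs]; omega

theorem fpl_sum {s : ℕ} (a : Fin s → ℕ) {Ω : Type*} (θ : Ω → Fin s) (S : Finset Ω) :
    ∑ ω ∈ S, a (θ ω) = ∑ j, a j * (S.filter fun ω => θ ω = j).card := by
  classical
  rw [← Finset.sum_fiberwise S θ]
  refine Finset.sum_congr rfl fun j _ => ?_
  rw [Finset.sum_congr rfl (g := fun _ => a j)]
  · simp [mul_comm]
  · intro x hx
    rw [(Finset.mem_filter.1 hx).2]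

theorem fpl_num {s : ℕ} (a : Fin s → ℕ) (ha : ∀ j, 0 < a j) (M φ : ℕ) (hM : 0 < M) (hs : 2 ≤ s)
    (haM : ∀ j, a j ≤ M)
    (hφ : ∀ N : ℕ, φ < N → ∃ x : Fin s → ℕ, ∑ j, a j * x j = N)
    (b c : ℕ) (hb : 2 * s * M * (M + φ) < b) (n : Fin s → ℕ)
    (hsum : ∑ j, a j * n j = b * (c + 2))
    (hn : ∀ j, (M + φ) * (c + 2) ≤ n j) :
    ∃ x : Fin s → ℕ, ∑ j, a j * x j = b ∧ ∀ j, x j + (M + φ) * (c + 1) ≤ n j := by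
  choose m hm using fun j => Nat.exists_eq_add_of_le (hn j)
  have hA : ∑ j, a j ≤ s * M := by
    calc ∑ j, a j ≤ ∑ _j : Fin s, M := Finset.sum_le_sum fun j _ => haM j
      _ = s * M := by simp
  have h1 : (∑ j, a j) * ((M + φ) * (c + 2)) + ∑ j, a j * m j = b * (c + 2) := by
    rw [← hsum, Finset.sum_mul, ← Finset.sum_add_distrib]
    refine Finset.sum_congr rfl fun j _ => ?_
    rw [hm j]; ring
  have h2 : 2 * ((∑ j, a j) * (M + φ)) ≤ b := by
    have := Nat.mul_le_mul_right (M + φ) hA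
    nlinarith
  have h3 : b ≤ ∑ j, a j * m j := by
    have := Nat.mul_le_mul_right (c + 2) h2
    nlinarith [Nat.zero_le (b * c)]
  have h4 : φ + 1 ≤ b := by
    have : 1 * (M + φ) ≤ 2 * s * M * (M + φ) :=
      Nat.mul_le_mul_right _ (Nat.mul_pos (by omega) hM)
    omega
  obtain ⟨y, hy1, hy2, hy3⟩ := fpl_greedy a m M hM haM ha (b - (φ + 1)) (by omega)
  obtain ⟨x, hx⟩ := hφ (b - ∑ j, a j * y j) (by omega)
  refine ⟨fun j => y j + x j, ?_, ?_⟩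
  · simp only [mul_add, Finset.sum_add_distrib]; omega
  · intro j
    have e1 : a j * x j ≤ ∑ j, a j * x j :=
      Finset.single_le_sum (f := fun j => a j * x j) (fun _ _ => Nat.zero_le _) (Finset.mem_univ j)
    have e2 : x j ≤ a j * x j := Nat.le_mul_of_pos_left _ (ha j)
    have e3 : x j ≤ M + φ := by omega
    have := hy1 j
    rw [hm j]
    nlinarith

theorem fpl_ind {s : ℕ} (a : Fin s → ℕ) (ha : ∀ j, 0 < a j) (M φ : ℕ) (hM : 0 < M) (hs : 2 ≤ s)
    (haM : ∀ j, a j ≤ M)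
    (hφ : ∀ N : ℕ, φ < N → ∃ x : Fin s → ℕ, ∑ j, a j * x j = N)
    (b : ℕ) (hb : 2 * s * M * (M + φ) < b) {Ω : Type*} (θ : Ω → Fin s) (c : ℕ) :
    ∀ S : Finset Ω, ∑ ω ∈ S, a (θ ω) = b * (c + 1) →
    (∀ j, (M + φ) * (c + 1) ≤ (S.filter fun ω => θ ω = j).card) →
    ∃ P : Ω → ℕ, (∀ ω, P ω < c + 1) ∧
      ∀ t < c + 1, ∑ ω ∈ S.filter (fun ω => P ω = t), a (θ ω) = b := by
  classical
  induction c with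
  | zero =>
    intro S h _
    refine ⟨fun _ => 0, by simp, ?_⟩
    intro t ht
    obtain rfl : t = 0 := by omega
    simpa using h
  | succ c ih =>
    intro S h hc
    obtain ⟨x, hx1, hx2⟩ := fpl_num a ha M φ hM hs haM hφ b c hb
      (fun j => (S.filter fun ω => θ ω = j).card) (by rw [← fpl_sum]; exact h) hc
    choose T hT hTc using fun j => Finset.exists_subset_card_eq
      (show x j ≤ (S.filter fun ω => θ ω = j).card by have := hx2 j; omega)
    let U := S.filter fun ω => ω ∈ T (θ ω)
    have hUS : U ⊆ S := Finset.filter_subset _ _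
    have hU : ∀ j, (U.filter fun ω => θ ω = j) = T j := by
      intro j
      ext ω
      simp only [U, Finset.mem_filter]
      constructor
      · rintro ⟨⟨_, h⟩, rfl⟩; exact h
      · intro h
        obtain ⟨h1, rfl⟩ := Finset.mem_filter.1 (hT j h)
        exact ⟨⟨h1, h⟩, rfl⟩
    have hUsum : ∑ ω ∈ U, a (θ ω) = b := by
      rw [fpl_sum, ← hx1]
      exact Finset.sum_congr rfl fun j _ => by rw [hU, hTc]
    have hsd := Finset.sum_sdiff (f := fun ω => a (θ ω)) hUS
    obtain ⟨P, hP1, hP2⟩ := ih (S \ U) (by simp only [hUsum, h] at hsd; nlinarith) (by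
      intro j
      have e : ((S \ U).filter fun ω => θ ω = j) = (S.filter fun ω => θ ω = j) \ T j := by
        rw [← hU j]; ext ω; simp only [Finset.mem_filter, Finset.mem_sdiff]; tauto
      rw [e, Finset.card_sdiff_of_subset (hT j), hTc]
      have := hx2 j
      omega)
    refine ⟨fun ω => if ω ∈ U then c + 1 else P ω, ?_, ?_⟩
    · intro ω
      have := hP1 ω
      dsimp only
      split_ifs <;> omega
    · intro t ht
      by_cases htc : t = c + 1
      · rw [← hUsum]
        congr 1
        ext ω
        have := hP1 ω
        simp only [Finset.mem_filter]
        constructor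
        · rintro ⟨_, h⟩
          by_contra hn
          simp only [hn, if_false] at h
          omega
        · intro h
          exact ⟨hUS h, by simp [h, htc]⟩
      · rw [← hP2 t (by omega)]
        congr 1
        ext ω
        simp only [Finset.mem_filter, Finset.mem_sdiff]
        by_cases h : ω ∈ U
        · simp [h]; omega
        · simp [h]

/-- **Combinatorial lemma from the Frobenius coin problem.** Let `a₁, …, a_s`
(`s ≥ 2`) be positive integers with `gcd(a₁, …, a_s) = 1` and let `φ` be a
Frobenius-type bound: every integer `N > φ` is a nonnegative integer combination
of the `aⱼ`. Let `b, c` be positive integers with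
`b > 2 s (maxₜ aₜ)(maxₜ aₜ + φ)`. Let `Ω` be a finite index set, `θ : Ω → Fin s`,
and `l_ω = a_{θ(ω)}`. If `∑_{ω ∈ Ω} l_ω = b c` and for every `j` the set
`{ω : θ(ω) = j}` has at least `(maxₜ aₜ + φ) c` elements, then `Ω` can be
partitioned into `c` parts `Ω₁, …, Ω_c` with `∑_{ω ∈ Ωₜ} l_ω = b` for every `t`. -/
theorem frobenius_partition_lemma
    (s : ℕ) (hs : 2 ≤ s) (a : Fin s → ℕ) (ha : ∀ j, 0 < a j)
    (hgcd : Finset.univ.gcd a = 1)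
    (φ : ℕ) (hφ : ∀ N : ℕ, φ < N → ∃ x : Fin s → ℕ, ∑ j, a j * x j = N)
    (b c : ℕ) (hc : 0 < c)
    (hb : 2 * s * (Finset.univ.sup a) * (Finset.univ.sup a + φ) < b)
    (Ω : Type*) [Fintype Ω] (θ : Ω → Fin s)
    (hsum : ∑ ω : Ω, a (θ ω) = b * c)
    (hcard : ∀ j : Fin s,
      (Finset.univ.sup a + φ) * c ≤ (Finset.univ.filter fun ω => θ ω = j).card) :
    ∃ P : Ω → Fin c, ∀ t : Fin c,
      ∑ ω ∈ Finset.univ.filter (fun ω => P ω = t), a (θ ω) = b := by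
  obtain ⟨c, rfl⟩ : ∃ d, c = d + 1 := ⟨c - 1, by omega⟩
  have haM : ∀ j, a j ≤ Finset.univ.sup a := fun j => Finset.le_sup (Finset.mem_univ j)
  have hM : 0 < Finset.univ.sup a := lt_of_lt_of_le (ha ⟨0, by omega⟩) (haM _)
  obtain ⟨P, h1, h2⟩ := fpl_ind a ha _ φ hM hs haM hφ b hb θ c Finset.univ hsum hcard
  refine ⟨fun ω => ⟨P ω, h1 ω⟩, fun t => ?_⟩
  rw [← h2 t t.2]
  simp only [Fin.ext_iff]
end
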